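/- For any constants a, b > 0 with a + b < 1/2 and any constant C₀ > 0, there exist ε > 0, C > 0 and N such that the following holds for all n ≥ N. Let d = (d_1,…,d_n) be a graphical degree sequence satisfying δ ≤ C₀ n^{1/2+ε} and min{d̄, n − d̄ − 1} ≥ n/(3a log n), and let r be a positive integer with r ≤ C₀ n^{1/2+ε} and δ³ r⁴/(λ³ n³) ≤ C₀ n^{−b}. Then the expected number of r-cliques in G ∼ 𝒢_d equals C(n,r) λ^{C(r,2)} exp( −(1−λ) r²(r−3)/(2λn) + R r³/(2λ²n²) − (1−λ)(2+5λ) r⁴/(12λ²n²) + E ) for some real E with |E| ≤ C n^{−b}. -/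

import Mathlib

open scoped BigOperators Classical

namespace Stmt19

/-- The degree of vertex `j` in the graph `G`. -/
noncomputable def deg {n : ℕ} (G : SimpleGraph (Fin n)) (j : Fin n) : ℕ :=
  (Finset.univ.filter (fun k => G.Adj j k)).card

/-- The set of simple graphs on `{1,…,n}` with degree sequence `d`. -/
noncomputable def degFinset (n : ℕ) (d : Fin n → ℕ) : Finset (SimpleGraph (Fin n)) :=
  Finset.univ.filter (fun G => ∀ j, deg G j = d j)

/-- The average degree `d̄`. -/
noncomputable def dbar (n : ℕ) (d : Fin n → ℕ) : ℝ := (∑ j, (d j : ℝ)) / n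

/-- The edge density `λ = d̄ / (n-1)`. -/
noncomputable def lam (n : ℕ) (d : Fin n → ℕ) : ℝ := dbar n d / ((n : ℝ) - 1)

/-- `R = (1/n) Σ_j (d_j - d̄)²`. -/
noncomputable def Rpar (n : ℕ) (d : Fin n → ℕ) : ℝ :=
  (∑ j, ((d j : ℝ) - dbar n d) ^ 2) / n

/-- `δ = max_j |d_j - d̄|`. -/
noncomputable def deltaPar (n : ℕ) (d : Fin n → ℕ) : ℝ :=
  ⨆ j : Fin n, |(d j : ℝ) - dbar n d|

/-- The number of automorphisms of `H`: permutations of the vertices preserving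
the edge set. -/
noncomputable def autCard {k : ℕ} (H : SimpleGraph (Fin k)) : ℕ :=
  (Finset.univ.filter
    (fun π : Equiv.Perm (Fin k) => ∀ i j, H.Adj (π i) (π j) ↔ H.Adj i j)).card

/-- The number of `r`-cliques in `G`: sets of `r` pairwise adjacent vertices. -/
noncomputable def cliqueCount {n : ℕ} (r : ℕ) (G : SimpleGraph (Fin n)) : ℕ :=
  (Finset.univ.filter (fun S : Finset (Fin n) =>
    S.card = r ∧ ∀ j ∈ S, ∀ k ∈ S, j ≠ k → G.Adj j k)).card

/-- The expected number of `r`-cliques in a uniformly random graph with degree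
sequence `d`. -/
noncomputable def expCliques (n : ℕ) (d : Fin n → ℕ) (r : ℕ) : ℝ :=
  (∑ G ∈ degFinset n d, (cliqueCount r G : ℝ)) / ((degFinset n d).card : ℝ)

/-! ### Conditional averages over graphs with given degrees and given fixed pairs -/

/-- The adjacency indicator of `G`. -/
noncomputable def ind {n : ℕ} (G : SimpleGraph (Fin n)) (u v : Fin n) : ℝ :=
  if G.Adj u v then 1 else 0

lemma ind_comm {n : ℕ} (G : SimpleGraph (Fin n)) (u v : Fin n) : ind G u v = ind G v u := by
  simp [ind, G.adj_comm]

lemma ind_self {n : ℕ} (G : SimpleGraph (Fin n)) (u : Fin n) : ind G u u = 0 := by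
  simp [ind]

lemma ind_nonneg {n : ℕ} (G : SimpleGraph (Fin n)) (u v : Fin n) : 0 ≤ ind G u v := by
  unfold ind; split_ifs <;> norm_num

lemma ind_le_one {n : ℕ} (G : SimpleGraph (Fin n)) (u v : Fin n) : ind G u v ≤ 1 := by
  unfold ind; split_ifs <;> norm_num

lemma ind_zero_or_one {n : ℕ} (G : SimpleGraph (Fin n)) (u v : Fin n) :
    ind G u v = 0 ∨ ind G u v = 1 := by
  unfold ind; split_ifs <;> simp

lemma ind_eq_one_iff {n : ℕ} (G : SimpleGraph (Fin n)) (u v : Fin n) :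
    ind G u v = 1 ↔ G.Adj u v := by
  unfold ind; split_ifs <;> simp_all

lemma ind_ext {n : ℕ} {G G' : SimpleGraph (Fin n)} (h : ∀ u v, ind G u v = ind G' u v) :
    G = G' := by
  ext u v
  rw [← ind_eq_one_iff, ← ind_eq_one_iff, h]

lemma deg_eq_sum {n : ℕ} (G : SimpleGraph (Fin n)) (v : Fin n) :
    (deg G v : ℝ) = ∑ z, ind G v z := by
  simp [deg, ind]

/-- The graphs with the same degrees as `G` which agree with `G` on the pairs in `X`. -/
noncomputable def cls {n : ℕ} (X : Set (Sym2 (Fin n))) (G : SimpleGraph (Fin n)) :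
    Finset (SimpleGraph (Fin n)) :=
  Finset.univ.filter fun G' => (∀ v, deg G' v = deg G v) ∧
    ∀ u v, s(u, v) ∈ X → ind G' u v = ind G u v

/-- The average of `φ` over `cls X G`. -/
noncomputable def av {n : ℕ} (X : Set (Sym2 (Fin n))) (G : SimpleGraph (Fin n))
    (φ : SimpleGraph (Fin n) → ℝ) : ℝ :=
  (∑ G' ∈ cls X G, φ G') / (cls X G).card

section av
variable {n : ℕ} {X Y : Set (Sym2 (Fin n))} {G G' : SimpleGraph (Fin n)}

lemma mem_cls : G' ∈ cls X G ↔ (∀ v, deg G' v = deg G v) ∧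
    ∀ u v, s(u, v) ∈ X → ind G' u v = ind G u v := by
  simp [cls]

lemma self_mem_cls : G ∈ cls X G := by simp [mem_cls]

lemma cls_eq (h : G' ∈ cls X G) : cls X G' = cls X G := by
  ext H
  rw [mem_cls] at h
  simp only [mem_cls, h.1]
  refine and_congr_right fun _ => forall_congr' fun u => forall_congr' fun v => ?_
  refine forall_congr' fun huv => ?_
  rw [h.2 u v huv]

lemma cls_subset (hXY : X ⊆ Y) : cls Y G ⊆ cls X G := by
  intro H hH
  rw [mem_cls] at hH ⊢
  exact ⟨hH.1, fun u v h => hH.2 u v (hXY h)⟩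

lemma card_cls_pos : (0 : ℝ) < (cls X G).card := by
  exact_mod_cast Finset.card_pos.mpr ⟨G, self_mem_cls⟩

lemma av_congr {φ ψ : SimpleGraph (Fin n) → ℝ} (h : ∀ H ∈ cls X G, φ H = ψ H) :
    av X G φ = av X G ψ := by
  unfold av; rw [Finset.sum_congr rfl h]

lemma av_const (c : ℝ) : av X G (fun _ => c) = c := by
  have := (card_cls_pos (X := X) (G := G)).ne'
  simp [av]; field_simp

lemma av_add (φ ψ : SimpleGraph (Fin n) → ℝ) :
    av X G (fun H => φ H + ψ H) = av X G φ + av X G ψ := by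
  simp [av, Finset.sum_add_distrib, add_div]

lemma av_sub (φ ψ : SimpleGraph (Fin n) → ℝ) :
    av X G (fun H => φ H - ψ H) = av X G φ - av X G ψ := by
  simp [av, Finset.sum_sub_distrib, sub_div]

lemma av_mul_left (c : ℝ) (φ : SimpleGraph (Fin n) → ℝ) :
    av X G (fun H => c * φ H) = c * av X G φ := by
  simp [av, ← Finset.mul_sum, mul_div_assoc]

lemma av_sum {ι : Type*} (s : Finset ι) (φ : ι → SimpleGraph (Fin n) → ℝ) :
    av X G (fun H => ∑ i ∈ s, φ i H) = ∑ i ∈ s, av X G (φ i) := by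
  simp only [av]
  rw [Finset.sum_comm, Finset.sum_div]

lemma av_mono {φ ψ : SimpleGraph (Fin n) → ℝ} (h : ∀ H ∈ cls X G, φ H ≤ ψ H) :
    av X G φ ≤ av X G ψ := by
  unfold av
  gcongr with H hH
  exact h H hH

lemma abs_av_le_av {φ ψ : SimpleGraph (Fin n) → ℝ} (h : ∀ H ∈ cls X G, |φ H| ≤ ψ H) :
    |av X G φ| ≤ av X G ψ := by
  rw [abs_le]
  constructor
  · have : av X G (fun H => (-1) * ψ H) ≤ av X G φ := av_mono fun H hH => by
      have := (abs_le.mp (h H hH)).1; linarith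
    rw [av_mul_left] at this; linarith
  · exact av_mono fun H hH => (abs_le.mp (h H hH)).2

lemma abs_av_le {φ : SimpleGraph (Fin n) → ℝ} {B : ℝ} (h : ∀ H ∈ cls X G, |φ H| ≤ B) :
    |av X G φ| ≤ B := by
  simpa [av_const] using abs_av_le_av (ψ := fun _ => B) h

lemma av_tower (hXY : X ⊆ Y) (φ : SimpleGraph (Fin n) → ℝ) :
    av X G (fun H => av Y H φ) = av X G φ := by
  unfold av
  congr 1
  have h1 : ∀ H ∈ cls X G, (∑ H' ∈ cls Y H, φ H') / ((cls Y H).card : ℝ) =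
      ∑ H' ∈ cls X G, if H' ∈ cls Y H then φ H' / ((cls Y H').card : ℝ) else 0 := by
    intro H hH
    rw [← Finset.sum_filter, Finset.sum_div]
    have : (cls X G).filter (fun H' => H' ∈ cls Y H) = cls Y H := by
      ext H'
      simp only [Finset.mem_filter, and_iff_right_iff_imp]
      intro h
      rw [← cls_eq hH]
      exact cls_subset hXY h
    rw [this]
    exact Finset.sum_congr rfl fun H' hH' => by rw [cls_eq hH']
  rw [Finset.sum_congr rfl h1, Finset.sum_comm]
  refine Finset.sum_congr rfl fun H hH => ?_
  have h2 : ∀ H', H ∈ cls Y H' ↔ H' ∈ cls Y H := by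
    intro H'
    simp only [mem_cls]
    constructor <;> exact fun h => ⟨fun v => (h.1 v).symm, fun u v huv => (h.2 u v huv).symm⟩
  simp_rw [h2]
  rw [← Finset.sum_filter]
  have : (cls X G).filter (fun H' => H' ∈ cls Y H) = cls Y H := by
    ext H'
    simp only [Finset.mem_filter, and_iff_right_iff_imp]
    intro h
    rw [← cls_eq hH]
    exact cls_subset hXY h
  rw [this, Finset.sum_const, nsmul_eq_mul]
  have := (card_cls_pos (X := Y) (G := H)).ne'
  field_simp

/-- If `φ` has small averages conditionally on the pairs in `Y` and `g` is determined by these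
pairs and bounded, then `g * φ` has a small average. -/
lemma abs_av_mul_le (hXY : X ⊆ Y) {g φ : SimpleGraph (Fin n) → ℝ} {B ρ : ℝ}
    (hg : ∀ H ∈ cls X G, ∀ H' ∈ cls Y H, g H' = g H) (hB : ∀ H ∈ cls X G, |g H| ≤ B)
    (hφ : ∀ H ∈ cls X G, |av Y H φ| ≤ ρ) :
    |av X G (fun H => g H * φ H)| ≤ B * ρ := by
  rw [← av_tower hXY]
  apply abs_av_le
  intro H hH
  have : av Y H (fun H => g H * φ H) = g H * av Y H φ := by
    rw [← av_mul_left]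
    exact av_congr fun H' hH' => by rw [hg H hH H' hH']
  rw [this, abs_mul]
  exact mul_le_mul (hB H hH) (hφ H hH) (abs_nonneg _) ((abs_nonneg _).trans (hB H hH))

end av

/-! ### Switching two edges along an alternating 4-cycle -/

/-- Toggle the four pairs of the cycle `w u w' u'`. -/
noncomputable def toggle {n : ℕ} (w w' u u' : Fin n) (G : SimpleGraph (Fin n)) :
    SimpleGraph (Fin n) where
  Adj x y := x ≠ y ∧
    (if s(x, y) ∈ ({s(w, u), s(w, u'), s(w', u), s(w', u')} : Set (Sym2 (Fin n))) then
      ¬ G.Adj x y else G.Adj x y)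
  symm := ⟨fun x y h => by
    rw [Sym2.eq_swap (a := y) (b := x), G.adj_comm y x]
    exact ⟨h.1.symm, h.2⟩⟩
  loopless := ⟨fun x h => h.1 rfl⟩

section toggle
variable {n : ℕ} {w w' u u' : Fin n} {G : SimpleGraph (Fin n)}

lemma ind_toggle {x y : Fin n} (hxy : x ≠ y) : ind (toggle w w' u u' G) x y =
    if s(x, y) ∈ ({s(w, u), s(w, u'), s(w', u), s(w', u')} : Set (Sym2 (Fin n))) then
      1 - ind G x y else ind G x y := by
  simp only [ind, toggle]
  split_ifs <;> simp_all

lemma toggle_toggle : toggle w w' u u' (toggle w w' u u' G) = G := by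
  apply ind_ext
  intro x y
  by_cases hxy : x = y
  · subst hxy; simp [ind_self]
  · rw [ind_toggle hxy, ind_toggle hxy]
    split_ifs <;> ring

lemma toggle_comm_right : toggle w w' u u' G = toggle w w' u' u G := by
  apply ind_ext
  intro x y
  by_cases hxy : x = y
  · subst hxy; simp [ind_self]
  · rw [ind_toggle hxy, ind_toggle hxy]
    congr 1
    simp only [Set.mem_insert_iff, Set.mem_singleton_iff, eq_iff_iff]
    tauto

/-- The configuration in which the pairs of the cycle alternate between edges and non-edges. -/
structure Alt {n : ℕ} (w w' u u' : Fin n) (G : SimpleGraph (Fin n)) : Prop where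
  ww : w ≠ w'
  wu : w ≠ u
  wu' : w ≠ u'
  wu2 : w' ≠ u
  wu2' : w' ≠ u'
  a1 : ind G w u = 1
  a2 : ind G w u' = 0
  a3 : ind G w' u = 0
  a4 : ind G w' u' = 1

lemma Alt.uu (h : Alt w w' u u' G) : u ≠ u' := by
  rintro rfl
  have := h.a1; have := h.a2; linarith

lemma Alt.ind_toggle (h : Alt w w' u u' G) (x y : Fin n) :
    ind (toggle w w' u u' G) x y = ind G x y -
      (((if x = w then 1 else 0) - (if x = w' then 1 else 0)) *
        ((if y = u then 1 else 0) - (if y = u' then 1 else 0)) +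
       ((if x = u then 1 else 0) - (if x = u' then 1 else 0)) *
        ((if y = w then 1 else 0) - (if y = w' then 1 else 0))) := by
  have huu := h.uu
  obtain ⟨h1, h2, h3, h4, h5, a1, a2, a3, a4⟩ := h
  have b1 := ind_comm G w u; have b2 := ind_comm G w u'
  have b3 := ind_comm G w' u; have b4 := ind_comm G w' u'
  by_cases hxy : x = y
  · subst hxy
    simp only [ind_self]
    by_cases c1 : x = w
    · subst c1; simp [*]
    by_cases c2 : x = w'
    · subst c2; simp [*]
    simp [*]
  rw [Stmt19.ind_toggle hxy]
  simp only [Set.mem_insert_iff, Set.mem_singleton_iff, Sym2.eq_iff]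
  by_cases c1 : x = w
  · subst c1
    by_cases d1 : y = u
    · subst d1; simp [*]
    by_cases d2 : y = u'
    · subst d2; simp [*]
    simp [*]
  by_cases c2 : x = w'
  · subst c2
    by_cases d1 : y = u
    · subst d1; simp [*]
    by_cases d2 : y = u'
    · subst d2; simp [*]
    simp [*]
  by_cases c3 : x = u
  · subst c3
    by_cases d1 : y = w
    · subst d1; simp_all
    by_cases d2 : y = w'
    · subst d2; simp_all
    simp [*]
  by_cases c4 : x = u'
  · subst c4
    by_cases d1 : y = w
    · subst d1; simp_all
    by_cases d2 : y = w'
    · subst d2; simp_all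
    simp [*]
  simp [*]

lemma Alt.deg_toggle (h : Alt w w' u u' G) (x : Fin n) :
    deg (toggle w w' u u' G) x = deg G x := by
  have : (deg (toggle w w' u u' G) x : ℝ) = deg G x := by
    rw [deg_eq_sum, deg_eq_sum, Finset.sum_congr rfl fun y _ => h.ind_toggle x y]
    rw [Finset.sum_sub_distrib, Finset.sum_add_distrib, ← Finset.mul_sum, ← Finset.mul_sum,
      Finset.sum_sub_distrib, Finset.sum_sub_distrib]
    simp
  exact_mod_cast this

lemma Alt.mem_cls {X : Set (Sym2 (Fin n))} {G₀ : SimpleGraph (Fin n)} (h : Alt w w' u u' G)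
    (hG : G ∈ cls X G₀) (h1 : s(w, u) ∉ X) (h2 : s(w, u') ∉ X) (h3 : s(w', u) ∉ X)
    (h4 : s(w', u') ∉ X) : toggle w w' u u' G ∈ cls X G₀ := by
  rw [Stmt19.mem_cls] at hG ⊢
  refine ⟨fun v => by rw [h.deg_toggle, hG.1], fun x y hxy => ?_⟩
  by_cases e : x = y
  · subst e; simp [ind_self]
  rw [← hG.2 x y hxy, Stmt19.ind_toggle e, if_neg]
  simp only [Set.mem_insert_iff, Set.mem_singleton_iff]
  rintro (e | e | e | e) <;> rw [e] at hxy <;> contradiction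

end toggle

/-! ### Redistributing the symmetric difference of two neighbourhoods -/

section split
variable {n : ℕ}

/-- The vertices for which both pairs with `w` and `w'` are free. -/
noncomputable def freeSet (X : Set (Sym2 (Fin n))) (w w' : Fin n) : Finset (Fin n) :=
  Finset.univ.filter fun z => z ≠ w ∧ z ≠ w' ∧ s(w, z) ∉ X ∧ s(w', z) ∉ X

/-- The vertices for which one of the pairs with `w` and `w'` is fixed. -/
noncomputable def fixedSet (X : Set (Sym2 (Fin n))) (w w' : Fin n) : Finset (Fin n) :=
  Finset.univ.filter fun z => z ≠ w ∧ z ≠ w' ∧ (s(w, z) ∈ X ∨ s(w', z) ∈ X)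

/-- The indicator of `z` being adjacent to exactly one of `w` and `w'`. -/
noncomputable def tau (G : SimpleGraph (Fin n)) (w w' z : Fin n) : ℝ :=
  (ind G w z + ind G w' z - 2 * ind G w z * ind G w' z : ℝ)

/-- The free vertices adjacent to exactly one of `w` and `w'`. -/
noncomputable def symDiffSet (X : Set (Sym2 (Fin n))) (G : SimpleGraph (Fin n)) (w w' : Fin n) :
    Finset (Fin n) :=
  (freeSet X w w').filter fun z => (ind G w z ≠ ind G w' z : Prop)

/-- The difference of the free degrees of `w` and `w'` into the common free set. -/
noncomputable def Delta (X : Set (Sym2 (Fin n))) (G : SimpleGraph (Fin n)) (w w' : Fin n) : ℝ :=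
  ∑ z ∈ freeSet X w w', (ind G w z - ind G w' z)

variable {X : Set (Sym2 (Fin n))} {G H : SimpleGraph (Fin n)} {w w' u u' k z : Fin n}

lemma tau_eq : tau G w w' z = if ind G w z ≠ ind G w' z then 1 else 0 := by
  unfold tau
  rcases ind_zero_or_one G w z with h | h <;> rcases ind_zero_or_one G w' z with h' | h' <;>
    norm_num [h, h']

lemma tau_nonneg : 0 ≤ tau G w w' z := by rw [tau_eq]; split_ifs <;> norm_num

lemma tau_le_one : tau G w w' z ≤ 1 := by rw [tau_eq]; split_ifs <;> norm_num

lemma mem_freeSet : z ∈ freeSet X w w' ↔ z ≠ w ∧ z ≠ w' ∧ s(w, z) ∉ X ∧ s(w', z) ∉ X := by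
  simp [freeSet]

lemma mem_symDiffSet : z ∈ symDiffSet X G w w' ↔
    (z ≠ w ∧ z ≠ w' ∧ s(w, z) ∉ X ∧ s(w', z) ∉ X) ∧ ind G w z ≠ ind G w' z := by
  simp [symDiffSet, mem_freeSet]

lemma card_symDiffSet : ((symDiffSet X G w w').card : ℝ) = ∑ z ∈ freeSet X w w', tau G w w' z := by
  simp [symDiffSet, tau_eq, Finset.sum_ite]

lemma Alt.ind_row (h : Alt w w' u u' G) (hw' : z ≠ w') :
    ind (toggle w w' u u' G) w z =
      ind G w z - ((if z = u then 1 else 0) - (if z = u' then 1 else 0)) := by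
  rw [h.ind_toggle]
  have := h.ww; have := h.wu; have := h.wu'
  simp [*]

lemma Alt.ind_row' (h : Alt w w' u u' G) (hw : z ≠ w) :
    ind (toggle w w' u u' G) w' z =
      ind G w' z + ((if z = u then 1 else 0) - (if z = u' then 1 else 0)) := by
  rw [h.ind_toggle]
  have := h.ww.symm; have := h.wu2; have := h.wu2'
  simp only [*, if_true, if_false, zero_sub]
  simp [*]
  ring

lemma Alt.toggled (h : Alt w w' u u' G) : Alt w w' u' u (toggle w w' u u' G) := by
  have huu := h.uu
  refine ⟨h.ww, h.wu', h.wu, h.wu2', h.wu2, ?_, ?_, ?_, ?_⟩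
  · rw [h.ind_row h.wu2'.symm]; simp [huu.symm, h.a2]
  · rw [h.ind_row h.wu2.symm]; simp [huu, h.a1]
  · rw [h.ind_row' h.wu'.symm]; simp [huu.symm, h.a4]
  · rw [h.ind_row' h.wu.symm]; simp [huu, h.a3]

lemma Alt.symDiffSet_toggle (h : Alt w w' u u' G) :
    symDiffSet X (toggle w w' u u' G) w w' = symDiffSet X G w w' := by
  ext z
  rw [mem_symDiffSet, mem_symDiffSet]
  refine and_congr_right fun hz => ?_
  rw [h.ind_row hz.2.1, h.ind_row' hz.1]
  have huu := h.uu
  by_cases h1 : z = u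
  · subst h1; simp [huu, h.a1, h.a3]
  by_cases h2 : z = u'
  · subst h2; simp [huu.symm, h.a2, h.a4]
  simp [h1, h2]

/-- The number of free vertices adjacent to `w` but not to `w'`. -/
noncomputable def half (X : Set (Sym2 (Fin n))) (G : SimpleGraph (Fin n)) (w w' : Fin n) : ℝ :=
  ∑ z ∈ freeSet X w w', ind G w z * (1 - ind G w' z)

lemma freeSet_comm (X : Set (Sym2 (Fin n))) (w w' : Fin n) : freeSet X w w' = freeSet X w' w := by
  ext z; simp only [mem_freeSet]; tauto

lemma half_add_half : half X G w w' + half X G w' w = (symDiffSet X G w w').card := by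
  rw [card_symDiffSet, half, half, freeSet_comm X w' w, ← Finset.sum_add_distrib]
  refine Finset.sum_congr rfl fun z _ => ?_
  unfold tau; ring

lemma half_sub_half : half X G w w' - half X G w' w = Delta X G w w' := by
  rw [half, half, Delta, freeSet_comm X w' w, ← Finset.sum_sub_distrib]
  refine Finset.sum_congr rfl fun z _ => ?_
  ring

lemma ind_mul_eq (h : w ≠ w') (hu : u ≠ w) (hu2 : u ≠ w') (hu' : u' ≠ w) (hu2' : u' ≠ w') (c : ℝ) :
    ind G w u * (1 - ind G w' u) * (ind G w' u' * (1 - ind G w u')) * c =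
      if Alt w w' u u' G then c else 0 := by
  split_ifs with hA
  · simp [hA.a1, hA.a2, hA.a3, hA.a4]
  · by_contra hne
    apply hA
    refine ⟨h, hu.symm, hu'.symm, hu2.symm, hu2'.symm, ?_, ?_, ?_, ?_⟩
    · rcases ind_zero_or_one G w u with e | e
      · simp [e] at hne
      · exact e
    · rcases ind_zero_or_one G w u' with e | e
      · exact e
      · simp [e] at hne
    · rcases ind_zero_or_one G w' u with e | e
      · exact e
      · simp [e] at hne
    · rcases ind_zero_or_one G w' u' with e | e
      · simp [e] at hne
      · exact e

lemma sum_switch (h : w ≠ w') (hk : k ∈ freeSet X w w') (hz : z ∈ freeSet X w w') :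
    ∑ H ∈ cls X G, ind H w k * (1 - ind H w' k) * (ind H w' z * (1 - ind H w z)) *
        ((symDiffSet X H w w').card : ℝ)⁻¹ =
      ∑ H ∈ cls X G, ind H w' k * (1 - ind H w k) * (ind H w z * (1 - ind H w' z)) *
        ((symDiffSet X H w w').card : ℝ)⁻¹ := by
  rw [mem_freeSet] at hk hz
  obtain ⟨k1, k2, k3, k4⟩ := hk
  obtain ⟨z1, z2, z3, z4⟩ := hz
  rw [Finset.sum_congr rfl fun H _ => ind_mul_eq (G := H) h k1 k2 z1 z2 _]
  have : ∀ H : SimpleGraph (Fin n), ind H w' k * (1 - ind H w k) * (ind H w z * (1 - ind H w' z)) *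
        ((symDiffSet X H w w').card : ℝ)⁻¹ =
      if Alt w w' z k H then ((symDiffSet X H w w').card : ℝ)⁻¹ else 0 := by
    intro H
    rw [← ind_mul_eq h z1 z2 k1 k2]
    ring
  rw [Finset.sum_congr rfl fun H _ => this H, ← Finset.sum_filter, ← Finset.sum_filter]
  refine Finset.sum_nbij' (toggle w w' k z) (toggle w w' k z) ?_ ?_ ?_ ?_ ?_
  · intro H hH
    rw [Finset.mem_filter] at hH ⊢
    exact ⟨hH.2.mem_cls hH.1 k3 z3 k4 z4, hH.2.toggled⟩
  · intro H hH
    rw [Finset.mem_filter] at hH ⊢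
    rw [toggle_comm_right]
    exact ⟨hH.2.mem_cls hH.1 z3 k3 z4 k4, hH.2.toggled⟩
  · intro H _; exact toggle_toggle
  · intro H _; exact toggle_toggle
  · intro H hH
    rw [Finset.mem_filter] at hH
    rw [hH.2.symDiffSet_toggle]

/-- The exact switching identity. -/
lemma av_sub_av_eq (h : w ≠ w') (hk : k ∈ freeSet X w w') :
    av X G (fun H => ind H w k) - av X G (fun H => ind H w' k) =
      av X G (fun H => tau H w w' k * Delta X H w w' * ((symDiffSet X H w w').card : ℝ)⁻¹) := by
  have key : av X G (fun H => ind H w k * (1 - ind H w' k) * half X H w' w *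
      ((symDiffSet X H w w').card : ℝ)⁻¹) = av X G (fun H => ind H w' k * (1 - ind H w k) *
      half X H w w' * ((symDiffSet X H w w').card : ℝ)⁻¹) := by
    unfold av half
    congr 1
    simp_rw [Finset.mul_sum, Finset.sum_mul]
    rw [Finset.sum_comm, freeSet_comm X w' w]
    conv_rhs => rw [Finset.sum_comm]
    exact Finset.sum_congr rfl fun z hz => sum_switch h hk hz
  rw [← av_sub, ← sub_eq_zero, ← av_sub]
  rw [← sub_eq_zero, ← av_sub] at key
  have : av X G (fun H => ind H w k - ind H w' k -
      tau H w w' k * Delta X H w w' * ((symDiffSet X H w w').card : ℝ)⁻¹) =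
      av X G (fun H => 2 * (ind H w k * (1 - ind H w' k) * half X H w' w *
      ((symDiffSet X H w w').card : ℝ)⁻¹ - ind H w' k * (1 - ind H w k) *
      half X H w w' * ((symDiffSet X H w w').card : ℝ)⁻¹)) := by
    refine av_congr fun H _ => ?_
    have e1 := half_add_half (X := X) (G := H) (w := w) (w' := w')
    have e2 := half_sub_half (X := X) (G := H) (w := w) (w' := w')
    by_cases ht : (symDiffSet X H w w').card = 0
    · have : k ∉ symDiffSet X H w w' := by
        rw [Finset.card_eq_zero] at ht; simp [ht]
      have : ind H w k = ind H w' k := by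
        by_contra hne
        exact this (by simp only [symDiffSet, Finset.mem_filter]; exact ⟨hk, hne⟩)
      simp [ht, this]
    · have ht' : ((symDiffSet X H w w').card : ℝ) ≠ 0 := by exact_mod_cast ht
      rw [← e2, tau, ← e1]
      rw [← e1] at ht'
      field_simp
      ring
  rw [this, av_mul_left, key, mul_zero]

end split

/-! ### The symmetric difference of two neighbourhoods is rarely small -/

section tail
variable {n : ℕ} {X : Set (Sym2 (Fin n))} {G H : SimpleGraph (Fin n)}

/-- The free vertices adjacent to `w` but not to `w'`. -/
noncomputable def halfSet (X : Set (Sym2 (Fin n))) (G : SimpleGraph (Fin n)) (w w' : Fin n) :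
    Finset (Fin n) :=
  (freeSet X w w').filter fun z => ind G w z = 1 ∧ ind G w' z = 0

lemma card_halfSet (w w' : Fin n) : ((halfSet X G w w').card : ℝ) = half X G w w' := by
  rw [halfSet, half, Finset.card_filter, Nat.cast_sum]
  refine Finset.sum_congr rfl fun z _ => ?_
  rcases ind_zero_or_one G w z with h | h <;> rcases ind_zero_or_one G w' z with h1 | h1 <;>
    simp [h, h1]

/-- The vertices `z` for which the pair with `v` is fixed. -/
noncomputable def fixedNbrs (X : Set (Sym2 (Fin n))) (v : Fin n) : Finset (Fin n) :=
  Finset.univ.filter fun z => z ≠ v ∧ s(v, z) ∈ X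

/-- The graphs for which the neighbourhoods of `a` and `c` differ a lot and those of `a` and `b`
differ little. -/
noncomputable def twins (X : Set (Sym2 (Fin n))) (G : SimpleGraph (Fin n)) (a b c : Fin n)
    (t j : ℕ) : Finset (SimpleGraph (Fin n)) :=
  (cls X G).filter fun H => t ≤ (symDiffSet X H a c).card ∧ (symDiffSet X H a b).card ≤ j

lemma alt_of_mem_halfSet {a c u u' : Fin n} (hac : a ≠ c) (hu : u ∈ halfSet X H a c)
    (hu' : u' ∈ halfSet X H c a) : Alt a c u u' H := by
  simp only [halfSet, Finset.mem_filter, mem_freeSet] at hu hu'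
  exact ⟨hac, hu.1.1.symm, hu'.1.2.1.symm, hu.1.2.1.symm, hu'.1.1.symm, hu.2.1, hu'.2.2, hu.2.2,
    hu'.2.1⟩

lemma symDiffSet_toggle_subset {a b c u u' : Fin n} (hab : b ≠ a) (hcb : c ≠ b) (hub : u ≠ b)
    (hub' : u' ≠ b) (hA : Alt a c u u' H) :
    symDiffSet X (toggle a c u u' H) a b ⊆ insert u (insert u' (symDiffSet X H a b)) := by
  intro z hz
  by_contra hne
  simp only [Finset.mem_insert, not_or] at hne
  apply hne.2.2
  rw [mem_symDiffSet] at hz ⊢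
  refine ⟨hz.1, ?_⟩
  have h2 := hz.2
  rw [hA.ind_toggle, hA.ind_toggle] at h2
  have := hne.1; have := hne.2.1; have := hub.symm; have := hub'.symm; have := hcb.symm
  have := hA.wu; have := hA.wu'
  simpa [*] using h2

lemma mem_symDiffSet_toggle {a b c u u' : Fin n} (hab : b ≠ a) (hcb : c ≠ b) (hub : u ≠ b)
    (hub' : u' ≠ b) (hA : Alt a c u u' H) (hau : s(a, u) ∉ X) (hau' : s(a, u') ∉ X)
    (hbu : s(b, u) ∉ X) (hbu' : s(b, u') ∉ X) (hu : u ∉ symDiffSet X H a b)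
    (hu' : u' ∉ symDiffSet X H a b) :
    u ∈ symDiffSet X (toggle a c u u' H) a b ∧ u' ∈ symDiffSet X (toggle a c u u' H) a b := by
  have huu := hA.uu
  rw [mem_symDiffSet] at hu hu'
  rw [mem_symDiffSet, mem_symDiffSet]
  have e1 : ind H b u = 1 := by
    by_contra h
    exact hu ⟨⟨hA.wu.symm, hub, hau, hbu⟩, by rw [hA.a1]; exact fun h' => h h'.symm⟩
  have e2 : ind H b u' = 0 := by
    by_contra h
    exact hu' ⟨⟨hA.wu'.symm, hub', hau', hbu'⟩, by rw [hA.a2]; exact fun h' => h h'.symm⟩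
  have hb : ∀ z, z ≠ a → z ≠ c → ind (toggle a c u u' H) b z = ind H b z := by
    intro z hza hzc
    rw [hA.ind_toggle]
    have := hub.symm; have := hub'.symm; have := hcb.symm
    simp [*]
  refine ⟨⟨⟨hA.wu.symm, hub, hau, hbu⟩, ?_⟩, ⟨⟨hA.wu'.symm, hub', hau', hbu'⟩, ?_⟩⟩
  · rw [hA.ind_row hA.wu2.symm, hb u hA.wu.symm hA.wu2.symm, e1, hA.a1]
    simp [huu]
  · rw [hA.ind_row hA.wu2'.symm, hb u' hA.wu'.symm hA.wu2'.symm, e2, hA.a2]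
    simp [huu.symm]

lemma twins_step {a b c : Fin n} {t j m : ℕ} (hab : b ≠ a) (hac : a ≠ c) (hcb : c ≠ b)
    (hs : ∀ H ∈ cls X G, t ≤ (symDiffSet X H a c).card →
      m + j + 1 + (fixedNbrs X b).card ≤ (halfSet X H a c).card ∧
      m + j + 1 + (fixedNbrs X b).card ≤ (halfSet X H c a).card) :
    (twins X G a b c t j).card * (m * m) ≤
      (twins X G a b c t (j + 2)).card * ((j + 2) * (j + 2)) := by
  let R := fun H => insert b (symDiffSet X H a b ∪ fixedNbrs X b)
  let U := fun H => halfSet X H a c \ R H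
  let U' := fun H => halfSet X H c a \ R H
  let D := fun H => symDiffSet X H a b
  have hcard : ((twins X G a b c t j).sigma fun H => U H ×ˢ U' H).card ≤
      ((twins X G a b c t (j + 2)).sigma fun H => D H ×ˢ D H).card := by
    refine Finset.card_le_card_of_injOn
      (fun p => ⟨toggle a c p.2.1 p.2.2 p.1, p.2⟩) ?_ ?_
    · rintro ⟨H, u, u'⟩ hp
      simp only [Finset.coe_sigma, Set.mem_sigma_iff, Finset.mem_coe, twins, Finset.mem_filter,
        Finset.mem_product, U, U', R, D, Finset.mem_sdiff, Finset.mem_insert, Finset.mem_union,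
        not_or] at hp ⊢
      obtain ⟨⟨hH, ht, hj⟩, ⟨hu, hub, huD, huX⟩, ⟨hu', hub', huD', huX'⟩⟩ := hp
      have hA := alt_of_mem_halfSet hac hu hu'
      simp only [halfSet, Finset.mem_filter, mem_freeSet] at hu hu'
      simp only [fixedNbrs, Finset.mem_filter, Finset.mem_univ, true_and, not_and] at huX huX'
      refine ⟨⟨hA.mem_cls hH hu.1.2.2.1 hu'.1.2.2.2 hu.1.2.2.2 hu'.1.2.2.1, ?_, ?_⟩, ?_⟩
      · rwa [hA.symDiffSet_toggle]
      · refine (Finset.card_le_card (symDiffSet_toggle_subset hab hcb hub hub' hA)).trans ?_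
        refine (Finset.card_insert_le _ _).trans ?_
        have := Finset.card_insert_le u' (symDiffSet X H a b)
        omega
      · exact mem_symDiffSet_toggle hab hcb hub hub' hA hu.1.2.2.1 hu'.1.2.2.2 (huX hub)
          (huX' hub') huD huD'
    · rintro ⟨H, u, u'⟩ _ ⟨H', v, v'⟩ _ h
      simp only [Sigma.mk.injEq, heq_eq_eq, Prod.mk.injEq] at h
      obtain ⟨h, rfl, rfl⟩ := h
      have := congrArg (toggle a c u u') h
      rw [toggle_toggle, toggle_toggle] at this
      rw [this]
  rw [Finset.card_sigma, Finset.card_sigma] at hcard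
  calc (twins X G a b c t j).card * (m * m)
      ≤ ∑ H ∈ twins X G a b c t j, (U H ×ˢ U' H).card := by
        rw [← smul_eq_mul]
        refine Finset.card_nsmul_le_sum _ _ _ fun H hH => ?_
        simp only [twins, Finset.mem_filter] at hH
        obtain ⟨h1, h2⟩ := hs H hH.1 hH.2.1
        have hR : (R H).card ≤ j + 1 + (fixedNbrs X b).card := by
          refine (Finset.card_insert_le _ _).trans ?_
          have := Finset.card_union_le (symDiffSet X H a b) (fixedNbrs X b)
          omega
        have h3 := Finset.le_card_sdiff (R H) (halfSet X H a c)
        have h4 := Finset.le_card_sdiff (R H) (halfSet X H c a)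
        rw [Finset.card_product]
        exact Nat.mul_le_mul (by simp only [U]; omega) (by simp only [U']; omega)
    _ ≤ _ := hcard
    _ ≤ _ := by
        rw [← smul_eq_mul]
        refine Finset.sum_le_card_nsmul _ _ _ fun H hH => ?_
        simp only [twins, Finset.mem_filter] at hH
        rw [Finset.card_product]
        exact Nat.mul_le_mul hH.2.2 hH.2.2

lemma twins_iterate {a b c : Fin n} {t J m : ℕ} (hab : b ≠ a) (hac : a ≠ c) (hcb : c ≠ b)
    (hJ : 2 * J ≤ m) (hm : 0 < m)
    (hs : ∀ H ∈ cls X G, t ≤ (symDiffSet X H a c).card →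
      m + J + 1 + (fixedNbrs X b).card ≤ (halfSet X H a c).card ∧
      m + J + 1 + (fixedNbrs X b).card ≤ (halfSet X H c a).card) (i : ℕ) :
    ∀ j, j + 2 * i ≤ J → (twins X G a b c t j).card * 4 ^ i ≤ (cls X G).card := by
  induction i with
  | zero =>
    intro j _
    rw [pow_zero, mul_one]
    exact Finset.card_le_card (Finset.filter_subset _ _)
  | succ i ih =>
    intro j hj
    have h1 := ih (j + 2) (by omega)
    have h2 := twins_step (t := t) (j := j) (m := m) hab hac hcb fun H hH ht => by
      have := hs H hH ht; omega
    have h3 : (twins X G a b c t j).card * 4 ≤ (twins X G a b c t (j + 2)).card := by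
      have h4 : (j + 2) * (j + 2) * 4 ≤ m * m := by
        have : (2 * (j + 2)) * (2 * (j + 2)) ≤ m * m := Nat.mul_le_mul (by omega) (by omega)
        linarith
      have h5 : (twins X G a b c t j).card * 4 * (m * m) ≤
          (twins X G a b c t (j + 2)).card * (m * m) := by
        calc _ = (twins X G a b c t j).card * (m * m) * 4 := by ring
          _ ≤ (twins X G a b c t (j + 2)).card * ((j + 2) * (j + 2)) * 4 :=
            Nat.mul_le_mul_right _ h2
          _ = (twins X G a b c t (j + 2)).card * ((j + 2) * (j + 2) * 4) := by ring
          _ ≤ _ := Nat.mul_le_mul_left _ h4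
      exact Nat.le_of_mul_le_mul_right h5 (Nat.mul_pos hm hm)
    calc _ = (twins X G a b c t j).card * 4 * 4 ^ i := by ring
      _ ≤ (twins X G a b c t (j + 2)).card * 4 ^ i := Nat.mul_le_mul_right _ h3
      _ ≤ _ := h1

lemma card_small_symDiffSet {a b : Fin n} {t J m : ℕ} (hab : b ≠ a)
    (hJ : 2 * J ≤ m) (hm : 0 < m) (hJt : J < t)
    (hs : ∀ H ∈ cls X G, ∀ c, c ≠ a → t ≤ (symDiffSet X H a c).card →
      m + J + 1 + (fixedNbrs X b).card ≤ (halfSet X H a c).card ∧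
      m + J + 1 + (fixedNbrs X b).card ≤ (halfSet X H c a).card)
    (hex : ∀ H ∈ cls X G, ∃ c, c ≠ a ∧ t ≤ (symDiffSet X H a c).card) (i j : ℕ)
    (hij : j + 2 * i ≤ J) :
    ((cls X G).filter fun H => (symDiffSet X H a b).card ≤ j).card * 4 ^ i ≤
      n * (cls X G).card := by
  have hsub : (cls X G).filter (fun H => (symDiffSet X H a b).card ≤ j) ⊆
      (Finset.univ.filter fun c => c ≠ a ∧ c ≠ b).biUnion fun c => twins X G a b c t j := by
    intro H hH
    rw [Finset.mem_filter] at hH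
    obtain ⟨c, hca, hc⟩ := hex H hH.1
    rw [Finset.mem_biUnion]
    refine ⟨c, ?_, ?_⟩
    · simp only [Finset.mem_filter, Finset.mem_univ, true_and]
      refine ⟨hca, ?_⟩
      rintro rfl
      omega
    · simp only [twins, Finset.mem_filter]
      exact ⟨hH.1, hc, hH.2⟩
  calc _ ≤ (∑ c ∈ Finset.univ.filter fun c => c ≠ a ∧ c ≠ b, (twins X G a b c t j).card) * 4 ^ i :=
        Nat.mul_le_mul_right _ ((Finset.card_le_card hsub).trans Finset.card_biUnion_le)
    _ = ∑ c ∈ Finset.univ.filter fun c => c ≠ a ∧ c ≠ b, (twins X G a b c t j).card * 4 ^ i :=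
        Finset.sum_mul _ _ _
    _ ≤ (Finset.univ.filter fun c : Fin n => c ≠ a ∧ c ≠ b).card • (cls X G).card := by
        refine Finset.sum_le_card_nsmul _ _ _ fun c hc => ?_
        simp only [Finset.mem_filter, Finset.mem_univ, true_and] at hc
        exact twins_iterate hab hc.1.symm hc.2 hJ hm (fun H hH => hs H hH c hc.1) i j hij
    _ ≤ n * (cls X G).card := by
        rw [smul_eq_mul]
        refine Nat.mul_le_mul_right _ ?_
        simpa using Finset.card_le_card (Finset.filter_subset _ (Finset.univ : Finset (Fin n)))

end tail

/-! ### Families of nearly regular graphs with few fixed pairs -/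

section fam
variable {n : ℕ} {X Y : Set (Sym2 (Fin n))} {G H : SimpleGraph (Fin n)} {L L' lam : ℝ}

/-- The graph `G` is nearly regular of density `lam` and few pairs are fixed by `X`. -/
structure Fam (L lam : ℝ) (X : Set (Sym2 (Fin n))) (G : SimpleGraph (Fin n)) : Prop where
  lam_lo : 1 ≤ L * lam
  lam_hi : 1 ≤ L * (1 - lam)
  deg_near : ∀ v, |(deg G v : ℝ) - lam * ((n : ℝ) - 1)| ≤ L * √n
  fix_le : ∀ v, ((fixedNbrs X v).card : ℝ) ≤ L * √n
  fix_sum : ∑ v, ((fixedNbrs X v).card : ℝ) ≤ L ^ 2 * n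
  deg_sum : ∑ v, (deg G v : ℝ) = lam * ((n : ℝ) * (n - 1))

/-- The number `n` is large with respect to `L`. -/
structure Big (n : ℕ) (L : ℝ) : Prop where
  L_ge : 100 ≤ L
  n_ge : L ^ 100 ≤ n

lemma Big.mono (h : Big n L) (h1 : 100 ≤ L') (h2 : L' ≤ L) : Big n L' :=
  ⟨h1, (pow_le_pow_left₀ (by linarith) h2 100).trans h.n_ge⟩

lemma Big.sqrt_ge (h : Big n L) : L ^ 50 ≤ √n := by
  apply Real.le_sqrt_of_sq_le
  have := h.n_ge
  calc (L ^ 50) ^ 2 = L ^ 100 := by rw [← pow_mul]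
    _ ≤ (n : ℝ) := this

lemma Big.pow_le_sqrt (h : Big n L) {k : ℕ} (hk : k ≤ 50) : L ^ k ≤ √n :=
  (pow_le_pow_right₀ (by linarith [h.L_ge]) hk).trans h.sqrt_ge

lemma Fam.of_mem_cls (h : Fam L lam X G) (hH : H ∈ cls X G) : Fam L lam X H := by
  obtain ⟨h1, h2, h3, h4, h5, h6⟩ := h
  rw [mem_cls] at hH
  refine ⟨h1, h2, fun v => ?_, h4, h5, ?_⟩
  · rw [hH.1]; exact h3 v
  · simp only [hH.1]; exact h6

lemma Fam.lam_pos (h : Fam L lam X G) (hL : 100 ≤ L) : 0 < lam := by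
  by_contra hn
  have := h.lam_lo
  nlinarith

lemma Fam.lam_lt_one (h : Fam L lam X G) (hL : 100 ≤ L) : lam < 1 := by
  by_contra hn
  have := h.lam_hi
  nlinarith

lemma fixedNbrs_union_card_le (A : Finset (Sym2 (Fin n))) (v : Fin n) :
    (fixedNbrs (X ∪ ↑A) v).card ≤ (fixedNbrs X v).card + A.card := by
  have : fixedNbrs (X ∪ ↑A) v ⊆
      fixedNbrs X v ∪ (Finset.univ.filter fun z => s(v, z) ∈ A) := by
    intro z
    simp only [fixedNbrs, Finset.mem_filter, Finset.mem_univ, true_and, Finset.mem_union,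
      Set.mem_union, Finset.mem_coe]
    tauto
  refine (Finset.card_le_card this).trans ((Finset.card_union_le _ _).trans ?_)
  gcongr
  refine Finset.card_le_card_of_injOn (fun z => s(v, z)) ?_ ?_
  · intro z hz; simpa using hz
  · intro z _ z' _ hzz
    have h1 : s(v, z) = s(v, z') := hzz
    exact Sym2.congr_right.mp h1

lemma Fam.union (h : Fam L lam X G) (hL : 100 ≤ L) (hn : 1 ≤ n) {A : Finset (Sym2 (Fin n))}
    (hA : A.card ≤ 6) (hH : H ∈ cls X G) : Fam (2 * L) lam (X ∪ ↑A) H := by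
  have h0 := h.lam_pos hL
  have h0' := h.lam_lt_one hL
  obtain ⟨h1, h2, h3, h4, h5, h6⟩ := h.of_mem_cls hH
  have hs : 1 ≤ √(n : ℝ) := by
    rw [Real.one_le_sqrt]; exact_mod_cast hn
  have hc : ∀ v, ((fixedNbrs (X ∪ ↑A) v).card : ℝ) ≤ (fixedNbrs X v).card + 6 := fun v => by
    have := fixedNbrs_union_card_le (X := X) A v
    exact_mod_cast this.trans (by omega)
  refine ⟨by nlinarith, by nlinarith, fun v => (h3 v).trans (by nlinarith), fun v => ?_, ?_, h6⟩
  · have := hc v; have := h4 v; nlinarith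
  · calc _ ≤ ∑ v : Fin n, (((fixedNbrs X v).card : ℝ) + 6) := Finset.sum_le_sum fun v _ => hc v
      _ = ∑ v : Fin n, ((fixedNbrs X v).card : ℝ) + 6 * n := by
        rw [Finset.sum_add_distrib]; simp; ring
      _ ≤ L ^ 2 * n + 6 * n := by linarith
      _ ≤ (2 * L) ^ 2 * n := by
        have : (0 : ℝ) ≤ n := Nat.cast_nonneg n
        nlinarith [mul_nonneg this (by nlinarith : (0 : ℝ) ≤ 3 * L ^ 2 - 6)]

lemma fixedSet_subset (w w' : Fin n) : fixedSet X w w' ⊆ fixedNbrs X w ∪ fixedNbrs X w' := by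
  intro z
  simp only [fixedSet, fixedNbrs, Finset.mem_filter, Finset.mem_univ, true_and, Finset.mem_union]
  tauto

lemma Fam.card_fixedSet_le (h : Fam L lam X G) (w w' : Fin n) :
    ((fixedSet X w w').card : ℝ) ≤ 2 * (L * √n) := by
  have h1 := (Finset.card_le_card (fixedSet_subset (X := X) w w')).trans (Finset.card_union_le _ _)
  have h2 : ((fixedSet X w w').card : ℝ) ≤ (fixedNbrs X w).card + (fixedNbrs X w').card := by
    exact_mod_cast h1
  linarith [h.fix_le w, h.fix_le w']

lemma sum_eq_free_add_fixed {w w' : Fin n} (h : w ≠ w') (f : Fin n → ℝ) :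
    ∑ z, f z = f w + f w' + ∑ z ∈ fixedSet X w w', f z + ∑ z ∈ freeSet X w w', f z := by
  have h1 : (Finset.univ : Finset (Fin n)) =
      insert w (insert w' (fixedSet X w w' ∪ freeSet X w w')) := by
    ext z; simp only [fixedSet, freeSet, Finset.mem_filter, Finset.mem_univ, true_and,
      Finset.mem_insert, Finset.mem_union]; tauto
  rw [h1, Finset.sum_insert, Finset.sum_insert, Finset.sum_union]
  · ring
  · rw [Finset.disjoint_left]; intro z
    simp only [fixedSet, freeSet, Finset.mem_filter, Finset.mem_univ, true_and]; tauto
  · simp [fixedSet, freeSet]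
  · simp [fixedSet, freeSet, h]

lemma Delta_eq {w w' : Fin n} (h : w ≠ w') : Delta X G w w' =
    (deg G w : ℝ) - deg G w' - ∑ z ∈ fixedSet X w w', (ind G w z - ind G w' z) := by
  rw [deg_eq_sum, deg_eq_sum, ← Finset.sum_sub_distrib,
    sum_eq_free_add_fixed (X := X) h (fun z => ind G w z - ind G w' z), Delta]
  simp only [ind_self, ind_comm G w' w]
  ring

lemma abs_ind_sub_le (w z w' z' : Fin n) : |ind G w z - ind H w' z'| ≤ 1 := by
  rw [abs_le]
  have := ind_nonneg G w z; have := ind_le_one G w z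
  have := ind_nonneg H w' z'; have := ind_le_one H w' z'
  constructor <;> linarith

lemma Fam.abs_deg_sub_le (h : Fam L lam X G) (w w' : Fin n) :
    |(deg G w : ℝ) - deg G w'| ≤ 2 * (L * √n) := by
  have h1 := abs_le.mp (h.deg_near w); have h2 := abs_le.mp (h.deg_near w')
  rw [abs_le]; constructor <;> linarith [h1.1, h1.2, h2.1, h2.2]

lemma Fam.abs_Delta_le (h : Fam L lam X G) {w w' : Fin n} (hw : w ≠ w') :
    |Delta X G w w'| ≤ 4 * (L * √n) := by
  rw [Delta_eq hw]
  have h1 := h.abs_deg_sub_le w w'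
  have h2 : |∑ z ∈ fixedSet X w w', (ind G w z - ind G w' z)| ≤ (fixedSet X w w').card := by
    refine (Finset.abs_sum_le_sum_abs _ _).trans ?_
    simpa using Finset.sum_le_card_nsmul (fixedSet X w w') _ (1 : ℝ)
      fun z _ => abs_ind_sub_le w z w' z
  have h3 := h.card_fixedSet_le w w'
  exact (abs_sub _ _).trans (by linarith)

/-- Sums of the sizes of symmetric differences with a fixed neighbourhood. -/
lemma Fam.sum_card_symDiffSet_ge (h : Fam L lam X G) (hB : Big n L) (a : Fin n) :
    (n : ℝ) * (n / (4 * L)) < ∑ c ∈ Finset.univ.erase a, ((symDiffSet X G a c).card : ℝ) := by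
  have hL := h.lam_lo
  have hL100 := hB.L_ge
  set s := √(n : ℝ) with hs
  have hss : s * s = n := Real.mul_self_sqrt (Nat.cast_nonneg n)
  have hs3 : L ^ 3 ≤ s := hB.pow_le_sqrt (by norm_num)
  have hLs : 0 < L := by linarith
  have hs0 : 0 < s := lt_of_lt_of_le (by positivity) hs3
  have hn0 : (0 : ℝ) < n := by rw [← hss]; positivity
  have h1 : ∀ c, c ≠ a → ∑ z, tau G a c z - (2 + 2 * (L * s)) ≤ (symDiffSet X G a c).card := by
    intro c hc
    rw [card_symDiffSet, sum_eq_free_add_fixed (X := X) hc.symm]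
    have h2 := h.card_fixedSet_le a c
    have h3 : ∑ z ∈ fixedSet X a c, tau G a c z ≤ (fixedSet X a c).card := by
      simpa using Finset.sum_le_card_nsmul (fixedSet X a c) _ (1 : ℝ) fun z _ => tau_le_one
    have h4 := tau_le_one (G := G) (w := a) (w' := c) (z := a)
    have h5 := tau_le_one (G := G) (w := a) (w' := c) (z := c)
    linarith
  have h2 : ∑ c ∈ Finset.univ.erase a, ∑ z, tau G a c z = ∑ c, ∑ z, tau G a c z := by
    refine Finset.sum_subset (Finset.subset_univ _) fun c _ hc => ?_
    have : c = a := by simpa using hc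
    subst this
    refine Finset.sum_eq_zero fun z _ => ?_
    rw [tau_eq]; simp
  have h3 : ∑ c, ∑ z, tau G a c z =
      ∑ z, ((n : ℝ) * ind G a z + deg G z - 2 * ind G a z * deg G z) := by
    rw [Finset.sum_comm]
    refine Finset.sum_congr rfl fun z _ => ?_
    rw [deg_eq_sum]
    simp only [tau, Finset.sum_add_distrib, Finset.sum_sub_distrib, Finset.mul_sum, ind_comm G z]
    simp
  have h4 : ∀ z, (n - 1) / L - L * s ≤
      (n : ℝ) * ind G a z + deg G z - 2 * ind G a z * deg G z := by
    intro z
    have h5 := abs_le.mp (h.deg_near z)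
    have hn1 : (1 : ℝ) ≤ n := by
      have : 0 < n := by exact_mod_cast hn0
      exact_mod_cast this
    have h6 : (n - 1) / L ≤ lam * ((n : ℝ) - 1) := by
      rw [div_le_iff₀ hLs]; nlinarith
    have h7 : (n - 1) / L ≤ (1 - lam) * ((n : ℝ) - 1) := by
      rw [div_le_iff₀ hLs]; nlinarith [h.lam_hi]
    rcases ind_zero_or_one G a z with e | e <;> rw [e] <;> linarith [h5.1, h5.2]
  have h5 : (n : ℝ) * ((n - 1) / L - L * s) ≤ ∑ c, ∑ z, tau G a c z := by
    rw [h3]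
    simpa using Finset.card_nsmul_le_sum Finset.univ _ _ fun z _ => h4 z
  have h6 : ∑ c ∈ Finset.univ.erase a, ∑ z, tau G a c z - n * (2 + 2 * (L * s)) ≤
      ∑ c ∈ Finset.univ.erase a, ((symDiffSet X G a c).card : ℝ) := by
    calc _ ≤ ∑ c ∈ Finset.univ.erase a, (∑ z, tau G a c z - (2 + 2 * (L * s))) := by
          rw [Finset.sum_sub_distrib]
          gcongr
          rw [Finset.sum_const, nsmul_eq_mul]
          gcongr
          simp
      _ ≤ _ := Finset.sum_le_sum fun c hc => h1 c (Finset.ne_of_mem_erase hc)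
  rw [h2] at h6
  refine lt_of_lt_of_le ?_ h6
  refine lt_of_lt_of_le ?_ (sub_le_sub_right h5 _)
  rw [← mul_sub]
  refine mul_lt_mul_of_pos_left ?_ hn0
  have e1 : (n : ℝ) / (4 * L) = n / L / 4 := by rw [div_div, mul_comm]
  have e2 : ((n : ℝ) - 1) / L = n / L - 1 / L := by ring
  rw [e1, e2]
  have h8 : L ^ 2 * s ≤ n / L := by
    rw [le_div_iff₀ hLs, ← hss]; nlinarith
  have h9 : 1 / L ≤ 1 := by rw [div_le_one hLs]; linarith
  have hs1 : 1 ≤ s := le_trans (one_le_pow₀ (by linarith)) hs3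
  nlinarith [mul_le_mul_of_nonneg_right hL100 hLs.le, mul_pos hLs hs0]

lemma Fam.exists_symDiffSet (h : Fam L lam X G) (hB : Big n L) (a : Fin n) :
    ∃ c, c ≠ a ∧ ⌊(n : ℝ) / (4 * L)⌋₊ ≤ (symDiffSet X G a c).card := by
  by_contra hn
  push Not at hn
  have h1 := h.sum_card_symDiffSet_ge hB a
  have h0 : (0 : ℝ) ≤ n / (4 * L) := by
    have := hB.L_ge
    positivity
  have h2 : ∑ c ∈ Finset.univ.erase a, ((symDiffSet X G a c).card : ℝ) ≤
      (Finset.univ.erase a).card • ((n : ℝ) / (4 * L)) := by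
    refine Finset.sum_le_card_nsmul _ _ _ fun c hc => ?_
    have := hn c (Finset.ne_of_mem_erase hc)
    exact le_trans (by exact_mod_cast this.le) (Nat.floor_le h0)
  have h3 : ((Finset.univ.erase a).card : ℝ) ≤ n := by
    simp
  rw [nsmul_eq_mul] at h2
  have h4 := mul_le_mul_of_nonneg_right h3 h0
  linarith

lemma pow_six_le_four_pow {i : ℕ} (hi : 20 ≤ i) : i ^ 6 ≤ 4 ^ i := by
  induction i, hi using Nat.le_induction with
  | base => norm_num
  | succ k hk ih =>
    have h1 : 4 * (k + 1) ≤ 5 * k := by omega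
    have h2 := Nat.pow_le_pow_left h1 6
    rw [mul_pow, mul_pow] at h2
    have h3 : 5 ^ 6 * k ^ 6 ≤ 4 ^ 7 * k ^ 6 := Nat.mul_le_mul_right _ (by norm_num)
    have h4 : 4 ^ 6 * (k + 1) ^ 6 ≤ 4 ^ 6 * (4 * k ^ 6) := by
      refine h2.trans (h3.trans (le_of_eq (by ring)))
    have h5 := Nat.le_of_mul_le_mul_left h4 (by norm_num)
    calc _ ≤ 4 * k ^ 6 := h5
      _ ≤ 4 * 4 ^ k := Nat.mul_le_mul_left _ ih
      _ = _ := by ring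

/-- The symmetric difference of two neighbourhoods is rarely small. -/
lemma Fam.av_small_le (h : Fam L lam X G) (hB : Big n L) {a b : Fin n} (hab : b ≠ a) :
    av X G (fun H => if ((symDiffSet X H a b).card : ℝ) < n / L ^ 2 then 1 else 0) ≤
      1 / (n : ℝ) ^ 2 := by
  have hL100 := hB.L_ge
  set s := √(n : ℝ) with hs
  have hss : s * s = n := Real.mul_self_sqrt (Nat.cast_nonneg n)
  have hs3 : L ^ 5 ≤ s := hB.pow_le_sqrt (by norm_num)
  have hLs : 0 < L := by linarith
  have hs0 : 0 < s := lt_of_lt_of_le (by positivity) hs3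
  have hn0 : (0 : ℝ) < n := by rw [← hss]; positivity
  set t := ⌊(n : ℝ) / (4 * L)⌋₊ with ht
  set j := ⌊(n : ℝ) / L ^ 2⌋₊ with hj
  have ht1 : (t : ℝ) ≤ n / (4 * L) := Nat.floor_le (by positivity)
  have ht2 : (n : ℝ) / (4 * L) < t + 1 := Nat.lt_floor_add_one _
  have hj1 : (j : ℝ) ≤ n / L ^ 2 := Nat.floor_le (by positivity)
  have hL4 : L ^ 4 * s ≤ n / L := by
    rw [le_div_iff₀ hLs, ← hss]; nlinarith
  have e1 : (n : ℝ) / (4 * L) = n / L / 4 := by rw [div_div, mul_comm]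
  have e2 : (n : ℝ) / L ^ 2 = n / L / L := by rw [div_div, sq]
  have hs100 : 10 ^ 10 ≤ s := le_trans (by
    calc (10 : ℝ) ^ 10 = 100 ^ 5 := by norm_num
      _ ≤ L ^ 5 := by gcongr) hs3
  have hLL : 10 ^ 8 ≤ L ^ 4 := by
    calc (10 : ℝ) ^ 8 = 100 ^ 4 := by norm_num
      _ ≤ L ^ 4 := by gcongr
  have hLL1 : 10 ^ 6 * L ≤ L ^ 4 := by
    calc 10 ^ 6 * L = 100 ^ 3 * L := by norm_num
      _ ≤ L ^ 3 * L := by gcongr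
      _ = L ^ 4 := by ring
  have hY : 10 ^ 6 * (L * s) ≤ n / L := by
    refine le_trans ?_ hL4
    rw [← mul_assoc]; gcongr
  have hY2 : 10 ^ 8 * s ≤ n / L := le_trans (by gcongr) hL4
  have htj : (25 : ℝ) * j ≤ t + 1 := by
    have : (n : ℝ) / L / L ≤ n / L / 100 := by gcongr
    linarith
  have htj' : 25 * j ≤ t + 1 := by exact_mod_cast htj
  have hts : (10 ^ 7 : ℝ) * s ≤ t := by linarith
  have ht17 : 10 ^ 17 ≤ t := by
    have : (10 ^ 17 : ℝ) ≤ t := by linarith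
    exact_mod_cast this
  have hhalf : ∀ H ∈ cls X G, ∀ c, c ≠ a → t ≤ (symDiffSet X H a c).card →
      2 * (t / 8) + t / 8 + 1 + (fixedNbrs X b).card ≤ (halfSet X H a c).card ∧
      2 * (t / 8) + t / 8 + 1 + (fixedNbrs X b).card ≤ (halfSet X H c a).card := by
    intro H hH c hc hct
    have h1 := (h.of_mem_cls hH).abs_Delta_le hc.symm
    rw [← half_sub_half, abs_le] at h1
    have h2 := half_add_half (X := X) (G := H) (w := a) (w' := c)
    have h3 := h.fix_le b
    have h4 : (t : ℝ) ≤ (symDiffSet X H a c).card := by exact_mod_cast hct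
    have h5 : ((t / 8 : ℕ) : ℝ) ≤ (t : ℝ) / 8 := Nat.cast_div_le
    rw [← hs] at h1 h3
    have h6 : 2 * ((t / 8 : ℕ) : ℝ) + ((t / 8 : ℕ) : ℝ) + 1 + (fixedNbrs X b).card ≤
        ((halfSet X H a c).card : ℝ) := by
      rw [card_halfSet]; linarith [h1.1, h1.2]
    have h7 : 2 * ((t / 8 : ℕ) : ℝ) + ((t / 8 : ℕ) : ℝ) + 1 + (fixedNbrs X b).card ≤
        ((halfSet X H c a).card : ℝ) := by
      rw [card_halfSet]; linarith [h1.1, h1.2]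
    exact ⟨by exact_mod_cast h6, by exact_mod_cast h7⟩
  set i := (t / 8 - j) / 2 with hi
  have hit : t ≤ 40 * i := by omega
  have h1 := card_small_symDiffSet (X := X) (G := G) (t := t) (J := t / 8) (m := 2 * (t / 8)) hab
    le_rfl (by omega) (by omega) hhalf (fun H hH => (h.of_mem_cls hH).exists_symDiffSet hB a) i j
    (by omega)
  have his : s ≤ i := by
    have : (t : ℝ) ≤ 40 * i := by exact_mod_cast hit
    linarith
  have h4 : (n : ℝ) ^ 3 ≤ 4 ^ i := by
    have h6 : ((i ^ 6 : ℕ) : ℝ) ≤ ((4 ^ i : ℕ) : ℝ) := by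
      exact_mod_cast pow_six_le_four_pow (i := i) (by omega)
    push_cast at h6
    calc (n : ℝ) ^ 3 = s ^ 6 := by rw [← hss]; ring
      _ ≤ (i : ℝ) ^ 6 := by gcongr
      _ ≤ _ := h6
  have h5 : (((cls X G).filter fun H => (symDiffSet X H a b).card ≤ j).card : ℝ) * n ^ 3 ≤
      n * (cls X G).card := by
    refine le_trans (mul_le_mul_of_nonneg_left h4 (Nat.cast_nonneg _)) ?_
    exact_mod_cast h1
  unfold av
  rw [Finset.sum_ite, Finset.sum_const_zero, add_zero, Finset.sum_const, nsmul_eq_mul, mul_one,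
    div_le_div_iff₀ card_cls_pos (by positivity), one_mul]
  have h6 : (((cls X G).filter fun H => ((symDiffSet X H a b).card : ℝ) < n / L ^ 2).card : ℝ) ≤
      ((cls X G).filter fun H => (symDiffSet X H a b).card ≤ j).card := by
    norm_cast
    refine Finset.card_le_card fun H hH => ?_
    rw [Finset.mem_filter] at hH ⊢
    exact ⟨hH.1, Nat.le_floor hH.2.le⟩
  refine le_of_mul_le_mul_left ?_ hn0
  calc _ = (((cls X G).filter fun H => ((symDiffSet X H a b).card : ℝ) < n / L ^ 2).card : ℝ) *
        n ^ 3 := by ring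
    _ ≤ _ := by gcongr
    _ ≤ _ := h5

end fam

/-! ### First estimate of the edge probabilities -/

section prob
variable {n : ℕ} {X Y : Set (Sym2 (Fin n))} {G H : SimpleGraph (Fin n)} {L lam : ℝ}

/-- The probability that `u` and `v` are adjacent in a random graph of `cls X G`. -/
noncomputable def prob (X : Set (Sym2 (Fin n))) (G : SimpleGraph (Fin n)) (u v : Fin n) : ℝ :=
  av X G fun H => ind H u v

lemma prob_comm (u v : Fin n) : prob X G u v = prob X G v u := by
  unfold prob; simp only [ind_comm _ u v]

lemma prob_of_mem {u v : Fin n} (h : s(u, v) ∈ X) : prob X G u v = ind G u v := by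
  rw [prob, av_congr (ψ := fun _ => ind G u v) fun H hH => (mem_cls.mp hH).2 u v h, av_const]

lemma prob_self (u : Fin n) : prob X G u u = 0 := by
  simp [prob, ind_self, av_const]

/-- The vertices whose pair with `v` is not fixed. -/
noncomputable def freeNbrs (X : Set (Sym2 (Fin n))) (v : Fin n) : Finset (Fin n) :=
  Finset.univ.filter fun z => z ≠ v ∧ s(v, z) ∉ X

/-- The number of fixed edges at `v`. -/
noncomputable def fixedDeg (X : Set (Sym2 (Fin n))) (G : SimpleGraph (Fin n)) (v : Fin n) : ℝ :=
  ∑ z ∈ fixedNbrs X v, ind G v z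

lemma sum_eq_fixedNbrs_add (v : Fin n) (f : Fin n → ℝ) :
    ∑ z, f z = f v + ∑ z ∈ fixedNbrs X v, f z + ∑ z ∈ freeNbrs X v, f z := by
  have h1 : (Finset.univ : Finset (Fin n)) = insert v (fixedNbrs X v ∪ freeNbrs X v) := by
    ext z; simp only [fixedNbrs, freeNbrs, Finset.mem_filter, Finset.mem_univ, true_and,
      Finset.mem_insert, Finset.mem_union]; tauto
  rw [h1, Finset.sum_insert, Finset.sum_union]
  · ring
  · rw [Finset.disjoint_left]; intro z
    simp only [fixedNbrs, freeNbrs, Finset.mem_filter, Finset.mem_univ, true_and]; tauto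
  · simp [fixedNbrs, freeNbrs]

lemma card_freeNbrs (v : Fin n) :
    ((freeNbrs X v).card : ℝ) = n - 1 - (fixedNbrs X v).card := by
  have := sum_eq_fixedNbrs_add (X := X) v fun _ => 1
  simp at this
  linarith

lemma fixedDeg_nonneg (v : Fin n) : 0 ≤ fixedDeg X G v :=
  Finset.sum_nonneg fun z _ => ind_nonneg G v z

lemma fixedDeg_le (v : Fin n) : fixedDeg X G v ≤ (fixedNbrs X v).card := by
  unfold fixedDeg
  simpa using Finset.sum_le_card_nsmul (fixedNbrs X v) _ (1 : ℝ) fun z _ => ind_le_one G v z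

lemma sum_freeNbrs_prob (v : Fin n) :
    ∑ z ∈ freeNbrs X v, prob X G z v = deg G v - fixedDeg X G v := by
  simp only [prob_comm _ v]
  have h1 : ∑ z, prob X G v z = deg G v := by
    unfold prob
    rw [← av_sum, av_congr (ψ := fun _ => (deg G v : ℝ)), av_const]
    intro H hH
    rw [← deg_eq_sum, (mem_cls.mp hH).1]
  rw [sum_eq_fixedNbrs_add (X := X) v, prob_self] at h1
  have h2 : ∑ z ∈ fixedNbrs X v, prob X G v z = fixedDeg X G v := by
    refine Finset.sum_congr rfl fun z hz => prob_of_mem ?_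
    exact (Finset.mem_filter.mp hz).2.2
  linarith

lemma mem_freeSet_of_freeNbrs {w w' k : Fin n} (hw : w ∈ freeNbrs X k) (hw' : w' ∈ freeNbrs X k) :
    k ∈ freeSet X w w' := by
  simp only [freeNbrs, Finset.mem_filter, Finset.mem_univ, true_and] at hw hw'
  rw [mem_freeSet, Sym2.eq_swap, Sym2.eq_swap (a := w')]
  exact ⟨hw.1.symm, hw'.1.symm, hw.2, hw'.2⟩

lemma Big.basic (hB : Big n L) : 0 < √(n : ℝ) ∧ (n : ℝ) = √(n : ℝ) ^ 2 ∧ 0 < (n : ℝ) ∧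
    1 ≤ n := by
  have h1 : L ^ 0 ≤ √(n : ℝ) := hB.pow_le_sqrt (by norm_num)
  rw [pow_zero] at h1
  have h2 : √(n : ℝ) ^ 2 = n := Real.sq_sqrt (Nat.cast_nonneg n)
  have h3 : (1 : ℝ) ≤ n := by nlinarith
  exact ⟨by linarith, h2.symm, by linarith, by exact_mod_cast h3⟩

lemma Fam.abs_prob_sub_prob_le (h : Fam L lam X G) (hB : Big n L) {w w' k : Fin n} (hw : w ≠ w')
    (hk : k ∈ freeSet X w w') : |prob X G w k - prob X G w' k| ≤ 5 * L ^ 3 / √n := by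
  obtain ⟨hs0, hns, hn0, -⟩ := hB.basic
  have hL := hB.L_ge
  set s := √(n : ℝ) with hs
  rw [prob, prob, av_sub_av_eq hw hk]
  have h1 : ∀ H ∈ cls X G, |tau H w w' k * Delta X H w w' * ((symDiffSet X H w w').card : ℝ)⁻¹| ≤
      4 * (L * s) * (L ^ 2 / n + if ((symDiffSet X H w w').card : ℝ) < n / L ^ 2 then 1 else 0) := by
    intro H hH
    have hD := (h.of_mem_cls hH).abs_Delta_le hw
    rw [abs_mul, abs_mul]
    have ht : |tau H w w' k| ≤ 1 := by rw [abs_of_nonneg tau_nonneg]; exact tau_le_one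
    have hT : |((symDiffSet X H w w').card : ℝ)⁻¹| ≤
        L ^ 2 / n + if ((symDiffSet X H w w').card : ℝ) < n / L ^ 2 then 1 else 0 := by
      rw [abs_of_nonneg (inv_nonneg.mpr (Nat.cast_nonneg _))]
      split_ifs with hc
      · have : ((symDiffSet X H w w').card : ℝ)⁻¹ ≤ 1 := Nat.cast_inv_le_one _
        have : 0 ≤ L ^ 2 / n := by positivity
        linarith
      · rw [not_lt] at hc
        rw [add_zero, ← inv_div]
        exact inv_anti₀ (div_pos hn0 (pow_pos (by linarith) 2)) hc
    calc _ ≤ 1 * (4 * (L * s)) * (L ^ 2 / n +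
          if ((symDiffSet X H w w').card : ℝ) < n / L ^ 2 then 1 else 0) :=
          mul_le_mul (mul_le_mul ht hD (abs_nonneg _) zero_le_one) hT (abs_nonneg _)
            (by positivity)
      _ = _ := by ring
  refine (abs_av_le_av h1).trans ?_
  rw [av_mul_left, av_add, av_const]
  have h2 := h.av_small_le hB hw.symm
  calc _ ≤ 4 * (L * s) * (L ^ 2 / n + 1 / (n : ℝ) ^ 2) := by gcongr
    _ ≤ 4 * (L * s) * (L ^ 2 / n + 1 / (n : ℝ)) := by
        have : (1 : ℝ) ≤ n := by exact_mod_cast hB.basic.2.2.2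
        gcongr
        nlinarith
    _ = 4 * L * (L ^ 2 + 1) / s := by rw [hns]; field_simp
    _ ≤ 5 * L ^ 3 / s := by
        have : 4 * L * (L ^ 2 + 1) ≤ 5 * L ^ 3 := by
          have : L * 1 ≤ L * (L ^ 2 / 4) := by gcongr; nlinarith
          linarith
        gcongr

/-- Recovering the probability of one pair from the differences of the probabilities at a
common vertex. -/
lemma prob_of_differences {k w : Fin n} (f : Fin n → ℝ) (e : ℝ)
    (hw : w ∈ freeNbrs X k) (he : 0 ≤ e)
    (h : ∀ w', w ≠ w' → k ∈ freeSet X w w' →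
      |prob X G w k - prob X G w' k - f w'| ≤ e) (hf : f w = 0) :
    |(freeNbrs X k).card * prob X G w k - (deg G k - fixedDeg X G k) -
      ∑ w' ∈ freeNbrs X k, f w'| ≤ (freeNbrs X k).card * e := by
  have h1 : (freeNbrs X k).card * prob X G w k - (deg G k - fixedDeg X G k) -
      ∑ w' ∈ freeNbrs X k, f w' =
      ∑ w' ∈ freeNbrs X k, (prob X G w k - prob X G w' k - f w') := by
    rw [Finset.sum_sub_distrib, Finset.sum_sub_distrib, sum_freeNbrs_prob]
    simp
  rw [h1]
  refine (Finset.abs_sum_le_sum_abs _ _).trans ?_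
  rw [← nsmul_eq_mul]
  refine Finset.sum_le_card_nsmul _ _ _ fun w' hw' => ?_
  by_cases e1 : w = w'
  · subst e1; simpa [hf]
  · exact h w' e1 (mem_freeSet_of_freeNbrs hw hw')

lemma Fam.card_freeNbrs_ge (h : Fam L lam X G) (hB : Big n L) (v : Fin n) :
    (n : ℝ) / 2 ≤ (freeNbrs X v).card := by
  obtain ⟨hs0, hns, hn0, -⟩ := hB.basic
  have hL := hB.L_ge
  have h1 : L ^ 2 ≤ √(n : ℝ) := hB.pow_le_sqrt (by norm_num)
  rw [card_freeNbrs]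
  have h2 := h.fix_le v
  have h3 : L ^ 2 * √(n : ℝ) ≤ n := by
    nth_rw 2 [hns]; nlinarith
  have h4 : 100 * L * √n ≤ L ^ 2 * √n := by gcongr; nlinarith
  nlinarith

/-- The probability of any free pair is close to the density. -/
lemma Fam.abs_prob_sub_lam_le (h : Fam L lam X G) (hB : Big n L) {w k : Fin n} (hw : w ≠ k)
    (hX : s(w, k) ∉ X) : |prob X G w k - lam| ≤ L ^ 4 / √n := by
  obtain ⟨hs0, hns, hn0, -⟩ := hB.basic
  have hL := hB.L_ge
  have hwk : w ∈ freeNbrs X k := by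
    simp only [freeNbrs, Finset.mem_filter, Finset.mem_univ, true_and]
    rw [Sym2.eq_swap]; exact ⟨hw, hX⟩
  have h1 := prob_of_differences (G := G) (fun _ => 0) (5 * L ^ 3 / √n) hwk (by positivity)
    (fun w' h1 h2 => by simpa using h.abs_prob_sub_prob_le hB h1 h2) rfl
  have hV := h.card_freeNbrs_ge hB k
  have hV1 := card_freeNbrs (X := X) k
  have hd := abs_le.mp (h.deg_near k)
  have hx := h.fix_le k
  have hf0 := fixedDeg_nonneg (X := X) (G := G) k
  have hf := fixedDeg_le (X := X) (G := G) k
  have hl0 := h.lam_pos hL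
  have hl1 := h.lam_lt_one hL
  set V := ((freeNbrs X k).card : ℝ) with hVdef
  set s := √(n : ℝ) with hs
  set x := ((fixedNbrs X k).card : ℝ) with hxdef
  have hx0 : 0 ≤ x := Nat.cast_nonneg _
  have hV0 : 0 < V := by linarith
  rw [Finset.sum_const_zero, sub_zero] at h1
  have h2 : |(deg G k - fixedDeg X G k) - V * lam| ≤ 3 * (L * s) := by
    rw [hV1, abs_le]
    constructor <;> nlinarith [hd.1, hd.2]
  have h3 : |V * (prob X G w k - lam)| ≤ V * (5 * L ^ 3 / s) + 3 * (L * s) := by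
    have : V * (prob X G w k - lam) = (V * prob X G w k - (deg G k - fixedDeg X G k)) +
      ((deg G k - fixedDeg X G k) - V * lam) := by ring
    rw [this]
    exact (abs_add_le _ _).trans (add_le_add h1 h2)
  rw [abs_mul, abs_of_pos hV0] at h3
  have h4 : 3 * (L * s) ≤ V * (6 * L / s) := by
    calc 3 * (L * s) = (s ^ 2 / 2) * (6 * L / s) := by field_simp; ring
      _ ≤ V * (6 * L / s) := by rw [← hns]; gcongr
  have h5 : V * |prob X G w k - lam| ≤ V * (5 * L ^ 3 / s + 6 * L / s) := by
    rw [mul_add]; linarith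
  refine (le_of_mul_le_mul_left h5 hV0).trans ?_
  rw [← add_div]
  gcongr
  have : 100 * L ^ 3 ≤ L ^ 4 := by
    calc _ ≤ L * L ^ 3 := by gcongr
      _ = _ := by ring
  have : 100 ^ 2 * L ≤ L ^ 3 := by
    calc _ ≤ L ^ 2 * L := by gcongr
      _ = _ := by ring
  linarith

end prob

/-! ### Comparing two probabilities at a common vertex -/

section swap
variable {n : ℕ} {X Y : Set (Sym2 (Fin n))} {G H : SimpleGraph (Fin n)} {L lam ρ : ℝ}
  {q : Fin n → Fin n → ℝ} {w w' k : Fin n}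

/-- The probabilities are within `ρ` of `q`, even after fixing a few more pairs. -/
def Approx (X : Set (Sym2 (Fin n))) (G : SimpleGraph (Fin n)) (q : Fin n → Fin n → ℝ) (ρ : ℝ) :
    Prop :=
  ∀ A : Finset (Sym2 (Fin n)), A.card ≤ 6 → ∀ G' ∈ cls X G, ∀ u v, u ≠ v → s(u, v) ∉ A →
    |prob (X ∪ ↑A) G' u v - q u v| ≤ ρ

/-- The function `g` only depends on the pairs in `A`. -/
def Det (A : Finset (Sym2 (Fin n))) (g : SimpleGraph (Fin n) → ℝ) : Prop :=
  ∀ H H', (∀ u v, s(u, v) ∈ A → ind H' u v = ind H u v) → g H' = g H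

lemma Approx.av_mul_le (hq : Approx X G q ρ) {A : Finset (Sym2 (Fin n))} (hA : A.card ≤ 6)
    {g : SimpleGraph (Fin n) → ℝ} {B : ℝ} (hg : Det A g) (hB : ∀ H ∈ cls X G, |g H| ≤ B)
    {u v : Fin n} (huv : u ≠ v) (h : s(u, v) ∉ A) :
    |av X G (fun H => g H * (ind H u v - q u v))| ≤ B * ρ := by
  refine abs_av_mul_le (Y := X ∪ ↑A) Set.subset_union_left ?_ hB ?_
  · intro H _ H' hH'
    exact hg H H' fun u v huv => (mem_cls.mp hH').2 u v (Or.inr huv)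
  · intro H hH
    rw [av_sub, av_const]
    exact hq A hA H hH u v huv h

/-- The approximation of the probability that `z` is adjacent to one of `w` and `w'`. -/
def tauq (q : Fin n → Fin n → ℝ) (w w' z : Fin n) : ℝ :=
  q w z + q w' z - 2 * q w z * q w' z

lemma tauq_mem (h0 : ∀ u v, 0 ≤ q u v) (h1 : ∀ u v, q u v ≤ 1) (z : Fin n) :
    0 ≤ tauq q w w' z ∧ tauq q w w' z ≤ 1 := by
  have := h0 w z; have := h0 w' z; have := h1 w z; have := h1 w' z
  unfold tauq
  constructor <;> nlinarith

lemma Approx.av_mul_tau_le (hq : Approx X G q ρ) (h0 : ∀ u v, 0 ≤ q u v) (h1 : ∀ u v, q u v ≤ 1)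
    {A : Finset (Sym2 (Fin n))} (hA : A.card ≤ 5)
    {g : SimpleGraph (Fin n) → ℝ} {B : ℝ} (hg : Det A g) (hB : ∀ H ∈ cls X G, |g H| ≤ B)
    (hw : w ≠ w') {z : Fin n} (hzw : z ≠ w) (hzw' : z ≠ w') (hz : s(w, z) ∉ A)
    (hz' : s(w', z) ∉ A) :
    |av X G (fun H => g H * (tau H w w' z - tauq q w w' z))| ≤ 2 * B * ρ := by
  have e : (fun H => g H * (tau H w w' z - tauq q w w' z)) = fun H =>
      (g H * (1 - 2 * ind H w' z)) * (ind H w z - q w z) +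
        (g H * (1 - 2 * q w z)) * (ind H w' z - q w' z) := by
    funext H; unfold tau tauq; ring
  rw [e, av_add]
  have hB0 : 0 ≤ B := (abs_nonneg _).trans (hB G self_mem_cls)
  have k1 : |av X G (fun H => (g H * (1 - 2 * ind H w' z)) * (ind H w z - q w z))| ≤ B * ρ := by
    refine hq.av_mul_le (A := insert s(w', z) A) ((Finset.card_insert_le _ _).trans (by omega))
      ?_ ?_ hzw.symm ?_
    · intro H H' hH
      beta_reduce
      rw [hg H H' fun u v huv => hH u v (Finset.mem_insert_of_mem huv),
        hH w' z (Finset.mem_insert_self _ _)]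
    · intro H hH
      rw [abs_mul]
      have : |1 - 2 * ind H w' z| ≤ 1 := by
        rw [abs_le]
        have := ind_nonneg H w' z; have := ind_le_one H w' z
        constructor <;> linarith
      calc _ ≤ B * 1 := mul_le_mul (hB H hH) this (abs_nonneg _) hB0
        _ = B := mul_one B
    · rw [Finset.mem_insert, not_or]
      refine ⟨?_, hz⟩
      intro h
      exact hw (Sym2.congr_left.mp h)
  have k2 : |av X G (fun H => (g H * (1 - 2 * q w z)) * (ind H w' z - q w' z))| ≤ B * ρ := by
    refine hq.av_mul_le (A := A) (by omega) ?_ ?_ hzw'.symm hz'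
    · intro H H' hH
      beta_reduce
      rw [hg H H' hH]
    · intro H hH
      rw [abs_mul]
      have : |1 - 2 * q w z| ≤ 1 := by
        rw [abs_le]
        have := h0 w z; have := h1 w z
        constructor <;> linarith
      calc _ ≤ B * 1 := mul_le_mul (hB H hH) this (abs_nonneg _) hB0
        _ = B := mul_one B
  exact (abs_add_le _ _).trans (by linarith)

lemma abs_tau_sub_le (h0 : ∀ u v, 0 ≤ q u v) (h1 : ∀ u v, q u v ≤ 1) (z : Fin n) :
    |tau H w w' z - tauq q w w' z| ≤ 1 := by
  have := tauq_mem (w := w) (w' := w') h0 h1 z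
  have := tau_nonneg (G := H) (w := w) (w' := w') (z := z)
  have := tau_le_one (G := H) (w := w) (w' := w') (z := z)
  rw [abs_le]; constructor <;> linarith

lemma det_tau (z : Fin n) : Det {s(w, z), s(w', z)} fun H => tau H w w' z := by
  intro H H' hH
  simp only [tau]
  rw [hH w z (by simp), hH w' z (by simp)]

lemma abs_tau_le : |tau H w w' k| ≤ 1 := by
  rw [abs_of_nonneg tau_nonneg]; exact tau_le_one

lemma Det.mul {A A' : Finset (Sym2 (Fin n))} {f g : SimpleGraph (Fin n) → ℝ} (hf : Det A f)
    (hg : Det A' g) : Det (A ∪ A') fun H => f H * g H := by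
  intro H H' hH
  beta_reduce
  rw [hf H H' fun u v h => hH u v (Finset.mem_union_left _ h),
    hg H H' fun u v h => hH u v (Finset.mem_union_right _ h)]

lemma tau_congr {z : Fin n} {H' : SimpleGraph (Fin n)}
    (hH : ∀ u v, s(u, v) ∈ ({s(w, z), s(w', z)} : Finset (Sym2 (Fin n))) → ind H' u v = ind H u v) :
    tau H' w w' z = tau H w w' z :=
  det_tau z H _ hH

/-- The limit of `Delta`. -/
noncomputable def Deltaq (X : Set (Sym2 (Fin n))) (G : SimpleGraph (Fin n))
    (q : Fin n → Fin n → ℝ) (w w' : Fin n) : ℝ :=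
  (deg G w : ℝ) - deg G w' - ∑ z ∈ fixedSet X w w', (q w z - q w' z)

lemma Delta_of_mem_cls (hw : w ≠ w') (hH : H ∈ cls X G) : Delta X H w w' =
    (deg G w : ℝ) - deg G w' - ∑ z ∈ fixedSet X w w', (ind H w z - ind H w' z) := by
  rw [Delta_eq hw, (mem_cls.mp hH).1, (mem_cls.mp hH).1]

lemma Fam.abs_Deltaq_le (h : Fam L lam X G) (h0 : ∀ u v, 0 ≤ q u v) (h1 : ∀ u v, q u v ≤ 1)
    (w w' : Fin n) : |Deltaq X G q w w'| ≤ 4 * (L * √n) := by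
  unfold Deltaq
  have k1 := h.abs_deg_sub_le w w'
  have k2 : |∑ z ∈ fixedSet X w w', (q w z - q w' z)| ≤ (fixedSet X w w').card := by
    refine (Finset.abs_sum_le_sum_abs _ _).trans ?_
    refine (Finset.sum_le_card_nsmul (fixedSet X w w') _ (1 : ℝ) fun z _ => ?_).trans (by simp)
    rw [abs_le]
    have := h0 w z; have := h0 w' z; have := h1 w z; have := h1 w' z
    constructor <;> linarith
  have k3 := h.card_fixedSet_le w w'
  exact (abs_sub _ _).trans (by linarith)

lemma mem_fixedSet {z : Fin n} : z ∈ fixedSet X w w' ↔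
    z ≠ w ∧ z ≠ w' ∧ (s(w, z) ∈ X ∨ s(w', z) ∈ X) := by
  simp [fixedSet]

lemma ne_of_fixed_free {z : Fin n} (hz : z ∈ fixedSet X w w') (hk : k ∈ freeSet X w w') :
    z ≠ k := by
  rintro rfl
  rw [mem_fixedSet] at hz; rw [mem_freeSet] at hk
  tauto

lemma Approx.av_tau_mul_Delta (hq : Approx X G q ρ) (h0 : ∀ u v, 0 ≤ q u v)
    (h1 : ∀ u v, q u v ≤ 1) (h : Fam L lam X G) (hρ : 0 ≤ ρ) (hw : w ≠ w')
    (hk : k ∈ freeSet X w w') :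
    |av X G (fun H => tau H w w' k * Delta X H w w') - tauq q w w' k * Deltaq X G q w w'| ≤
      12 * (L * √n) * ρ := by
  have hk' := mem_freeSet.mp hk
  set D0 := Deltaq X G q w w' with hD0
  have e : av X G (fun H => tau H w w' k * Delta X H w w') - tauq q w w' k * D0 =
      av X G (fun H => D0 * (tau H w w' k - tauq q w w' k)) -
      ∑ z ∈ fixedSet X w w', (av X G (fun H => tau H w w' k * (ind H w z - q w z)) -
        av X G (fun H => tau H w w' k * (ind H w' z - q w' z))) := by
    rw [← av_const (X := X) (G := G) (tauq q w w' k * D0), ← av_sub]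
    simp only [← av_sub]
    rw [← av_sum, ← av_sub]
    refine av_congr fun H hH => ?_
    rw [Delta_of_mem_cls hw hH, hD0, Deltaq]
    simp only [← mul_sub]
    rw [← Finset.mul_sum]
    have : ∑ z ∈ fixedSet X w w', (ind H w z - q w z - (ind H w' z - q w' z)) =
      ∑ z ∈ fixedSet X w w', (ind H w z - ind H w' z) -
        ∑ z ∈ fixedSet X w w', (q w z - q w' z) := by
      rw [← Finset.sum_sub_distrib]
      exact Finset.sum_congr rfl fun z _ => by ring
    rw [this]; ring
  rw [e]
  have k0 := h.abs_Deltaq_le h0 h1 w w'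
  have k1 : |av X G (fun H => D0 * (tau H w w' k - tauq q w w' k))| ≤
      2 * (4 * (L * √n)) * ρ :=
    hq.av_mul_tau_le h0 h1 (A := ∅) (by simp) (fun _ _ _ => rfl) (fun _ _ => k0) hw hk'.1
      hk'.2.1 (by simp) (by simp)
  have k2 : ∀ z ∈ fixedSet X w w', |av X G (fun H => tau H w w' k * (ind H w z - q w z)) -
        av X G (fun H => tau H w w' k * (ind H w' z - q w' z))| ≤ 2 * ρ := by
    intro z hz
    have hzk := ne_of_fixed_free hz hk
    have hz' := mem_fixedSet.mp hz
    have hc : ({s(w, k), s(w', k)} : Finset (Sym2 (Fin n))).card ≤ 6 :=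
      Finset.card_le_two.trans (by norm_num)
    have m1 := hq.av_mul_le hc (det_tau k) (fun H _ => abs_tau_le) hz'.1.symm
      (by simp [hzk, hz'.1, hz'.2.1])
    have m2 := hq.av_mul_le hc (det_tau k) (fun H _ => abs_tau_le) hz'.2.1.symm
      (by simp [hzk, hz'.1, hz'.2.1])
    exact (abs_sub _ _).trans (by linarith)
  have k3 : |∑ z ∈ fixedSet X w w', (av X G (fun H => tau H w w' k * (ind H w z - q w z)) -
        av X G (fun H => tau H w w' k * (ind H w' z - q w' z)))| ≤ 2 * (L * √n) * (2 * ρ) := by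
    refine (Finset.abs_sum_le_sum_abs _ _).trans ((Finset.sum_le_card_nsmul _ _ _ k2).trans ?_)
    rw [nsmul_eq_mul]
    exact mul_le_mul_of_nonneg_right (h.card_fixedSet_le w w') (by linarith)
  exact (abs_sub _ _).trans (by linarith)

lemma card_symDiffSet_sub : ((symDiffSet X H w w').card : ℝ) -
    ∑ z ∈ freeSet X w w', tauq q w w' z =
      ∑ z ∈ freeSet X w w', (tau H w w' z - tauq q w w' z) := by
  rw [card_symDiffSet, Finset.sum_sub_distrib]

lemma card_freeSet_le : ((freeSet X w w').card : ℝ) ≤ n := by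
  simpa using Finset.card_le_card (Finset.subset_univ (freeSet X w w'))

lemma Approx.av_sq_le (hq : Approx X G q ρ) (h0 : ∀ u v, 0 ≤ q u v)
    (h1 : ∀ u v, q u v ≤ 1) (hρ : 0 ≤ ρ) (hw : w ≠ w') :
    av X G (fun H => (((symDiffSet X H w w').card : ℝ) -
      ∑ z ∈ freeSet X w w', tauq q w w' z) ^ 2) ≤ n + 2 * n ^ 2 * ρ := by
  simp only [card_symDiffSet_sub, sq, Finset.sum_mul, Finset.mul_sum]
  rw [av_sum]
  have key : ∀ y ∈ freeSet X w w', av X G (fun H => ∑ z ∈ freeSet X w w',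
      (tau H w w' z - tauq q w w' z) * (tau H w w' y - tauq q w w' y)) ≤ 1 + n * (2 * ρ) := by
    intro y hy
    rw [av_sum, ← Finset.add_sum_erase _ _ hy]
    have hy' := mem_freeSet.mp hy
    refine add_le_add ?_ ?_
    · refine (le_abs_self _).trans (abs_av_le fun H _ => ?_)
      rw [abs_mul]
      exact mul_le_one₀ (abs_tau_sub_le h0 h1 y) (abs_nonneg _) (abs_tau_sub_le h0 h1 y)
    · have : ∀ z ∈ (freeSet X w w').erase y,
          av X G (fun H => (tau H w w' z - tauq q w w' z) * (tau H w w' y - tauq q w w' y)) ≤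
            2 * ρ := by
        intro z hz
        rw [Finset.mem_erase, mem_freeSet] at hz
        refine (le_abs_self _).trans ?_
        simp only [mul_comm (tau _ w w' z - tauq q w w' z)]
        have := hq.av_mul_tau_le h0 h1 (A := {s(w, y), s(w', y)})
          (Finset.card_le_two.trans (by norm_num)) (g := fun H => tau H w w' y - tauq q w w' y)
          (B := 1) (fun H H' hH => by beta_reduce; rw [tau_congr hH])
          (fun H _ => abs_tau_sub_le h0 h1 y) hw hz.2.1 hz.2.2.1
          (by simp [hz.1, hz.2.1, hz.2.2.1])
          (by simp [hz.1, hz.2.1, hz.2.2.1])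
        linarith
      refine (Finset.sum_le_card_nsmul _ _ _ this).trans ?_
      rw [nsmul_eq_mul]
      have : (((freeSet X w w').erase y).card : ℝ) ≤ n := by
        simpa using Finset.card_le_card (Finset.subset_univ ((freeSet X w w').erase y))
      exact mul_le_mul_of_nonneg_right this (by linarith)
  refine (Finset.sum_le_card_nsmul _ _ _ key).trans ?_
  rw [nsmul_eq_mul, ← sq]
  calc _ ≤ (n : ℝ) * (1 + n * (2 * ρ)) :=
        mul_le_mul_of_nonneg_right card_freeSet_le (by positivity)
    _ = _ := by ring

lemma Approx.av_tau_mul_Delta_mul (hq : Approx X G q ρ) (h0 : ∀ u v, 0 ≤ q u v)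
    (h1 : ∀ u v, q u v ≤ 1) (h : Fam L lam X G) (hL : 0 ≤ L) (hρ : 0 ≤ ρ) (hw : w ≠ w')
    (hk : k ∈ freeSet X w w') :
    |av X G (fun H => tau H w w' k * Delta X H w w' * (((symDiffSet X H w w').card : ℝ) -
      ∑ z ∈ freeSet X w w', tauq q w w' z))| ≤ 8 * n * (L * √n) * ρ + 4 * (L * √n) := by
  have hk' := mem_freeSet.mp hk
  simp only [card_symDiffSet_sub, Finset.mul_sum]
  rw [av_sum, ← Finset.add_sum_erase _ _ hk, add_comm (8 * _ * _ * _)]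
  set d0 := (deg G w : ℝ) - deg G w' with hd0
  refine (abs_add_le _ _).trans (add_le_add ?_ ?_)
  · refine abs_av_le fun H hH => ?_
    rw [abs_mul, abs_mul]
    calc _ ≤ 1 * (4 * (L * √n)) * 1 := by
          refine mul_le_mul (mul_le_mul abs_tau_le ((h.of_mem_cls hH).abs_Delta_le hw)
            (abs_nonneg _) zero_le_one) (abs_tau_sub_le h0 h1 k) (abs_nonneg _) (by positivity)
      _ = _ := by ring
  have key : ∀ z ∈ (freeSet X w w').erase k, |av X G (fun H =>
      tau H w w' k * Delta X H w w' * (tau H w w' z - tauq q w w' z))| ≤ 8 * (L * √n) * ρ := by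
    intro z hz
    rw [Finset.mem_erase] at hz
    have hz' := mem_freeSet.mp hz.2
    have e : av X G (fun H => tau H w w' k * Delta X H w w' * (tau H w w' z - tauq q w w' z)) =
        av X G (fun H => (tau H w w' k * d0) * (tau H w w' z - tauq q w w' z)) -
        ∑ y ∈ fixedSet X w w', av X G (fun H =>
          (tau H w w' k * (ind H w y - ind H w' y)) * (tau H w w' z - tauq q w w' z)) := by
      rw [← av_sum, ← av_sub]
      refine av_congr fun H hH => ?_
      rw [Delta_of_mem_cls hw hH, ← Finset.sum_mul, ← Finset.mul_sum]
      ring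
    rw [e]
    have k1 : |av X G (fun H => (tau H w w' k * d0) * (tau H w w' z - tauq q w w' z))| ≤
        2 * (2 * (L * √n)) * ρ := by
      refine hq.av_mul_tau_le h0 h1 (A := {s(w, k), s(w', k)})
          (Finset.card_le_two.trans (by norm_num)) ?_ (fun H hH => ?_) hw hz'.1 hz'.2.1
          (by simp [hz.1, hz'.1, hz'.2.1])
          (by simp [hz.1, hz'.1, hz'.2.1])
      · intro H H' hH
        beta_reduce
        rw [tau_congr hH]
      · rw [abs_mul]
        calc _ ≤ 1 * (2 * (L * √n)) := mul_le_mul abs_tau_le (h.abs_deg_sub_le w w')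
              (abs_nonneg _) zero_le_one
          _ = _ := one_mul _
    have k2 : ∀ y ∈ fixedSet X w w', |av X G (fun H =>
          (tau H w w' k * (ind H w y - ind H w' y)) * (tau H w w' z - tauq q w w' z))| ≤
        2 * 1 * ρ := by
      intro y hy
      have hyz := ne_of_fixed_free hy hz.2
      refine hq.av_mul_tau_le h0 h1 (A := {s(w, k), s(w', k)} ∪ {s(w, y), s(w', y)})
          ((Finset.card_union_le _ _).trans (add_le_add Finset.card_le_two Finset.card_le_two |>.trans
            (by norm_num))) ?_ (fun H hH => ?_) hw hz'.1 hz'.2.1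
          (by simp [hz.1, hz'.1, hz'.2.1, hyz.symm])
          (by simp [hz.1, hz'.1, hz'.2.1, hyz.symm])
      · refine (det_tau k).mul (g := fun H => ind H w y - ind H w' y) ?_
        intro H H' hH
        beta_reduce
        rw [hH w y (by simp), hH w' y (by simp)]
      · rw [abs_mul]
        exact mul_le_one₀ abs_tau_le (abs_nonneg _) (abs_ind_sub_le w y w' y)
    have k3 : |∑ y ∈ fixedSet X w w', av X G (fun H =>
          (tau H w w' k * (ind H w y - ind H w' y)) * (tau H w w' z - tauq q w w' z))| ≤
        2 * (L * √n) * (2 * 1 * ρ) := by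
      refine (Finset.abs_sum_le_sum_abs _ _).trans ((Finset.sum_le_card_nsmul _ _ _ k2).trans ?_)
      rw [nsmul_eq_mul]
      exact mul_le_mul_of_nonneg_right (h.card_fixedSet_le w w') (by linarith)
    exact (abs_sub _ _).trans (by linarith)
  refine (Finset.abs_sum_le_sum_abs _ _).trans ((Finset.sum_le_card_nsmul _ _ _ key).trans ?_)
  rw [nsmul_eq_mul]
  have : (((freeSet X w w').erase k).card : ℝ) ≤ n := by
    simpa using Finset.card_le_card (Finset.subset_univ ((freeSet X w w').erase k))
  calc _ ≤ (n : ℝ) * (8 * (L * √n) * ρ) := mul_le_mul_of_nonneg_right this (by positivity)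
    _ = _ := by ring

/-- The difference of the probabilities of two pairs with a common vertex. -/
lemma Approx.prob_sub_prob (hq : Approx X G q ρ) (h0 : ∀ u v, 0 ≤ q u v)
    (h1 : ∀ u v, q u v ≤ 1) (h : Fam L lam X G) (hB : Big n L) (hρ : 0 ≤ ρ) (hw : w ≠ w')
    (hk : k ∈ freeSet X w w') (hμ : (n : ℝ) / L ^ 2 ≤ ∑ z ∈ freeSet X w w', tauq q w w' z) :
    |prob X G w k - prob X G w' k - Deltaq X G q w w' * tauq q w w' k /
      ∑ z ∈ freeSet X w w', tauq q w w' z| ≤ L ^ 8 * (ρ / √n + 1 / √n ^ 3) := by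
  obtain ⟨hs0, hns, hn0, hn1⟩ := hB.basic
  have hL := hB.L_ge
  have m1 := hq.av_tau_mul_Delta h0 h1 h hρ hw hk
  have m2 := hq.av_tau_mul_Delta_mul h0 h1 h (by linarith) hρ hw hk
  have m3 := hq.av_sq_le h0 h1 hρ hw
  set μ := ∑ z ∈ freeSet X w w', tauq q w w' z with hμdef
  set s := √(n : ℝ) with hs
  set D0 := Deltaq X G q w w'
  have hθ : 0 < (n : ℝ) / L ^ 2 := by positivity
  have hμ0 : 0 < μ := lt_of_lt_of_le hθ hμ
  have hμn : μ ≤ n := by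
    refine (Finset.sum_le_card_nsmul _ _ (1 : ℝ) fun z _ => (tauq_mem h0 h1 z).2).trans ?_
    simpa using card_freeSet_le
  have e : prob X G w k - prob X G w' k =
      (1 / μ) * av X G (fun H => tau H w w' k * Delta X H w w') -
      (1 / μ ^ 2) * av X G (fun H => tau H w w' k * Delta X H w w' *
        (((symDiffSet X H w w').card : ℝ) - μ)) +
      (1 / μ ^ 2) * av X G (fun H => tau H w w' k * Delta X H w w' *
        (((symDiffSet X H w w').card : ℝ) - μ) ^ 2 * ((symDiffSet X H w w').card : ℝ)⁻¹) := by
    rw [prob, prob, av_sub_av_eq hw hk, ← av_mul_left, ← av_mul_left, ← av_mul_left, ← av_sub,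
      ← av_add]
    refine av_congr fun H _ => ?_
    by_cases hT : symDiffSet X H w w' = ∅
    · have : tau H w w' k = 0 := by
        rw [tau_eq, if_neg]
        intro hne
        have : k ∈ symDiffSet X H w w' := Finset.mem_filter.mpr ⟨hk, hne⟩
        rw [hT] at this
        simp at this
      rw [this]; ring
    · have hT' : ((symDiffSet X H w w').card : ℝ) ≠ 0 := by simpa using hT
      field_simp
      ring
  have m4 : |av X G (fun H => tau H w w' k * Delta X H w w' *
        (((symDiffSet X H w w').card : ℝ) - μ) ^ 2 * ((symDiffSet X H w w').card : ℝ)⁻¹)| ≤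
      4 * (L * s) * ((n + 2 * n ^ 2 * ρ) * (L ^ 2 / n) + 1) := by
    have k1 : ∀ H ∈ cls X G, |tau H w w' k * Delta X H w w' *
        (((symDiffSet X H w w').card : ℝ) - μ) ^ 2 * ((symDiffSet X H w w').card : ℝ)⁻¹| ≤
        4 * (L * s) * ((L ^ 2 / n) * (((symDiffSet X H w w').card : ℝ) - μ) ^ 2 +
          n ^ 2 * if ((symDiffSet X H w w').card : ℝ) < n / L ^ 2 then 1 else 0) := by
      intro H hH
      have hD := (h.of_mem_cls hH).abs_Delta_le hw
      set T := ((symDiffSet X H w w').card : ℝ) with hT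
      have hT0 : 0 ≤ T := Nat.cast_nonneg _
      have hTn : T ≤ n := by
        refine le_trans ?_ (card_freeSet_le (X := X) (w := w) (w' := w'))
        rw [hT]; exact_mod_cast Finset.card_le_card (Finset.filter_subset _ _)
      rw [mul_assoc, abs_mul]
      refine mul_le_mul ?_ ?_ (abs_nonneg _) (by positivity)
      · rw [abs_mul]
        calc _ ≤ 1 * (4 * (L * s)) := mul_le_mul abs_tau_le hD (abs_nonneg _) zero_le_one
          _ = _ := one_mul _
      · have hTi : 0 ≤ T⁻¹ := inv_nonneg.mpr hT0
        rw [abs_of_nonneg (mul_nonneg (sq_nonneg _) hTi)]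
        split_ifs with hc
        · have k2 : T⁻¹ ≤ 1 := Nat.cast_inv_le_one _
          have k3 : (T - μ) ^ 2 ≤ (n : ℝ) ^ 2 := by
            rw [sq_le_sq, abs_of_pos hn0, abs_le]
            constructor <;> linarith
          have k4 : (T - μ) ^ 2 * T⁻¹ ≤ (n : ℝ) ^ 2 * 1 :=
            mul_le_mul k3 k2 hTi (by positivity)
          have k5 : 0 ≤ L ^ 2 / n * (T - μ) ^ 2 := by positivity
          linarith
        · rw [not_lt] at hc
          have : T⁻¹ ≤ L ^ 2 / n := by
            rw [← inv_div]; exact inv_anti₀ hθ hc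
          have := mul_le_mul_of_nonneg_left this (sq_nonneg (T - μ))
          linarith
    refine (abs_av_le_av k1).trans ?_
    rw [av_mul_left, av_add, av_mul_left, av_mul_left]
    have k2 := h.av_small_le hB hw.symm
    refine mul_le_mul_of_nonneg_left (add_le_add ?_ ?_) (by positivity)
    · rw [mul_comm]
      exact mul_le_mul_of_nonneg_right m3 (by positivity)
    · calc _ ≤ (n : ℝ) ^ 2 * (1 / (n : ℝ) ^ 2) := mul_le_mul_of_nonneg_left k2 (by positivity)
        _ = 1 := by field_simp
  have hμi : 1 / μ ≤ L ^ 2 / s ^ 2 := by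
    rw [← hns, ← one_div_div (n : ℝ)]; exact one_div_le_one_div_of_le hθ hμ
  have hμi2 : 1 / μ ^ 2 ≤ (L ^ 2 / s ^ 2) ^ 2 := by
    rw [← one_div_pow]; exact pow_le_pow_left₀ (by positivity) hμi 2
  rw [e]
  set P1 := av X G (fun H => tau H w w' k * Delta X H w w')
  set P2 := av X G (fun H => tau H w w' k * Delta X H w w' *
        (((symDiffSet X H w w').card : ℝ) - μ))
  set P3 := av X G (fun H => tau H w w' k * Delta X H w w' *
        (((symDiffSet X H w w').card : ℝ) - μ) ^ 2 * ((symDiffSet X H w w').card : ℝ)⁻¹)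
  have e2 : 1 / μ * P1 - 1 / μ ^ 2 * P2 + 1 / μ ^ 2 * P3 - D0 * tauq q w w' k / μ =
      1 / μ * (P1 - tauq q w w' k * D0) + (1 / μ ^ 2 * P3 - 1 / μ ^ 2 * P2) := by ring
  rw [e2]
  have hLpos : 0 < L := by linarith
  have n1 : |1 / μ * (P1 - tauq q w w' k * D0)| ≤ L ^ 2 / s ^ 2 * (12 * (L * s) * ρ) := by
    rw [abs_mul, abs_of_pos (by positivity : 0 < 1 / μ)]
    exact mul_le_mul hμi m1 (abs_nonneg _) (by positivity)
  have n2 : |1 / μ ^ 2 * P2| ≤ (L ^ 2 / s ^ 2) ^ 2 * (8 * n * (L * s) * ρ + 4 * (L * s)) := by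
    rw [abs_mul, abs_of_pos (by positivity : 0 < 1 / μ ^ 2)]
    exact mul_le_mul hμi2 m2 (abs_nonneg _) (by positivity)
  have n3 : |1 / μ ^ 2 * P3| ≤ (L ^ 2 / s ^ 2) ^ 2 *
      (4 * (L * s) * ((n + 2 * n ^ 2 * ρ) * (L ^ 2 / n) + 1)) := by
    rw [abs_mul, abs_of_pos (by positivity : 0 < 1 / μ ^ 2)]
    exact mul_le_mul hμi2 m4 (abs_nonneg _) (by positivity)
  refine (abs_add_le _ _).trans ((add_le_add n1 ((abs_sub _ _).trans (add_le_add n3 n2))).trans ?_)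
  have e3 : L ^ 2 / s ^ 2 * (12 * (L * s) * ρ) + ((L ^ 2 / s ^ 2) ^ 2 *
      (4 * (L * s) * ((n + 2 * n ^ 2 * ρ) * (L ^ 2 / n) + 1)) +
      (L ^ 2 / s ^ 2) ^ 2 * (8 * n * (L * s) * ρ + 4 * (L * s))) =
      (12 * L ^ 3 + 8 * L ^ 5 + 8 * L ^ 7) * (ρ / s) + (4 * L ^ 7 + 8 * L ^ 5) * (1 / s ^ 3) := by
    rw [hns]; field_simp; ring
  rw [e3, mul_add]
  have p1 : L ^ 3 ≤ L ^ 7 := pow_le_pow_right₀ (by linarith) (by norm_num)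
  have p2 : L ^ 5 ≤ L ^ 7 := pow_le_pow_right₀ (by linarith) (by norm_num)
  have p3 : 100 * L ^ 7 ≤ L ^ 8 := by
    calc _ ≤ L * L ^ 7 := by gcongr
      _ = _ := by ring
  have p4 : 0 < L ^ 7 := by positivity
  gcongr <;> linarith

end swap

/-! ### Second estimate of the edge probabilities -/

section second
variable {n : ℕ} {X Y : Set (Sym2 (Fin n))} {G H : SimpleGraph (Fin n)} {L lam : ℝ}
  {q : Fin n → Fin n → ℝ} {w w' k : Fin n}

/-- The matrix which is given by `G` on the pairs in `X` and by `f` on the other pairs. -/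
noncomputable def extend (X : Set (Sym2 (Fin n))) (G : SimpleGraph (Fin n))
    (f : Fin n → Fin n → ℝ) (u v : Fin n) : ℝ :=
  if u = v then 0 else if s(u, v) ∈ X then ind G u v else f u v

lemma extend_self (f : Fin n → Fin n → ℝ) (u : Fin n) : extend X G f u u = 0 := by simp [extend]

lemma extend_comm {f : Fin n → Fin n → ℝ} (hf : ∀ u v, f u v = f v u) (u v : Fin n) :
    extend X G f u v = extend X G f v u := by
  simp only [extend, eq_comm (a := u), Sym2.eq_swap (a := u), ind_comm G u, hf u]

lemma extend_of_mem {f : Fin n → Fin n → ℝ} {u v : Fin n} (h : u ≠ v) (hX : s(u, v) ∈ X) :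
    extend X G f u v = ind G u v := by simp [extend, h, hX]

lemma extend_of_notMem {f : Fin n → Fin n → ℝ} {u v : Fin n} (h : u ≠ v) (hX : s(u, v) ∉ X) :
    extend X G f u v = f u v := by simp [extend, h, hX]

lemma extend_mem_Icc {f : Fin n → Fin n → ℝ} (h : ∀ u v, 0 ≤ f u v ∧ f u v ≤ 1) (u v : Fin n) :
    0 ≤ extend X G f u v ∧ extend X G f u v ≤ 1 := by
  unfold extend
  split_ifs
  · norm_num
  · exact ⟨ind_nonneg _ _ _, ind_le_one _ _ _⟩
  · exact h u v

lemma sum_extend (f : Fin n → Fin n → ℝ) (v : Fin n) :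
    ∑ z, extend X G f v z = fixedDeg X G v + ∑ z ∈ freeNbrs X v, f v z := by
  rw [sum_eq_fixedNbrs_add (X := X) v, extend_self, zero_add, fixedDeg]
  congr 1
  · refine Finset.sum_congr rfl fun z hz => ?_
    simp only [fixedNbrs, Finset.mem_filter, Finset.mem_univ, true_and] at hz
    exact extend_of_mem hz.1.symm hz.2
  · refine Finset.sum_congr rfl fun z hz => ?_
    simp only [freeNbrs, Finset.mem_filter, Finset.mem_univ, true_and] at hz
    exact extend_of_notMem hz.1.symm hz.2

lemma Deltaq_extend {f : Fin n → Fin n → ℝ} (hf : ∀ u v, f u v = f v u) (hw : w ≠ w') :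
    Deltaq X G (extend X G f) w w' =
      (deg G w - fixedDeg X G w - ∑ z ∈ freeNbrs X w, f w z) -
      (deg G w' - fixedDeg X G w' - ∑ z ∈ freeNbrs X w', f w' z) +
      ∑ z ∈ freeSet X w w', (f w z - f w' z) := by
  have h1 := sum_extend (X := X) (G := G) f w
  have h2 := sum_extend (X := X) (G := G) f w'
  have h3 := sum_eq_free_add_fixed (X := X) hw
    (fun z => extend X G f w z - extend X G f w' z)
  rw [Finset.sum_sub_distrib, h1, h2, extend_self, extend_self, extend_comm hf w' w] at h3
  have h4 : ∑ z ∈ freeSet X w w', (extend X G f w z - extend X G f w' z) =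
      ∑ z ∈ freeSet X w w', (f w z - f w' z) := by
    refine Finset.sum_congr rfl fun z hz => ?_
    rw [mem_freeSet] at hz
    rw [extend_of_notMem hz.1.symm hz.2.2.1, extend_of_notMem hz.2.1.symm hz.2.2.2]
  unfold Deltaq
  linarith

/-- The normalized deviation of the free degree of `v` from its typical value. -/
noncomputable def dev (X : Set (Sym2 (Fin n))) (G : SimpleGraph (Fin n)) (lam : ℝ) (v : Fin n) :
    ℝ :=
  (deg G v - fixedDeg X G v - lam * (freeNbrs X v).card) / n

lemma Fam.abs_dev_le (h : Fam L lam X G) (hB : Big n L) (v : Fin n) :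
    |dev X G lam v| ≤ 2 * L / √n := by
  obtain ⟨hs0, hns, hn0, hn1⟩ := hB.basic
  have hL := hB.L_ge
  have hd := abs_le.mp (h.deg_near v)
  have hx := h.fix_le v
  have hf0 := fixedDeg_nonneg (X := X) (G := G) v
  have hf := fixedDeg_le (X := X) (G := G) v
  have hl0 := h.lam_pos hL
  have hl1 := h.lam_lt_one hL
  unfold dev
  rw [abs_div, abs_of_pos hn0, div_le_iff₀ hn0, card_freeNbrs]
  have e : 2 * L / √(n : ℝ) * n = 2 * (L * √n) := by
    nth_rw 2 [hns]; field_simp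
  rw [e, abs_le]
  set x := ((fixedNbrs X v).card : ℝ)
  have hx0 : 0 ≤ x := Nat.cast_nonneg _
  constructor <;> nlinarith [hd.1, hd.2]

lemma Fam.abs_sum_dev_le (h : Fam L lam X G) (hB : Big n L) :
    |∑ v, dev X G lam v| ≤ L ^ 2 := by
  obtain ⟨hs0, hns, hn0, hn1⟩ := hB.basic
  have hL := hB.L_ge
  have hl0 := h.lam_pos hL
  have hl1 := h.lam_lt_one hL
  have e : ∑ v, dev X G lam v =
      (∑ v, (lam * (fixedNbrs X v).card - fixedDeg X G v)) / n := by
    unfold dev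
    rw [← Finset.sum_div]
    congr 1
    simp only [Finset.sum_sub_distrib, ← Finset.mul_sum, h.deg_sum, card_freeNbrs]
    simp
    ring
  rw [e, abs_div, abs_of_pos hn0, div_le_iff₀ hn0]
  refine (Finset.abs_sum_le_sum_abs _ _).trans (le_trans ?_ h.fix_sum)
  refine Finset.sum_le_sum fun v _ => ?_
  have hf0 := fixedDeg_nonneg (X := X) (G := G) v
  have hf := fixedDeg_le (X := X) (G := G) v
  rw [abs_le]; constructor <;> nlinarith

lemma Fam.card_freeSet_ge (h : Fam L lam X G) (hB : Big n L) (hw : w ≠ w') :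
    (n : ℝ) - 3 * (L * √n) ≤ (freeSet X w w').card ∧ (n : ℝ) / 2 ≤ (freeSet X w w').card := by
  obtain ⟨hs0, hns, hn0, -⟩ := hB.basic
  have hL := hB.L_ge
  have h1 : L ^ 2 ≤ √(n : ℝ) := hB.pow_le_sqrt (by norm_num)
  have h2 := h.card_fixedSet_le w w'
  have h3 := sum_eq_free_add_fixed (X := X) hw fun _ => (1 : ℝ)
  simp at h3
  set s := √(n : ℝ) with hs
  have h4 : 100 * 100 ≤ L * s := by
    have : 100 ≤ s := by nlinarith
    gcongr
  have h5 : 100 * (L * s) ≤ n := by rw [hns]; nlinarith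
  constructor <;> linarith

lemma Fam.lam_mul_ge (h : Fam L lam X G) (hL : 100 ≤ L) : 1 ≤ L * (2 * lam * (1 - lam)) := by
  have h0 := h.lam_pos hL
  have h1 := h.lam_lt_one hL
  have := h.lam_lo
  have := h.lam_hi
  by_cases hc : lam ≤ 1 / 2
  · nlinarith
  · nlinarith

lemma Fam.approx_lam (h : Fam L lam X G) (hB : Big n (2 * L)) (hL : 100 ≤ L) :
    Approx X G (extend X G fun _ _ => lam) (L ^ 5 / √n) := by
  intro A hA G' hG' u v huv hu
  by_cases hX : s(u, v) ∈ X
  · rw [extend_of_mem huv hX, prob_of_mem (Or.inl hX), (mem_cls.mp hG').2 u v hX, sub_self,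
      abs_zero]
    positivity
  · rw [extend_of_notMem huv hX]
    refine ((h.union hL hB.basic.2.2.2 hA hG').abs_prob_sub_lam_le hB huv ?_).trans ?_
    · rintro (h | h)
      · exact hX h
      · exact hu h
    · gcongr
      calc (2 * L) ^ 4 = 16 * L ^ 4 := by ring
        _ ≤ L * L ^ 4 := by gcongr; linarith
        _ = L ^ 5 := by ring

lemma Fam.abs_prob_sub_sub_le (h : Fam L lam X G) (hB : Big n (2 * L)) (hL : 100 ≤ L)
    (hw : w ≠ w') (hk : k ∈ freeSet X w w') :
    |prob X G w k - prob X G w' k - (dev X G lam w - dev X G lam w')| ≤ L ^ 14 / √n ^ 2 := by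
  have hB1 : Big n L := hB.mono hL (by linarith)
  obtain ⟨hs0, hns, hn0, hn1⟩ := hB1.basic
  have hl0 := h.lam_pos hL
  have hl1 := h.lam_lt_one hL
  have hk' := mem_freeSet.mp hk
  have hq01 := extend_mem_Icc (X := X) (G := G) (f := fun _ _ => lam) fun _ _ => ⟨hl0.le, hl1.le⟩
  have htau : ∀ z ∈ freeSet X w w', tauq (extend X G fun _ _ => lam) w w' z =
      2 * lam * (1 - lam) := by
    intro z hz
    rw [mem_freeSet] at hz
    rw [tauq, extend_of_notMem hz.1.symm hz.2.2.1, extend_of_notMem hz.2.1.symm hz.2.2.2]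
    ring
  have hsum : ∑ z ∈ freeSet X w w', tauq (extend X G fun _ _ => lam) w w' z =
      (freeSet X w w').card * (2 * lam * (1 - lam)) := by
    rw [Finset.sum_congr rfl htau]; simp
  obtain ⟨hF1, hF2⟩ := h.card_freeSet_ge hB1 hw
  have hF3 := card_freeSet_le (X := X) (w := w) (w' := w')
  have hc := h.lam_mul_ge hL
  have h1 := (h.approx_lam hB hL).prob_sub_prob (fun u v => (hq01 u v).1) (fun u v => (hq01 u v).2) h
    hB1 (by positivity) hw hk (by
      rw [hsum, div_le_iff₀ (by positivity)]
      have : (n : ℝ) / 2 * 1 ≤ (freeSet X w w').card * (L * (2 * lam * (1 - lam))) :=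
        mul_le_mul hF2 hc zero_le_one (Nat.cast_nonneg _)
      nlinarith)
  rw [htau k hk, hsum, Deltaq_extend (fun _ _ => rfl) hw] at h1
  set F := ((freeSet X w w').card : ℝ) with hF
  set s := √(n : ℝ) with hs
  have hF0 : 0 < F := by linarith
  have hcpos : 0 < 2 * lam * (1 - lam) := by nlinarith
  have hD : (deg G w - fixedDeg X G w - ∑ z ∈ freeNbrs X w, lam) -
      (deg G w' - fixedDeg X G w' - ∑ z ∈ freeNbrs X w', lam) +
      ∑ z ∈ freeSet X w w', (lam - lam) = n * (dev X G lam w - dev X G lam w') := by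
    simp only [sub_self, Finset.sum_const_zero, Finset.sum_const, nsmul_eq_mul, dev]
    field_simp
    ring
  rw [hD, mul_div_mul_right _ _ hcpos.ne'] at h1
  have ha := h.abs_dev_le hB1 w
  have ha' := h.abs_dev_le hB1 w'
  set D := dev X G lam w - dev X G lam w' with hDdef
  have hDle : |D| ≤ 4 * L / s := by
    refine (abs_sub _ _).trans ((add_le_add ha ha').trans (le_of_eq ?_))
    ring
  have h2 : |n * D / F - D| ≤ 24 * L ^ 2 / s ^ 2 := by
    have e : n * D / F - D = D * ((n - F) / F) := by field_simp
    rw [e, abs_mul]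
    have : |(n - F) / F| ≤ 3 * (L * s) / (s ^ 2 / 2) := by
      rw [abs_div, abs_of_pos hF0, abs_of_nonneg (by linarith), ← hns]
      gcongr
      linarith
    calc _ ≤ 4 * L / s * (3 * (L * s) / (s ^ 2 / 2)) :=
          mul_le_mul hDle this (abs_nonneg _) (div_nonneg (by linarith) hs0.le)
      _ = _ := by field_simp; ring
  have h3 : |prob X G w k - prob X G w' k - D| ≤ L ^ 8 * (L ^ 5 / s / s + 1 / s ^ 3) +
      24 * L ^ 2 / s ^ 2 := by
    have e : prob X G w k - prob X G w' k - D = (prob X G w k - prob X G w' k - n * D / F) +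
      (n * D / F - D) := by ring
    rw [e]
    exact (abs_add_le _ _).trans (add_le_add h1 h2)
  refine h3.trans ?_
  have hs1 : 1 ≤ s := by
    have : L ^ 0 ≤ s := hB1.pow_le_sqrt (by norm_num)
    simpa using this
  have h4 : 1 / s ^ 3 ≤ 1 / s ^ 2 :=
    one_div_le_one_div_of_le (by positivity) (pow_le_pow_right₀ hs1 (by norm_num))
  have p1 : L ^ 8 ≤ L ^ 13 := pow_le_pow_right₀ (by linarith) (by norm_num)
  have p2 : L ^ 2 ≤ L ^ 13 := pow_le_pow_right₀ (by linarith) (by norm_num)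
  have p3 : 100 * L ^ 13 ≤ L ^ 14 := by
    calc _ ≤ L * L ^ 13 := by gcongr
      _ = _ := by ring
  calc _ ≤ L ^ 8 * (L ^ 5 / s / s + 1 / s ^ 2) + 24 * L ^ 2 / s ^ 2 := by gcongr
    _ = (L ^ 13 + L ^ 8 + 24 * L ^ 2) / s ^ 2 := by field_simp
    _ ≤ _ := by
      gcongr
      have : 0 < L ^ 13 := by positivity
      linarith

/-- The probability of a free pair up to an error of order `1 / n`. -/
lemma Fam.abs_prob_sub_le (h : Fam L lam X G) (hB : Big n (2 * L)) (hL : 100 ≤ L)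
    (hw : w ≠ k) (hX : s(w, k) ∉ X) :
    |prob X G w k - (lam + dev X G lam w + dev X G lam k)| ≤ L ^ 15 / √n ^ 2 := by
  have hB1 : Big n L := hB.mono hL (by linarith)
  obtain ⟨hs0, hns, hn0, hn1⟩ := hB1.basic
  have hl0 := h.lam_pos hL
  have hl1 := h.lam_lt_one hL
  have hwk : w ∈ freeNbrs X k := by
    simp only [freeNbrs, Finset.mem_filter, Finset.mem_univ, true_and]
    rw [Sym2.eq_swap]; exact ⟨hw, hX⟩
  have h1 := prob_of_differences (G := G) (fun w' => dev X G lam w - dev X G lam w')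
    (L ^ 14 / √n ^ 2) hwk (by positivity)
    (fun w' h1 h2 => h.abs_prob_sub_sub_le hB hL h1 h2) (sub_self _)
  have hV := h.card_freeNbrs_ge hB1 k
  have hV1 := card_freeNbrs (X := X) k
  have hx := h.fix_le k
  have hak := h.abs_dev_le hB1 k
  have hsumdev := h.abs_sum_dev_le hB1
  have hdk : deg G k - fixedDeg X G k = lam * (freeNbrs X k).card + n * dev X G lam k := by
    unfold dev; field_simp; ring
  set V := ((freeNbrs X k).card : ℝ) with hVdef
  set s := √(n : ℝ) with hs
  set x := ((fixedNbrs X k).card : ℝ) with hxdef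
  have hx0 : 0 ≤ x := Nat.cast_nonneg _
  have hV0 : 0 < V := by linarith
  have hs1 : 1 ≤ s := by
    have : L ^ 0 ≤ s := hB1.pow_le_sqrt (by norm_num)
    simpa using this
  have hLs : 1 ≤ L * s := by nlinarith
  have hfix : |∑ z ∈ fixedNbrs X k, dev X G lam z| ≤ x * (2 * L / s) := by
    refine (Finset.abs_sum_le_sum_abs _ _).trans ?_
    rw [hxdef, ← nsmul_eq_mul]
    exact Finset.sum_le_card_nsmul _ _ _ fun z _ => h.abs_dev_le hB1 z
  have hfree : |∑ z ∈ freeNbrs X k, dev X G lam z| ≤ 5 * L ^ 2 := by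
    have e := sum_eq_fixedNbrs_add (X := X) k (dev X G lam)
    have e1 : ∑ z ∈ freeNbrs X k, dev X G lam z = ∑ z, dev X G lam z - (dev X G lam k +
      ∑ z ∈ fixedNbrs X k, dev X G lam z) := by linarith
    have e2 : x * (2 * L / s) ≤ 2 * L ^ 2 := by
      calc _ ≤ (L * s) * (2 * L / s) := by gcongr
        _ = _ := by field_simp
    have e3 : 2 * L / s ≤ 2 * L ^ 2 := by
      rw [div_le_iff₀ hs0]; nlinarith
    rw [e1]
    refine (abs_sub _ _).trans ?_
    have := abs_add_le (dev X G lam k) (∑ z ∈ fixedNbrs X k, dev X G lam z)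
    linarith
  rw [Finset.sum_sub_distrib, Finset.sum_const, nsmul_eq_mul, ← hVdef, hdk] at h1
  have hxa : |(1 + x) * dev X G lam k| ≤ 4 * L ^ 2 := by
    rw [abs_mul, abs_of_nonneg (by linarith)]
    calc _ ≤ (2 * (L * s)) * (2 * L / s) := by gcongr; linarith
      _ = _ := by field_simp; ring
  have h2 : |V * (prob X G w k - (lam + dev X G lam w + dev X G lam k))| ≤
      V * (L ^ 14 / s ^ 2) + 9 * L ^ 2 := by
    have e : V * (prob X G w k - (lam + dev X G lam w + dev X G lam k)) =
      (V * prob X G w k - (lam * V + n * dev X G lam k) -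
        (V * dev X G lam w - ∑ z ∈ freeNbrs X k, dev X G lam z)) +
      ((1 + x) * dev X G lam k - ∑ z ∈ freeNbrs X k, dev X G lam z) := by
      rw [hV1]; ring
    rw [e]
    refine (abs_add_le _ _).trans (add_le_add h1 ((abs_sub _ _).trans ?_))
    linarith
  rw [abs_mul, abs_of_pos hV0] at h2
  have h3 : 9 * L ^ 2 ≤ V * (18 * L ^ 2 / s ^ 2) := by
    calc 9 * L ^ 2 = (s ^ 2 / 2) * (18 * L ^ 2 / s ^ 2) := by field_simp; ring
      _ ≤ V * (18 * L ^ 2 / s ^ 2) := by rw [← hns]; gcongr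
  have h4 : V * |prob X G w k - (lam + dev X G lam w + dev X G lam k)| ≤
      V * (L ^ 14 / s ^ 2 + 18 * L ^ 2 / s ^ 2) := by rw [mul_add]; linarith
  refine (le_of_mul_le_mul_left h4 hV0).trans ?_
  rw [← add_div]
  gcongr
  have p2 : L ^ 2 ≤ L ^ 14 := pow_le_pow_right₀ (by linarith) (by norm_num)
  have p3 : 100 * L ^ 14 ≤ L ^ 15 := by
    calc _ ≤ L * L ^ 14 := by gcongr
      _ = _ := by ring
  have : 0 < L ^ 14 := by positivity
  linarith

end second

/-! ### Third estimate of the edge probabilities -/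

section third
variable {n : ℕ} {X Y : Set (Sym2 (Fin n))} {G H : SimpleGraph (Fin n)} {L lam : ℝ}
  {w w' k : Fin n}

lemma fixedNbrs_union_sdiff_card (A : Finset (Sym2 (Fin n))) (v : Fin n) :
    (fixedNbrs (X ∪ ↑A) v \ fixedNbrs X v).card ≤ A.card := by
  refine Finset.card_le_card_of_injOn (fun z => s(v, z)) ?_ ?_
  · intro z hz
    simp only [fixedNbrs, Finset.coe_sdiff, Set.mem_sdiff, Finset.mem_coe, Finset.mem_filter,
      Finset.mem_univ, true_and, Set.mem_union] at hz
    simp only [Finset.mem_coe]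
    tauto
  · intro z _ z' _ hzz
    exact Sym2.congr_right.mp hzz

lemma fixedNbrs_mono (h : X ⊆ Y) (v : Fin n) : fixedNbrs X v ⊆ fixedNbrs Y v := by
  intro z hz
  simp only [fixedNbrs, Finset.mem_filter, Finset.mem_univ, true_and] at hz ⊢
  exact ⟨hz.1, h hz.2⟩

lemma abs_dev_union_sub_le {A : Finset (Sym2 (Fin n))} (hA : A.card ≤ 6) (hH : H ∈ cls X G)
    (hl0 : 0 ≤ lam) (hl1 : lam ≤ 1) (v : Fin n) :
    |dev (X ∪ ↑A) H lam v - dev X G lam v| ≤ 6 / n := by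
  have hsub := fixedNbrs_mono (X := X) (Y := X ∪ ↑A) Set.subset_union_left v
  have hcard := fixedNbrs_union_sdiff_card (X := X) A v
  set D := fixedNbrs (X ∪ ↑A) v \ fixedNbrs X v with hD
  have h1 : fixedDeg (X ∪ ↑A) H v = fixedDeg X G v + ∑ z ∈ D, ind H v z := by
    rw [fixedDeg, ← Finset.sum_sdiff hsub, add_comm, ← hD]
    congr 1
    refine Finset.sum_congr rfl fun z hz => ?_
    simp only [fixedNbrs, Finset.mem_filter, Finset.mem_univ, true_and] at hz
    exact (mem_cls.mp hH).2 v z hz.2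
  have h2 : ((fixedNbrs (X ∪ ↑A) v).card : ℝ) = (fixedNbrs X v).card + D.card := by
    rw [← Finset.card_sdiff_add_card_eq_card hsub, ← hD]
    push_cast; ring
  have h3 : 0 ≤ ∑ z ∈ D, ind H v z := Finset.sum_nonneg fun z _ => ind_nonneg H v z
  have h4 : ∑ z ∈ D, ind H v z ≤ D.card := by
    simpa using Finset.sum_le_card_nsmul D _ (1 : ℝ) fun z _ => ind_le_one H v z
  have h5 : (D.card : ℝ) ≤ 6 := by exact_mod_cast hcard.trans hA
  have h6 : (0 : ℝ) ≤ D.card := Nat.cast_nonneg _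
  unfold dev
  rw [← sub_div, abs_div, Nat.abs_cast, (mem_cls.mp hH).1, h1, card_freeNbrs, card_freeNbrs, h2]
  refine div_le_div_of_nonneg_right ?_ (Nat.cast_nonneg n)
  rw [abs_le]
  constructor <;> nlinarith

lemma Fam.dev_add_mem_Icc (h : Fam L lam X G) (hB : Big n L) (u v : Fin n) :
    0 ≤ lam + dev X G lam u + dev X G lam v ∧ lam + dev X G lam u + dev X G lam v ≤ 1 := by
  obtain ⟨hs0, -, -, -⟩ := hB.basic
  have hL := hB.L_ge
  have h3 : L ^ 3 ≤ √(n : ℝ) := hB.pow_le_sqrt (by norm_num)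
  have hu := abs_le.mp (h.abs_dev_le hB u)
  have hv := abs_le.mp (h.abs_dev_le hB v)
  have h4 : 2 * L / √(n : ℝ) ≤ 1 / (4 * L) := by
    rw [div_le_div_iff₀ hs0 (by linarith)]
    nlinarith
  have h5 : 1 / (4 * L) = 1 / L / 4 := by field_simp
  have h6 : 1 / L ≤ lam := by
    rw [div_le_iff₀ (by linarith)]; linarith [h.lam_lo]
  have h7 : 1 / L ≤ 1 - lam := by
    rw [div_le_iff₀ (by linarith)]; linarith [h.lam_hi]
  constructor <;> linarith [hu.1, hu.2, hv.1, hv.2]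

lemma Fam.approx_dev (h : Fam L lam X G) (hB : Big n (4 * L)) (hL : 100 ≤ L) :
    Approx X G (extend X G fun u v => lam + dev X G lam u + dev X G lam v)
      (L ^ 18 / √n ^ 2) := by
  intro A hA G' hG' u v huv hu
  have hB1 : Big n L := hB.mono hL (by linarith)
  obtain ⟨hs0, hns, hn0, hn1⟩ := hB1.basic
  by_cases hX : s(u, v) ∈ X
  · rw [extend_of_mem huv hX, prob_of_mem (Or.inl hX), (mem_cls.mp hG').2 u v hX, sub_self,
      abs_zero]
    exact div_nonneg (pow_nonneg (by linarith) _) (by positivity)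
  · rw [extend_of_notMem huv hX]
    have h1 := (h.union hL hn1 hA hG').abs_prob_sub_le (by convert hB using 1; ring) (by linarith)
      huv (by
        rintro (h | h)
        · exact hX h
        · exact hu h)
    have hl0 := (h.lam_pos hL).le
    have hl1 := (h.lam_lt_one hL).le
    have h2 := abs_dev_union_sub_le hA hG' hl0 hl1 u
    have h3 := abs_dev_union_sub_le hA hG' hl0 hl1 v
    have h4 : (2 * L) ^ 15 + 12 ≤ L ^ 18 := by
      have e1 : (32768 : ℝ) * L ^ 15 + 12 ≤ 1000000 * L ^ 15 := by
        have : (1 : ℝ) ≤ L ^ 15 := one_le_pow₀ (by linarith)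
        linarith
      have e2 : (100 : ℝ) ^ 3 * L ^ 15 ≤ L ^ 3 * L ^ 15 := by gcongr
      calc (2 * L) ^ 15 + 12 = 32768 * L ^ 15 + 12 := by ring
        _ ≤ L ^ 3 * L ^ 15 := by linarith
        _ = L ^ 18 := by ring
    have h5 : (2 * L) ^ 15 / √(n : ℝ) ^ 2 + 12 / √(n : ℝ) ^ 2 ≤ L ^ 18 / √(n : ℝ) ^ 2 := by
      rw [← add_div]; gcongr
    have h6 : (6 : ℝ) / n = 6 / √(n : ℝ) ^ 2 := by rw [← hns]
    rw [h6] at h2 h3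
    have h7 : (12 : ℝ) / √(n : ℝ) ^ 2 = 6 / √(n : ℝ) ^ 2 + 6 / √(n : ℝ) ^ 2 := by ring
    refine le_trans ?_ h5
    rw [h7]
    rw [abs_le] at h1 h2 h3 ⊢
    constructor <;> linarith [h1.1, h1.2, h2.1, h2.2, h3.1, h3.2]

set_option maxHeartbeats 1000000 in
lemma ratio_estimate {L T t u g e e' α ν : ℝ} (hL : 100 ≤ L) (hT : 1 ≤ L * T)
    (ht0 : 0 ≤ t) (ht : 100 * L * t ≤ 1) (hu : |u| ≤ 2 * t) (hg : |g| ≤ 2 * t)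
    (he : |e| ≤ 8 * t ^ 2) (he' : |e'| ≤ 12 * t ^ 2) (hα0 : 0 ≤ α) (hα : α ≤ t) (hν0 : 0 ≤ ν)
    (hν : ν ≤ t ^ 2) :
    |(T + u + g + e) / ((1 - α - 2 * ν) * (T + u + e')) - (1 + α + g / T)| ≤ 200 * L ^ 2 * t ^ 2 := by
  have hL0 : 0 < L := by linarith
  have hT0 : 0 < T := by
    by_contra hc
    nlinarith
  have ht1 : t ≤ 1 / 10000 := by nlinarith
  have ht2 : t ^ 2 ≤ t / 10000 := by nlinarith
  have htT : 100 * t ≤ T := by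
    have : L * (100 * t) ≤ L * T := by linarith
    exact le_of_mul_le_mul_left this hL0
  rw [abs_le] at hu hg he he'
  set B := T + u + e' with hB
  have hBT : T / 2 ≤ B := by linarith [hu.1, he'.1]
  have hB0 : 0 < B := by linarith
  set φ := 1 - α - 2 * ν with hφ
  have hφ1 : 1 / 2 ≤ φ := by linarith
  have hφ0 : 0 < φ := by linarith
  have hgT : |g / T| ≤ 2 * L * t := by
    rw [abs_div, abs_of_pos hT0, div_le_iff₀ hT0]
    calc |g| ≤ 2 * t * 1 := by rw [abs_le]; constructor <;> linarith
      _ ≤ 2 * t * (L * T) := by gcongr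
      _ = _ := by ring
  have hx := abs_le.mp hgT
  set x := g / T with hxdef
  have hgx : g = x * T := by rw [hxdef]; field_simp
  have h1 : |(T + u + g + e) / B - (1 + x)| ≤ 100 * L ^ 2 * t ^ 2 := by
    have e1 : (T + u + g + e) / B - (1 + x) = (e - e' - x * (u + e')) / B := by
      rw [hgx]; field_simp; rw [hB]; ring
    rw [e1, abs_div, abs_of_pos hB0, div_le_iff₀ hB0]
    have e2 : |x * (u + e')| ≤ 2 * L * t * (3 * t) := by
      rw [abs_mul]
      refine mul_le_mul hgT ?_ (abs_nonneg _) (by positivity)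
      rw [abs_le]; constructor <;> linarith [hu.1, hu.2, he'.1, he'.2]
    have e3 : 100 * L ^ 2 * t ^ 2 * B ≥ 50 * L * t ^ 2 := by
      have : 50 * L * t ^ 2 * 1 ≤ 50 * L * t ^ 2 * (2 * (L * B)) := by
        gcongr
        nlinarith
      nlinarith
    have e4 : |e - e' - x * (u + e')| ≤ 20 * t ^ 2 + 2 * L * t * (3 * t) := by
      refine (abs_sub _ _).trans (add_le_add ?_ e2)
      rw [abs_le]; constructor <;> linarith [he.1, he.2, he'.1, he'.2]
    nlinarith [sq_nonneg t]
  have h2 : |1 / φ - (1 + α)| ≤ 10 * t ^ 2 := by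
    have e1 : 1 / φ - (1 + α) = (1 - (1 + α) * φ) / φ := by field_simp
    rw [e1, abs_div, abs_of_pos hφ0, div_le_iff₀ hφ0]
    have e2 : 1 - (1 + α) * φ = α ^ 2 + 2 * ν * (1 + α) := by rw [hφ]; ring
    rw [e2, abs_of_nonneg (by positivity)]
    have : α ^ 2 ≤ t ^ 2 := by gcongr
    nlinarith
  have h3 : (T + u + g + e) / (φ * B) - (1 + α + x) =
      (1 / φ) * ((T + u + g + e) / B - (1 + x)) + (1 / φ - (1 + α)) * (1 + x) + α * x := by
    field_simp; ring
  have h4 : |1 / φ| ≤ 5 / 4 := by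
    rw [abs_of_pos (by positivity), div_le_iff₀ hφ0]; linarith
  have h5 : |1 + x| ≤ 2 := by
    have : 2 * L * t ≤ 1 := by nlinarith
    rw [abs_le]; constructor <;> linarith
  have h6 : |α * x| ≤ t * (2 * L * t) := by
    rw [abs_mul, abs_of_nonneg hα0]; gcongr
  have h7 := mul_le_mul h4 h1 (abs_nonneg _) (by norm_num)
  have h8 := mul_le_mul h2 h5 (abs_nonneg _) (mul_nonneg (by norm_num) (sq_nonneg t))
  rw [← abs_mul] at h7 h8
  have h9 : t ^ 2 * (100 * L) ≤ t ^ 2 * L ^ 2 :=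
    mul_le_mul_of_nonneg_left (by nlinarith) (sq_nonneg t)
  have h10 : t ^ 2 * 100 ≤ t ^ 2 * L := mul_le_mul_of_nonneg_left hL (sq_nonneg t)
  rw [h3]
  refine (abs_add_le _ _).trans ((add_le_add ((abs_add_le _ _).trans (add_le_add h7 h8)) h6).trans ?_)
  linarith

end third

section third
variable {n : ℕ} {X Y : Set (Sym2 (Fin n))} {G H : SimpleGraph (Fin n)} {L lam : ℝ}
  {w w' k : Fin n}

lemma fixedSet_eq (hw' : fixedNbrs X w' = ∅) : fixedSet X w w' = fixedNbrs X w := by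
  have h : ∀ z, ¬ (z ≠ w' ∧ s(w', z) ∈ X) := by
    intro z hz
    have : z ∈ fixedNbrs X w' := by simpa [fixedNbrs] using hz
    rw [hw'] at this
    exact absurd this (Finset.notMem_empty z)
  ext z
  rw [mem_fixedSet]
  simp only [fixedNbrs, Finset.mem_filter, Finset.mem_univ, true_and]
  constructor
  · rintro ⟨h1, h2, h3 | h3⟩
    · exact ⟨h1, h3⟩
    · exact absurd ⟨h2, h3⟩ (h z)
  · rintro ⟨h1, h2⟩
    refine ⟨h1, ?_, Or.inl h2⟩
    rintro rfl
    refine h w ⟨h1.symm, ?_⟩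
    rwa [Sym2.eq_swap]

lemma product_estimate {L t D ρ α x a a' σ : ℝ} (hL : 100 ≤ L) (ht0 : 0 ≤ t)
    (hD : D = a - a' + α * a' + σ) (hα0 : 0 ≤ α) (hα : α ≤ t) (ha : |a| ≤ t) (ha' : |a'| ≤ t)
    (hσ : |σ| ≤ t ^ 2) (ht : 100 * L * t ≤ 1) (hx : |x| ≤ 2 * L * t)
    (hρ : |ρ - (1 + α + x)| ≤ 200 * L ^ 2 * t ^ 2) :
    |D * ρ - ((a - a') * (1 + α + x) + α * a' + σ)| ≤ 1000 * L ^ 2 * t ^ 3 := by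
  have ht1 : t ≤ 1 / 10000 := by
    have := mul_le_mul_of_nonneg_right hL ht0
    linarith only [this, ht]
  have ht2 : t ^ 2 ≤ t / 10000 := by nlinarith
  have h1 : |α * a'| ≤ t ^ 2 := by
    rw [abs_mul, abs_of_nonneg hα0, sq]
    exact mul_le_mul hα ha' (abs_nonneg _) ht0
  have h2 : |D| ≤ 3 * t := by
    rw [hD]
    rw [abs_le] at *
    constructor <;> linarith [ha.1, ha.2, ha'.1, ha'.2, h1.1, h1.2, hσ.1, hσ.2]
  have h3 : |α * a' + σ| ≤ 2 * t ^ 2 := (abs_add_le _ _).trans (by linarith)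
  have h4 : |α + x| ≤ 3 * L * t := by
    refine (abs_add_le _ _).trans ?_
    rw [abs_of_nonneg hα0]; nlinarith
  have e : D * ρ - ((a - a') * (1 + α + x) + α * a' + σ) =
      D * (ρ - (1 + α + x)) + (α * a' + σ) * (α + x) := by rw [hD]; ring
  have h5 := mul_le_mul h2 hρ (abs_nonneg _) (by linarith)
  have h6 := mul_le_mul h3 h4 (abs_nonneg _) (by positivity)
  rw [← abs_mul] at h5 h6
  rw [e]
  refine (abs_add_le _ _).trans ((add_le_add h5 h6).trans ?_)
  have : t ^ 3 * L ≤ t ^ 3 * L ^ 2 := mul_le_mul_of_nonneg_left (by nlinarith) (by positivity)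
  have : 0 ≤ t ^ 3 * L ^ 2 := by positivity
  nlinarith

lemma Fam.abs_sum_fixedNbrs_dev_le (h : Fam L lam X G) (hB : Big n L) (v : Fin n) :
    |∑ z ∈ fixedNbrs X v, dev X G lam z| ≤ 2 * L ^ 2 := by
  obtain ⟨hs0, hns, hn0, -⟩ := hB.basic
  have hL := hB.L_ge
  refine (Finset.abs_sum_le_sum_abs _ _).trans ?_
  refine (Finset.sum_le_card_nsmul _ _ _ fun z _ => h.abs_dev_le hB z).trans ?_
  rw [nsmul_eq_mul]
  calc _ ≤ (L * √n) * (2 * L / √n) :=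
        mul_le_mul_of_nonneg_right (h.fix_le v) (div_nonneg (by linarith) hs0.le)
    _ = _ := by field_simp

lemma error_estimate {L s : ℝ} (hL : 100 ≤ L) (hs : 0 < s) :
    L ^ 8 * (L ^ 18 / s ^ 2 / s + 1 / s ^ 3) ≤ (L ^ 10 / s) ^ 3 := by
  have e1 : L ^ 8 * (L ^ 18 / s ^ 2 / s + 1 / s ^ 3) = (L ^ 26 + L ^ 8) / s ^ 3 := by
    field_simp
  rw [e1, div_pow]
  have h1 : L ^ 8 ≤ L ^ 26 := pow_le_pow_right₀ (by linarith) (by norm_num)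
  have h2 : 100 * L ^ 26 ≤ L * L ^ 26 := mul_le_mul_of_nonneg_right hL (by positivity)
  have h3 : L ^ 27 ≤ L ^ 30 := pow_le_pow_right₀ (by linarith) (by norm_num)
  have h4 : 0 ≤ L ^ 26 := by positivity
  gcongr
  calc L ^ 26 + L ^ 8 ≤ L * L ^ 26 := by linarith
    _ = L ^ 27 := by ring
    _ ≤ L ^ 30 := h3
    _ = _ := by ring

set_option maxHeartbeats 2000000 in
lemma Fam.abs_prob_sub_sub_second (h : Fam L lam X G) (hB : Big n (4 * L)) (hL : 100 ≤ L)
    (hw : w ≠ w') (hk : k ∈ freeSet X w w') (hw' : fixedNbrs X w' = ∅) :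
    |prob X G w k - prob X G w' k -
      ((dev X G lam w - dev X G lam w') * (1 + (fixedNbrs X w).card / n +
        (1 - 2 * lam) / (lam * (1 - lam)) * dev X G lam k) +
        (fixedNbrs X w).card / n * dev X G lam w' +
        (∑ z ∈ fixedNbrs X w, dev X G lam z) / n)| ≤ 2000 * L ^ 2 * (L ^ 10 / √n) ^ 3 := by
  have hB1 : Big n L := hB.mono hL (by linarith)
  obtain ⟨hs0, hns, hn0, hn1⟩ := hB1.basic
  have hl0 := h.lam_pos hL
  have hl1 := h.lam_lt_one hL
  have hk' := mem_freeSet.mp hk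
  have hq01 := extend_mem_Icc (X := X) (G := G) (h.dev_add_mem_Icc hB1)
  have hT := h.lam_mul_ge hL
  have hLp : L ^ 50 ≤ √(n : ℝ) := hB1.pow_le_sqrt (by norm_num)
  set a := dev X G lam with ha
  have hat : ∀ v, |a v| ≤ L ^ 10 / √n := by
    intro v
    refine (h.abs_dev_le hB1 v).trans (div_le_div_of_nonneg_right ?_ hs0.le)
    calc 2 * L ≤ L * L := by nlinarith
      _ = L ^ 2 := by ring
      _ ≤ L ^ 10 := pow_le_pow_right₀ (by linarith) (by norm_num)
  have hfw := h.abs_sum_fixedNbrs_dev_le hB1 w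
  have hx := h.fix_le w
  have hA := h.abs_sum_dev_le hB1
  rw [← ha] at hfw hA
  have hF1 := sum_eq_free_add_fixed (X := X) hw fun _ => (1 : ℝ)
  have hF2 := sum_eq_free_add_fixed (X := X) hw a
  rw [fixedSet_eq hw'] at hF1 hF2
  simp only [Finset.sum_const, nsmul_eq_mul, mul_one, Finset.card_univ, Fintype.card_fin] at hF1
  have hFh := (h.card_freeSet_ge hB1 hw).2
  set t := L ^ 10 / √(n : ℝ) with ht
  have ht0 : 0 ≤ t := div_nonneg (pow_nonneg (by linarith) _) hs0.le
  have hnt : n * t ^ 2 = L ^ 20 := by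
    rw [ht, hns, Real.sqrt_sq hs0.le]; field_simp
  set T := 2 * lam * (1 - lam) with hTdef
  set u := (1 - 2 * lam) * (a w + a w') with hu
  set q := extend X G fun u v => lam + a u + a v with hq
  have htau : ∀ z ∈ freeSet X w w', tauq q w w' z =
      T + u + 2 * (1 - 2 * lam) * a z + -(2 * (a w + a z) * (a w' + a z)) := by
    intro z hz
    rw [mem_freeSet] at hz
    rw [tauq, hq, extend_of_notMem hz.1.symm hz.2.2.1, extend_of_notMem hz.2.1.symm hz.2.2.2]
    ring
  have hee : ∀ z, |-(2 * (a w + a z) * (a w' + a z))| ≤ 8 * t ^ 2 := by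
    intro z
    rw [abs_neg, mul_assoc, abs_mul, abs_mul, abs_two]
    have := mul_le_mul ((abs_add_le (a w) (a z)).trans (add_le_add (hat w) (hat z)))
      ((abs_add_le (a w') (a z)).trans (add_le_add (hat w') (hat z))) (abs_nonneg _)
      (add_nonneg ht0 ht0)
    linarith only [this]
  set F := ((freeSet X w w').card : ℝ) with hF
  set ℓ := ((fixedNbrs X w).card : ℝ) with hℓ
  have hℓ0 : 0 ≤ ℓ := Nat.cast_nonneg _
  have hF0 : 0 < F := by linarith
  set e' := (2 * (1 - 2 * lam) * ∑ z ∈ freeSet X w w', a z +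
    ∑ z ∈ freeSet X w w', -(2 * (a w + a z) * (a w' + a z))) / F with he'
  have hsum : ∑ z ∈ freeSet X w w', tauq q w w' z = F * (T + u + e') := by
    rw [Finset.sum_congr rfl htau, Finset.sum_add_distrib, Finset.sum_add_distrib,
      ← Finset.mul_sum, Finset.sum_const, nsmul_eq_mul, ← hF, he']
    field_simp
    ring
  have hL2 : (10000 : ℝ) ≤ L ^ 2 := by nlinarith
  have h20 : 1000 * L ^ 2 ≤ L ^ 20 := by
    calc 1000 * L ^ 2 ≤ L ^ 2 * L ^ 2 := by nlinarith
      _ = L ^ 4 := by ring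
      _ ≤ L ^ 20 := pow_le_pow_right₀ (by linarith) (by norm_num)
  have hLt : 100 * L * t ≤ 1 := by
    rw [ht, mul_div_assoc', div_le_one hs0]
    calc 100 * L * L ^ 10 ≤ L * L * L ^ 10 := by gcongr
      _ = L ^ 12 := by ring
      _ ≤ L ^ 50 := pow_le_pow_right₀ (by linarith) (by norm_num)
      _ ≤ _ := hLp
  have ht1 : t ≤ 1 / 10000 := by
    have := mul_le_mul_of_nonneg_right hL ht0
    linarith only [this, hLt]
  have hab := abs_le.mp (hat w)
  have hab' := abs_le.mp (hat w')
  have h12 : |1 - 2 * lam| ≤ 1 := by rw [abs_le]; constructor <;> linarith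
  have hub : |u| ≤ 2 * t := by
    rw [hu, abs_mul]
    calc _ ≤ 1 * (t + t) := mul_le_mul h12
          ((abs_add_le _ _).trans (add_le_add (hat w) (hat w'))) (abs_nonneg _) zero_le_one
      _ = _ := by ring
  have he'b : |e'| ≤ 12 * t ^ 2 := by
    rw [he', abs_div, abs_of_pos hF0, div_le_iff₀ hF0]
    have e1 : |∑ z ∈ freeSet X w w', a z| ≤ 4 * L ^ 2 := by
      have : ∑ z ∈ freeSet X w w', a z = ∑ z, a z - a w - a w' - ∑ z ∈ fixedNbrs X w, a z := by
        linarith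
      rw [this]
      rw [abs_le] at hA hfw ⊢
      constructor <;> linarith only [hA.1, hA.2, hfw.1, hfw.2, hab.1, hab.2, hab'.1, hab'.2, ht1,
        hL2]
    have e2 : |∑ z ∈ freeSet X w w', -(2 * (a w + a z) * (a w' + a z))| ≤ F * (8 * t ^ 2) := by
      refine (Finset.abs_sum_le_sum_abs _ _).trans ?_
      rw [hF, ← nsmul_eq_mul]
      exact Finset.sum_le_card_nsmul _ _ _ fun z _ => hee z
    have e3 : |2 * (1 - 2 * lam) * ∑ z ∈ freeSet X w w', a z| ≤ 8 * L ^ 2 := by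
      rw [mul_assoc, abs_mul, abs_mul, abs_two]
      have := mul_le_mul h12 e1 (abs_nonneg _) zero_le_one
      linarith
    have e4 : 8 * L ^ 2 ≤ F * (4 * t ^ 2) := by
      have := mul_le_mul_of_nonneg_right hFh (show 0 ≤ 4 * t ^ 2 by positivity)
      linarith only [this, hnt, h20, hL2]
    refine (abs_add_le _ _).trans ((add_le_add e3 e2).trans ?_)
    linarith only [e4]
  have hD : (deg G w - fixedDeg X G w - ∑ z ∈ freeNbrs X w, (lam + a w + a z)) -
      (deg G w' - fixedDeg X G w' - ∑ z ∈ freeNbrs X w', (lam + a w' + a z)) +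
      ∑ z ∈ freeSet X w w', ((lam + a w + a z) - (lam + a w' + a z)) =
      n * (a w - a w' + ℓ / n * a w' + (∑ z ∈ fixedNbrs X w, a z) / n) := by
    have e1 : deg G w - fixedDeg X G w = n * a w + lam * (freeNbrs X w).card := by
      rw [ha, dev]; field_simp; ring
    have e2 : deg G w' - fixedDeg X G w' = n * a w' + lam * (freeNbrs X w').card := by
      rw [ha, dev]; field_simp; ring
    have e3 := sum_eq_fixedNbrs_add (X := X) w a
    have e4 := sum_eq_fixedNbrs_add (X := X) w' a
    have e5 := card_freeNbrs (X := X) w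
    have e6 := card_freeNbrs (X := X) w'
    rw [hw'] at e4 e6
    rw [e1, e2]
    simp only [Finset.sum_add_distrib, Finset.sum_sub_distrib, Finset.sum_const, nsmul_eq_mul]
    rw [Finset.sum_empty] at e4
    rw [Finset.card_empty, Nat.cast_zero] at e6
    rw [← hℓ] at e5
    have e7 : n * (a w - a w' + ℓ / n * a w' + (∑ z ∈ fixedNbrs X w, a z) / n) =
      n * (a w - a w') + ℓ * a w' + ∑ z ∈ fixedNbrs X w, a z := by field_simp
    rw [e7, e5, e6]
    have e8 : F = n - 2 - ℓ := by linarith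
    rw [← hF, e8]
    linear_combination e3 - e4
  have hTpos : 0 < T := by
    by_contra hc
    have := mul_nonpos_of_nonneg_of_nonpos (show 0 ≤ L by linarith only [hL]) (not_lt.mp hc)
    linarith only [this, hT]
  have htT : 100 * t ≤ T := by
    have : L * (100 * t) ≤ L * T := by linarith
    exact le_of_mul_le_mul_left this (by linarith)
  have hB' : T / 2 ≤ T + u + e' := by
    have h1 := (abs_le.mp hub).1
    have h2 := (abs_le.mp he'b).1
    have h3 := mul_le_mul_of_nonneg_right ht1 ht0
    linarith only [h1, h2, h3, htT, ht0]
  have hμ : (n : ℝ) / L ^ 2 ≤ F * (T + u + e') := by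
    rw [div_le_iff₀ (by positivity)]
    have e1 : (n : ℝ) / 2 * (T / 2) ≤ F * (T + u + e') :=
      mul_le_mul hFh hB' (half_pos hTpos).le hF0.le
    have e2 : 100 ≤ L ^ 2 * T := by
      have := mul_le_mul_of_nonneg_left hT (show 0 ≤ L by linarith only [hL])
      linarith only [this, hL]
    have e3 := mul_le_mul_of_nonneg_left e2 hn0.le
    have e4 := mul_le_mul_of_nonneg_right e1 (sq_nonneg L)
    linarith only [e3, e4, hn0]
  have h1 := (h.approx_dev hB hL).prob_sub_prob (fun u v => (hq01 u v).1) (fun u v => (hq01 u v).2)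
    h hB1 (div_nonneg (pow_nonneg (by linarith) _) (sq_nonneg _)) hw hk (by rw [hsum]; exact hμ)
  rw [← ha, ← hq, hsum, htau k hk, hq,
    Deltaq_extend (fun u v => by ring) hw, hD] at h1
  set D := a w - a w' + ℓ / n * a w' + (∑ z ∈ fixedNbrs X w, a z) / n with hDdef
  set ε := -(2 * (a w + a k) * (a w' + a k)) with hε
  have hFn : F = n * (1 - ℓ / n - 2 * (1 / n)) := by
    have : n * (1 - ℓ / n - 2 * (1 / n)) = n - 2 - ℓ := by field_simp; ring
    linarith
  have e1 : n * D * (T + u + 2 * (1 - 2 * lam) * a k + ε) / (F * (T + u + e')) =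
      D * ((T + u + 2 * (1 - 2 * lam) * a k + ε) /
        ((1 - ℓ / n - 2 * (1 / n)) * (T + u + e'))) := by
    rw [hFn, mul_assoc (n : ℝ) D, mul_assoc (n : ℝ) (1 - ℓ / n - 2 * (1 / n)),
      mul_div_mul_left _ _ hn0.ne', mul_div_assoc]
  rw [e1] at h1
  have hα : ℓ / n ≤ t := by
    rw [div_le_iff₀ hn0, ht]
    have e : L ^ 10 / √(n : ℝ) * n = L ^ 10 * √n := by nth_rw 2 [hns]; field_simp
    rw [e]
    refine hx.trans ?_
    have : L ≤ L ^ 10 := le_self_pow₀ (by linarith) (by norm_num)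
    gcongr
  have hν : 1 / (n : ℝ) ≤ t ^ 2 := by
    rw [div_le_iff₀ hn0, mul_comm, hnt]
    exact one_le_pow₀ (by linarith)
  have hg : |2 * (1 - 2 * lam) * a k| ≤ 2 * t := by
    rw [mul_assoc, abs_mul, abs_mul, abs_two]
    have := mul_le_mul h12 (hat k) (abs_nonneg _) zero_le_one
    linarith
  have hgT : 2 * (1 - 2 * lam) * a k / T = (1 - 2 * lam) / (lam * (1 - lam)) * a k := by
    have : 1 - lam ≠ 0 := by linarith
    rw [hTdef]; field_simp
  have h2 := ratio_estimate hL hT ht0 hLt hub hg (hee k) he'b (div_nonneg hℓ0 hn0.le) hα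
    (div_nonneg zero_le_one hn0.le) hν
  rw [hgT] at h2
  have hκ : |(1 - 2 * lam) / (lam * (1 - lam)) * a k| ≤ 2 * L * t := by
    rw [← hgT, abs_div, abs_of_pos hTpos, div_le_iff₀ hTpos]
    have : 2 * t * 1 ≤ 2 * t * (L * T) := mul_le_mul_of_nonneg_left hT (by linarith)
    linarith
  have hσ : |(∑ z ∈ fixedNbrs X w, a z) / n| ≤ t ^ 2 := by
    rw [abs_div, abs_of_pos hn0, div_le_iff₀ hn0, mul_comm, hnt]
    linarith only [hfw, h20, hL2]
  have h3 := product_estimate hL ht0 hDdef (div_nonneg hℓ0 hn0.le) hα (hat w) (hat w') hσ hLt hκ h2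
  have h4 := error_estimate hL hs0
  rw [← ht] at h4
  have h5 : t ^ 3 ≤ 1000 * L ^ 2 * t ^ 3 := by
    have : 1 * t ^ 3 ≤ 1000 * L ^ 2 * t ^ 3 :=
      mul_le_mul_of_nonneg_right (by linarith only [hL2]) (pow_nonneg ht0 3)
    linarith only [this]
  have h6 : L ^ 8 * (L ^ 18 / √(n : ℝ) ^ 2 / √n + 1 / √n ^ 3) + 1000 * L ^ 2 * t ^ 3 ≤
      2000 * L ^ 2 * t ^ 3 := by linarith only [h4, h5]
  exact (abs_sub_le _ _ _).trans ((add_le_add h1 h3).trans h6)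

end third

section third
variable {n : ℕ} {X Y : Set (Sym2 (Fin n))} {G H : SimpleGraph (Fin n)} {L lam : ℝ}
  {w w' k : Fin n}

lemma mean_estimate {L t p a a' x α β ν σ A B S γ E : ℝ} (hL : 100 ≤ L) (ht0 : 0 ≤ t)
    (ht : 100 * L * t ≤ 1) (ha : |a| ≤ t) (ha' : |a'| ≤ t) (hx : |x| ≤ 2 * L * t)
    (hα : |α| ≤ t) (hβ0 : 0 ≤ β) (hβ : β ≤ t) (hν0 : 0 ≤ ν) (hν : ν ≤ t ^ 2) (hσ : |σ| ≤ t ^ 2)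
    (hA : |A| ≤ t ^ 2) (hB : |B| ≤ t ^ 2) (hS : S = A - ν * a' - B) (hγ : γ = ν * (α * a + σ))
    (h : |(1 - β) * p - (a' + (1 + α + x) * ((1 - β) * a - S) + α * S + (1 - β) * σ - γ)| ≤ E) :
    |p - (a + a' + x * a + β * a' + α * a + σ + B - A)| ≤ 2 * E + 40 * L * t ^ 3 := by
  have ht1 : t ≤ 1 / 10000 := by nlinarith
  have h0 : t ^ 3 ≤ t ^ 2 := pow_le_pow_of_le_one ht0 (by linarith) (by norm_num)
  have ht2 : t ^ 2 ≤ 1 := pow_le_one₀ ht0 (by linarith)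
  set P := a + a' + x * a + β * a' + α * a + σ + B - A with hP
  have e : (1 - β) * (p - P) =
      ((1 - β) * p - (a' + (1 + α + x) * ((1 - β) * a - S) + α * S + (1 - β) * σ - γ)) +
      (β ^ 2 * a' + β * (B - A) + ν * a' - x * S - γ) := by
    rw [hP, hS]; ring
  have b1 : |β ^ 2 * a'| ≤ t ^ 2 * t := by
    rw [abs_mul, abs_of_nonneg (sq_nonneg β)]
    gcongr
  have b2 : |β * (B - A)| ≤ t * (2 * t ^ 2) := by
    rw [abs_mul, abs_of_nonneg hβ0]
    have := (abs_sub B A).trans (add_le_add hB hA)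
    gcongr
    linarith
  have b3 : |ν * a'| ≤ t ^ 2 * t := by
    rw [abs_mul, abs_of_nonneg hν0]
    gcongr
  have b3' : |ν * a'| ≤ t ^ 2 := by
    refine b3.trans ?_
    linarith
  have b4 : |S| ≤ 3 * t ^ 2 := by
    rw [hS, abs_le]
    rw [abs_le] at hA hB b3'
    constructor <;> linarith [hA.1, hA.2, hB.1, hB.2, b3'.1, b3'.2]
  have b5 : |x * S| ≤ 2 * L * t * (3 * t ^ 2) := by
    rw [abs_mul]
    exact mul_le_mul hx b4 (abs_nonneg _) (by positivity)
  have b6 : |α * a| ≤ t * t := by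
    rw [abs_mul]
    exact mul_le_mul hα ha (abs_nonneg _) ht0
  have b7 : |γ| ≤ t ^ 2 * t := by
    rw [hγ, abs_mul, abs_of_nonneg hν0]
    have : |α * a + σ| ≤ t := by
      refine (abs_add_le _ _).trans ?_
      nlinarith
    gcongr
  have b8 : |(1 - β) * (p - P)| ≤ E + 20 * L * t ^ 3 := by
    rw [e]
    refine (abs_add_le _ _).trans (add_le_add h ?_)
    have : 100 * t ^ 3 ≤ L * t ^ 3 := mul_le_mul_of_nonneg_right hL (by positivity)
    rw [abs_le] at b1 b2 b3 b5 b7 ⊢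
    constructor <;> linarith [b1.1, b1.2, b2.1, b2.2, b3.1, b3.2, b5.1, b5.2, b7.1, b7.2]
  rw [abs_mul, abs_of_nonneg (by linarith)] at b8
  have : 1 / 2 * |p - P| ≤ (1 - β) * |p - P| :=
    mul_le_mul_of_nonneg_right (by linarith) (abs_nonneg _)
  linarith

/-- The second order approximation of the probability of the pair `w`, `k`. -/
noncomputable def approxProb (X : Set (Sym2 (Fin n))) (G : SimpleGraph (Fin n)) (lam : ℝ)
    (w k : Fin n) : ℝ :=
  lam + (dev X G lam w + dev X G lam k +
    (1 - 2 * lam) / (lam * (1 - lam)) * dev X G lam k * dev X G lam w +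
    (1 + (fixedNbrs X k).card) / n * dev X G lam k + (fixedNbrs X w).card / n * dev X G lam w +
    (∑ z ∈ fixedNbrs X w, dev X G lam z) / n + (∑ z ∈ fixedNbrs X k, dev X G lam z) / n -
    (∑ z, dev X G lam z) / n)

set_option maxHeartbeats 2000000 in
lemma Fam.abs_prob_sub_approxProb_le (h : Fam L lam X G) (hB : Big n (4 * L)) (hL : 100 ≤ L)
    (hw : w ≠ k) (hX : s(w, k) ∉ X)
    (hfix : ∀ z ∈ freeNbrs X k, z ≠ w → fixedNbrs X z = ∅) :
    |prob X G w k - approxProb X G lam w k| ≤ L ^ 34 / √n ^ 3 := by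
  have hB1 : Big n L := hB.mono hL (by linarith)
  obtain ⟨hs0, hns, hn0, hn1⟩ := hB1.basic
  have hl0 := h.lam_pos hL
  have hl1 := h.lam_lt_one hL
  have hT := h.lam_mul_ge hL
  have hLp : L ^ 50 ≤ √(n : ℝ) := hB1.pow_le_sqrt (by norm_num)
  have hwk : w ∈ freeNbrs X k := by
    simp only [freeNbrs, Finset.mem_filter, Finset.mem_univ, true_and]
    rw [Sym2.eq_swap]; exact ⟨hw, hX⟩
  have hdiff := fun w' (h1 : w ≠ w') (h2 : k ∈ freeSet X w w') =>
    h.abs_prob_sub_sub_second hB hL h1 h2 (hfix w' (by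
      rw [mem_freeSet] at h2
      simp only [freeNbrs, Finset.mem_filter, Finset.mem_univ, true_and]
      rw [Sym2.eq_swap]; exact ⟨h2.2.1.symm, h2.2.2.2⟩) h1.symm)
  set a := dev X G lam with ha
  have hat : ∀ v, |a v| ≤ L ^ 10 / √n := by
    intro v
    refine (h.abs_dev_le hB1 v).trans (div_le_div_of_nonneg_right ?_ hs0.le)
    calc 2 * L ≤ L * L := by nlinarith
      _ = L ^ 2 := by ring
      _ ≤ L ^ 10 := pow_le_pow_right₀ (by linarith) (by norm_num)
  have hfw := h.abs_sum_fixedNbrs_dev_le hB1 w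
  have hfk := h.abs_sum_fixedNbrs_dev_le hB1 k
  have hA := h.abs_sum_dev_le hB1
  rw [← ha] at hfw hfk hA
  have hxw := h.fix_le w
  have hxk := h.fix_le k
  have hV1 := card_freeNbrs (X := X) k
  have hVh := h.card_freeNbrs_ge hB1 k
  have hSk := sum_eq_fixedNbrs_add (X := X) k a
  have hdk : deg G k - fixedDeg X G k = lam * (freeNbrs X k).card + n * a k := by
    rw [ha, dev]; field_simp; ring
  set t := L ^ 10 / √(n : ℝ) with ht
  have ht0 : 0 ≤ t := div_nonneg (pow_nonneg (by linarith) _) hs0.le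
  have hnt : n * t ^ 2 = L ^ 20 := by
    rw [ht, hns, Real.sqrt_sq hs0.le]; field_simp
  have hL2 : (10000 : ℝ) ≤ L ^ 2 := by nlinarith
  have h20 : 1000 * L ^ 2 ≤ L ^ 20 := by
    calc 1000 * L ^ 2 ≤ L ^ 2 * L ^ 2 := by nlinarith
      _ = L ^ 4 := by ring
      _ ≤ L ^ 20 := pow_le_pow_right₀ (by linarith) (by norm_num)
  have hLt : 100 * L * t ≤ 1 := by
    rw [ht, mul_div_assoc', div_le_one hs0]
    calc 100 * L * L ^ 10 ≤ L * L * L ^ 10 := by gcongr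
      _ = L ^ 12 := by ring
      _ ≤ L ^ 50 := pow_le_pow_right₀ (by linarith) (by norm_num)
      _ ≤ _ := hLp
  have hnt1 : 2 * (L * √(n : ℝ)) ≤ t * n := by
    have e : t * n = L ^ 10 * √n := by rw [ht]; nth_rw 2 [hns]; field_simp
    rw [e, ← mul_assoc]
    refine mul_le_mul_of_nonneg_right ?_ hs0.le
    calc 2 * L ≤ L * L := by nlinarith
      _ = L ^ 2 := by ring
      _ ≤ L ^ 10 := pow_le_pow_right₀ (by linarith) (by norm_num)
  have hLs : 1 ≤ L * √(n : ℝ) := by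
    have : 1 ≤ L ^ 50 := one_le_pow₀ (by linarith)
    nlinarith
  have hκ : |(1 - 2 * lam) / (lam * (1 - lam)) * a k| ≤ 2 * L * t := by
    have h2 : 0 < lam * (1 - lam) := mul_pos hl0 (by linarith)
    have h3 : |(1 - 2 * lam) / (lam * (1 - lam))| ≤ 2 * L := by
      rw [abs_div, abs_of_pos h2, div_le_iff₀ h2]
      have : |1 - 2 * lam| ≤ 1 := by rw [abs_le]; constructor <;> linarith
      linarith only [this, hT]
    rw [abs_mul]
    exact mul_le_mul h3 (hat k) (abs_nonneg _) (by linarith)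
  set V := ((freeNbrs X k).card : ℝ) with hVdef
  set y := ((fixedNbrs X k).card : ℝ) with hy
  set ℓ := ((fixedNbrs X w).card : ℝ) with hℓ
  have hy0 : 0 ≤ y := Nat.cast_nonneg _
  have hℓ0 : 0 ≤ ℓ := Nat.cast_nonneg _
  set σ := (∑ z ∈ fixedNbrs X w, a z) / n with hσ
  set x := (1 - 2 * lam) / (lam * (1 - lam)) * a k with hx
  set γ := ℓ / n * a w + σ with hγ
  set e := 2000 * L ^ 2 * t ^ 3 with he
  have he0 : 0 ≤ e := by rw [he]; exact mul_nonneg (by linarith only [hL2]) (pow_nonneg ht0 3)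
  have h1 := prob_of_differences (G := G) (fun w' => ((a w - a w') * (1 + ℓ / n + x) +
    ℓ / n * a w' + σ) - if w' = w then γ else 0) e hwk he0
    (fun w' h1 h2 => by
      simp only [h1.symm, if_false, sub_zero]
      exact hdiff w' h1 h2) (by simp [hγ])
  rw [Finset.sum_sub_distrib, Finset.sum_ite_eq' , if_pos hwk, Finset.sum_add_distrib,
    Finset.sum_add_distrib, ← Finset.sum_mul, Finset.sum_sub_distrib, ← Finset.mul_sum,
    Finset.sum_const, Finset.sum_const, nsmul_eq_mul, nsmul_eq_mul, ← hVdef, hdk] at h1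
  set Sf := ∑ z ∈ freeNbrs X k, a z with hSf
  have hbd : ∀ c : ℝ, |c| ≤ 2 * L ^ 2 → |c / n| ≤ t ^ 2 := by
    intro c hc
    rw [abs_div, abs_of_pos hn0, div_le_iff₀ hn0, mul_comm, hnt]
    linarith only [hc, h20, hL2]
  have hν : 1 / (n : ℝ) ≤ t ^ 2 := by
    rw [div_le_iff₀ hn0, mul_comm, hnt]
    exact one_le_pow₀ (by linarith only [hL])
  have hα : |ℓ / (n : ℝ)| ≤ t := by
    rw [abs_of_nonneg (div_nonneg hℓ0 hn0.le), div_le_iff₀ hn0]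
    linarith only [hnt1, hxw, hLs]
  have hβ : (1 + y) / (n : ℝ) ≤ t := by
    rw [div_le_iff₀ hn0]
    linarith only [hnt1, hxk, hLs]
  have hmain := mean_estimate (p := prob X G w k - lam) (E := e) hL ht0 hLt (hat w) (hat k) hκ hα
    (div_nonneg (by linarith only [hy0]) hn0.le) hβ (div_nonneg zero_le_one hn0.le) hν
    (hbd _ hfw) (hbd (∑ z, a z) (by linarith only [hA, hL2])) (hbd _ hfk) (S := Sf / n) (by
      have : Sf = ∑ z, a z - a k - ∑ z ∈ fixedNbrs X k, a z := by linarith only [hSk]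
      rw [this]; ring) rfl (by
      have e1 : (1 - (1 + y) / n) * (prob X G w k - lam) - (a k + (1 + ℓ / n + x) *
          ((1 - (1 + y) / n) * a w - Sf / n) + ℓ / n * (Sf / n) + (1 - (1 + y) / n) * σ -
          1 / n * (ℓ / n * a w + σ)) =
        (V * prob X G w k - (lam * V + n * a k) - ((V * a w - Sf) * (1 + ℓ / n + x) +
          ℓ / n * Sf + V * σ - γ)) / n := by
        rw [hV1, hγ]; field_simp; ring
      rw [← hσ, e1, abs_div, abs_of_pos hn0, div_le_iff₀ hn0]
      refine h1.trans ?_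
      rw [mul_comm]
      refine mul_le_mul_of_nonneg_left ?_ he0
      linarith only [hV1, hy0])
  have e2 : prob X G w k - approxProb X G lam w k = prob X G w k - lam - (a w + a k + x * a w +
      (1 + y) / n * a k + ℓ / n * a w + σ + (∑ z ∈ fixedNbrs X k, a z) / n - (∑ z, a z) / n) := by
    rw [approxProb, hx, hσ]; ring
  rw [e2]
  refine hmain.trans ?_
  have e3 : L ^ 34 / √(n : ℝ) ^ 3 = L ^ 4 * t ^ 3 := by rw [ht]; field_simp
  rw [e3, he]
  have e4 : 4000 * L ^ 2 + 40 * L ≤ L ^ 4 := by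
    have := mul_le_mul_of_nonneg_right hL2 (sq_nonneg L)
    nlinarith
  have := mul_le_mul_of_nonneg_right e4 (pow_nonneg ht0 3)
  linarith only [this]

end third

/-! ### Conditioning on a partially built clique -/

section clique
variable {n : ℕ} {G H : SimpleGraph (Fin n)} {L lam : ℝ} {K J : Finset (Fin n)}
  {w k : Fin n}

/-- The pairs inside `K` and the pairs between `w` and `J`. -/
def cliquePairs (K : Finset (Fin n)) (w : Fin n) (J : Finset (Fin n)) : Set (Sym2 (Fin n)) :=
  {e | (∃ u v, u ≠ v ∧ u ∈ K ∧ v ∈ K ∧ e = s(u, v)) ∨ ∃ j ∈ J, e = s(w, j)}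

lemma mem_cliquePairs {u v : Fin n} : s(u, v) ∈ cliquePairs K w J ↔
    (u ≠ v ∧ u ∈ K ∧ v ∈ K) ∨ (u = w ∧ v ∈ J) ∨ (v = w ∧ u ∈ J) := by
  simp only [cliquePairs, Set.mem_ofPred_eq, Sym2.eq_iff]
  constructor
  · rintro (⟨a, b, h1, h2, h3, ⟨rfl, rfl⟩ | ⟨rfl, rfl⟩⟩ | ⟨j, hj, ⟨rfl, rfl⟩ | ⟨rfl, rfl⟩⟩)
    · exact Or.inl ⟨h1, h2, h3⟩
    · exact Or.inl ⟨h1.symm, h3, h2⟩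
    · exact Or.inr (Or.inl ⟨rfl, hj⟩)
    · exact Or.inr (Or.inr ⟨rfl, hj⟩)
  · rintro (⟨h1, h2, h3⟩ | ⟨rfl, h⟩ | ⟨rfl, h⟩)
    · exact Or.inl ⟨u, v, h1, h2, h3, Or.inl ⟨rfl, rfl⟩⟩
    · exact Or.inr ⟨v, h, Or.inl ⟨rfl, rfl⟩⟩
    · exact Or.inr ⟨u, h, Or.inr ⟨rfl, rfl⟩⟩

/-- The graph `G` contains all edges inside `K` and from `w` to `J ⊆ K`. -/
structure Partial (K : Finset (Fin n)) (w : Fin n) (J : Finset (Fin n)) (G : SimpleGraph (Fin n)) :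
    Prop where
  notMem : w ∉ K
  subset : J ⊆ K
  clique : ∀ u ∈ K, ∀ v ∈ K, u ≠ v → G.Adj u v
  star : ∀ j ∈ J, G.Adj w j

lemma Partial.ind_eq_one (h : Partial K w J G) {u v : Fin n} (hm : s(u, v) ∈ cliquePairs K w J) :
    ind G u v = 1 := by
  rw [ind_eq_one_iff]
  rcases mem_cliquePairs.mp hm with ⟨h1, h2, h3⟩ | ⟨rfl, hJ⟩ | ⟨rfl, hJ⟩
  · exact h.clique u h2 v h3 h1
  · exact h.star v hJ
  · exact (h.star u hJ).symm

lemma Partial.fixedNbrs_self (h : Partial K w J G) : fixedNbrs (cliquePairs K w J) w = J := by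
  ext z
  simp only [fixedNbrs, Finset.mem_filter, Finset.mem_univ, true_and, mem_cliquePairs]
  constructor
  · rintro ⟨h1, ⟨-, h2, -⟩ | h2 | ⟨h2, -⟩⟩
    · exact absurd h2 h.notMem
    · exact h2
    · exact absurd h2 h1
  · intro hz
    refine ⟨?_, Or.inr (Or.inl hz)⟩
    rintro rfl
    exact h.notMem (h.subset hz)

lemma Partial.fixedNbrs_of_notMem (h : Partial K w J G) {v : Fin n} (hv : v ∉ K) (hvw : v ≠ w) :
    fixedNbrs (cliquePairs K w J) v = ∅ := by
  ext z
  simp only [fixedNbrs, Finset.mem_filter, Finset.mem_univ, true_and, mem_cliquePairs,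
    Finset.notMem_empty, iff_false]
  rintro ⟨h1, ⟨-, h2, -⟩ | ⟨h2, -⟩ | ⟨-, h2⟩⟩
  · exact hv h2
  · exact hvw h2
  · exact hv (h.subset h2)

lemma Partial.fixedNbrs_of_mem (h : Partial K w J G) {v : Fin n} (hv : v ∈ K) (hvJ : v ∉ J) :
    fixedNbrs (cliquePairs K w J) v = K.erase v := by
  ext z
  simp only [fixedNbrs, Finset.mem_filter, Finset.mem_univ, true_and, mem_cliquePairs,
    Finset.mem_erase]
  constructor
  · rintro ⟨h1, ⟨-, h2, h3⟩ | ⟨h2, -⟩ | ⟨-, h2⟩⟩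
    · exact ⟨h1, h3⟩
    · exact absurd (h2 ▸ hv) h.notMem
    · exact absurd h2 hvJ
  · rintro ⟨h1, h2⟩
    exact ⟨h1, Or.inl ⟨h1.symm, hv, h2⟩⟩

lemma Partial.fixedNbrs_of_mem_star (h : Partial K w J G) {v : Fin n} (hvJ : v ∈ J) :
    fixedNbrs (cliquePairs K w J) v = insert w (K.erase v) := by
  have hv := h.subset hvJ
  ext z
  simp only [fixedNbrs, Finset.mem_filter, Finset.mem_univ, true_and, mem_cliquePairs,
    Finset.mem_erase, Finset.mem_insert]
  constructor
  · rintro ⟨h1, ⟨-, h2, h3⟩ | ⟨h2, -⟩ | ⟨h2, -⟩⟩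
    · exact Or.inr ⟨h1, h3⟩
    · exact absurd (h2 ▸ hv) h.notMem
    · exact Or.inl h2
  · rintro (rfl | ⟨h1, h2⟩)
    · refine ⟨?_, Or.inr (Or.inr ⟨rfl, hvJ⟩)⟩
      rintro rfl
      exact h.notMem hv
    · exact ⟨h1, Or.inl ⟨h1.symm, hv, h2⟩⟩

lemma Partial.card_fixedNbrs (h : Partial K w J G) (v : Fin n) :
    ((fixedNbrs (cliquePairs K w J) v).card : ℝ) =
      (if v ∈ K then (K.card : ℝ) - 1 else 0) + (if v ∈ J then 1 else 0) +
        (if v = w then (J.card : ℝ) else 0) := by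
  by_cases hvw : v = w
  · subst hvw
    rw [h.fixedNbrs_self, if_neg h.notMem, if_neg fun hh => h.notMem (h.subset hh), if_pos rfl]
    ring
  by_cases hv : v ∈ K
  · have hc : 1 ≤ K.card := Finset.card_pos.mpr ⟨v, hv⟩
    by_cases hvJ : v ∈ J
    · rw [h.fixedNbrs_of_mem_star hvJ, Finset.card_insert_of_notMem fun hh =>
        h.notMem (Finset.mem_of_mem_erase hh), Finset.card_erase_of_mem hv, if_pos hv, if_pos hvJ,
        if_neg hvw]
      push_cast [hc]
      ring
    · rw [h.fixedNbrs_of_mem hv hvJ, Finset.card_erase_of_mem hv, if_pos hv, if_neg hvJ,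
        if_neg hvw]
      push_cast [hc]
      ring
  · rw [h.fixedNbrs_of_notMem hv hvw, if_neg hv, if_neg fun hh => hv (h.subset hh), if_neg hvw]
    simp

lemma Partial.dev_eq (h : Partial K w J G) (v : Fin n) :
    dev (cliquePairs K w J) G lam v = ((deg G v - lam * (n - 1)) -
      (1 - lam) * ((if v ∈ K then (K.card : ℝ) - 1 else 0) + (if v ∈ J then 1 else 0) +
        (if v = w then (J.card : ℝ) else 0))) / n := by
  have h1 : fixedDeg (cliquePairs K w J) G v = (fixedNbrs (cliquePairs K w J) v).card := by
    unfold fixedDeg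
    rw [Finset.sum_congr rfl fun z hz => h.ind_eq_one (v := z) (u := v) (by
      simp only [fixedNbrs, Finset.mem_filter] at hz
      exact hz.2.2)]
    simp
  rw [dev, h1, card_freeNbrs, h.card_fixedNbrs]
  congr 1
  ring

lemma Partial.card_le (h : Partial K w J G) : (J.card : ℝ) ≤ K.card :=
  Nat.cast_le.mpr (Finset.card_le_card h.subset)

lemma Partial.fam (h : Partial K w J G) (h1 : 1 ≤ L * lam) (h2 : 1 ≤ L * (1 - lam))
    (hdeg : ∀ v, |(deg G v : ℝ) - lam * ((n : ℝ) - 1)| ≤ L * √n)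
    (hsum : ∑ v, (deg G v : ℝ) = lam * ((n : ℝ) * (n - 1)))
    (hK : (K.card : ℝ) + 1 ≤ L * √n) : Fam L lam (cliquePairs K w J) G := by
  have hc := h.card_le
  have hJ0 : (0 : ℝ) ≤ J.card := Nat.cast_nonneg _
  refine ⟨h1, h2, hdeg, fun v => ?_, ?_, hsum⟩
  · rw [h.card_fixedNbrs]
    by_cases hvw : v = w
    · rw [if_neg (hvw ▸ h.notMem), if_neg fun hh => h.notMem (h.subset (hvw ▸ hh)), if_pos hvw]
      linarith
    · rw [if_neg hvw]
      split_ifs <;> linarith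
  · simp only [h.card_fixedNbrs, Finset.sum_add_distrib, Finset.sum_ite_mem, Finset.univ_inter,
      Finset.sum_const, nsmul_eq_mul, mul_one, Finset.sum_ite_eq', Finset.mem_univ, if_true]
    have e : L ^ 2 * n = (L * √n) ^ 2 := by
      rw [mul_pow, Real.sq_sqrt (Nat.cast_nonneg n)]
    rw [e]
    have : ((K.card : ℝ) + 1) ^ 2 ≤ (L * √n) ^ 2 := pow_le_pow_left₀ (by linarith) hK 2
    nlinarith

/-- The deterministic part of the logarithm of the edge probability, relative to the density. -/
noncomputable def regTerm (n : ℕ) (lam q l : ℝ) : ℝ :=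
  -((1 - lam) * (q - 1 + l) / (lam * n)) +
    ((1 - 2 * lam) / (lam * (1 - lam)) * (1 - lam) ^ 2 * (q - 1) * l - (1 - lam) * q * (q - 1) -
      (1 - lam) * l ^ 2 - (1 - lam) * q * l + (1 - lam) * (q - 1) + (1 - lam) * l) / (lam * n ^ 2) -
    (1 - lam) ^ 2 * (q - 1 + l) ^ 2 / (2 * lam ^ 2 * n ^ 2)

/-- The linear part in the degree deviations of the logarithm of the edge probability: `x` and `y`
are the deviations of the two vertices and `z` is a sum of other deviations. -/
noncomputable def linTerm (n : ℕ) (lam q l x y z : ℝ) : ℝ :=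
  (x + y) / (lam * n) +
    ((-((1 - 2 * lam) / (lam * (1 - lam))) * (1 - lam) * (l * x + (q - 1) * y) + q * x + l * y + z)
      / lam + (1 - lam) * (q - 1 + l) * (x + y) / lam ^ 2) / n ^ 2

/-- The quadratic part in the degree deviations of the logarithm of the edge probability. -/
noncomputable def quadTerm (n : ℕ) (lam x y : ℝ) : ℝ :=
  ((1 - 2 * lam) / (lam * (1 - lam)) * x * y / lam - (x + y) ^ 2 / (2 * lam ^ 2)) / n ^ 2

lemma Partial.approxProb_eq (h : Partial K w J G) (hk : k ∈ K) (hkJ : k ∉ J) (hn : (n : ℝ) ≠ 0)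
    (hl : lam ≠ 0)
    (hsum : ∑ v, (deg G v : ℝ) = lam * ((n : ℝ) * (n - 1))) :
    let a := dev (cliquePairs K w J) G lam
    let δ := fun v => (deg G v : ℝ) - lam * (n - 1)
    (approxProb (cliquePairs K w J) G lam w k - lam) / lam -
      (a k + a w) ^ 2 / (2 * lam ^ 2) =
    regTerm n lam K.card J.card +
      linTerm n lam K.card J.card (δ k) (δ w) (∑ j ∈ J, δ j + ∑ j ∈ K.erase k, δ j) +
      quadTerm n lam (δ k) (δ w) := by
  intro a δ
  have hkw : k ≠ w := fun hh => h.notMem (hh ▸ hk)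
  have hdev : ∀ v, a v = (δ v -
      (1 - lam) * ((if v ∈ K then (K.card : ℝ) - 1 else 0) + (if v ∈ J then 1 else 0) +
        (if v = w then (J.card : ℝ) else 0))) / n := h.dev_eq
  have hw1 : a w = (δ w - (1 - lam) * J.card) / n := by
    rw [hdev, if_neg h.notMem, if_neg fun hh => h.notMem (h.subset hh), if_pos rfl]; ring
  have hk1 : a k = (δ k - (1 - lam) * (K.card - 1)) / n := by
    rw [hdev, if_pos hk, if_neg hkJ, if_neg hkw]; ring
  have hδ : ∑ v, δ v = 0 := by
    simp only [δ, Finset.sum_sub_distrib, hsum, Finset.sum_const, Finset.card_univ,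
      Fintype.card_fin, nsmul_eq_mul]
    ring
  have hs1 : ∑ z, a z = -(1 - lam) * (K.card * (K.card - 1) + 2 * J.card) / n := by
    simp only [hdev]
    rw [← Finset.sum_div, Finset.sum_sub_distrib, hδ, ← Finset.mul_sum]
    simp only [Finset.sum_add_distrib, Finset.sum_ite_mem, Finset.univ_inter,
      Finset.sum_const, nsmul_eq_mul, mul_one, Finset.sum_ite_eq', Finset.mem_univ, if_true]
    ring
  have hs2 : ∑ z ∈ J, a z = (∑ z ∈ J, δ z - (1 - lam) * (K.card * J.card)) / n := by
    have : ∀ z ∈ J, a z = (δ z - (1 - lam) * K.card) / n := by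
      intro z hz
      have hzw : z ≠ w := fun hh => h.notMem (hh ▸ h.subset hz)
      rw [hdev, if_pos (h.subset hz), if_pos hz, if_neg hzw]
      ring
    rw [Finset.sum_congr rfl this, ← Finset.sum_div, Finset.sum_sub_distrib, Finset.sum_const,
      nsmul_eq_mul]
    ring
  have hs3 : ∑ z ∈ K.erase k, a z = (∑ z ∈ K.erase k, δ z -
      (1 - lam) * ((K.card - 1) ^ 2 + J.card)) / n := by
    have : ∀ z ∈ K.erase k, a z = (δ z - (1 - lam) * (K.card - 1 + if z ∈ J then 1 else 0)) / n := by
      intro z hz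
      have hz' := Finset.mem_of_mem_erase hz
      have hzw : z ≠ w := fun hh => h.notMem (hh ▸ hz')
      rw [hdev, if_pos hz', if_neg hzw]
      ring
    have hsub : K.erase k ∩ J = J := Finset.inter_eq_right.mpr fun z hz =>
      Finset.mem_erase.mpr ⟨fun hh => hkJ (hh ▸ hz), h.subset hz⟩
    have hc : 1 ≤ K.card := Finset.card_pos.mpr ⟨k, hk⟩
    rw [Finset.sum_congr rfl this, ← Finset.sum_div, Finset.sum_sub_distrib, ← Finset.mul_sum,
      Finset.sum_add_distrib, Finset.sum_ite_mem, hsub, Finset.sum_const, Finset.sum_const,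
      nsmul_eq_mul, nsmul_eq_mul, Finset.card_erase_of_mem hk]
    push_cast [hc]
    ring
  have hxk : ((fixedNbrs (cliquePairs K w J) k).card : ℝ) = K.card - 1 := by
    rw [h.card_fixedNbrs, if_pos hk, if_neg hkJ, if_neg hkw]; ring
  have hap : approxProb (cliquePairs K w J) G lam w k - lam =
      a w + a k + (1 - 2 * lam) / (lam * (1 - lam)) * a k * a w +
      (1 + ((K.card : ℝ) - 1)) / n * a k + J.card / n * a w +
      (∑ z ∈ J, a z) / n + (∑ z ∈ K.erase k, a z) / n - (∑ z, a z) / n := by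
    rw [approxProb, hxk, h.fixedNbrs_self, h.fixedNbrs_of_mem hk hkJ]
    ring
  rw [hap, hs1, hs2, hs3, hw1, hk1]
  unfold regTerm linTerm quadTerm
  generalize (1 - 2 * lam) / (lam * (1 - lam)) = κ
  generalize ∑ z ∈ J, δ z = A
  generalize ∑ z ∈ K.erase k, δ z = B
  generalize δ k = x
  generalize δ w = y
  generalize (K.card : ℝ) = q
  generalize (J.card : ℝ) = l
  field_simp
  ring

end clique

/-! ### The logarithm of the edge probability -/

lemma abs_log_one_add_le {v : ℝ} (hv : |v| ≤ 1 / 2) :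
    |Real.log (1 + v) - v + v ^ 2 / 2| ≤ 2 * |v| ^ 3 := by
  have h := Real.abs_log_sub_add_sum_range_le (x := -v) (by rw [abs_neg]; linarith) 2
  rw [abs_neg] at h
  simp only [Finset.sum_range_succ, Finset.sum_range_zero] at h
  have e : Real.log (1 + v) - v + v ^ 2 / 2 = 0 + (-v) ^ (0 + 1) / ((0 : ℕ) + 1) +
      (-v) ^ (1 + 1) / ((1 : ℕ) + 1) + Real.log (1 - -v) := by
    rw [sub_neg_eq_add]
    push_cast
    ring
  rw [e]
  refine h.trans ?_
  rw [div_le_iff₀ (by linarith)]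
  have h2 : 0 ≤ |v| ^ 3 * (1 / 2 - |v|) := mul_nonneg (by positivity) (by linarith)
  have h3 : |v| ^ (2 + 1) = |v| ^ 3 := rfl
  rw [h3]
  linarith

/-- Expansion of the logarithm of a number close to `lam`. -/
lemma abs_log_sub_le {L h lam p A u : ℝ} (hL : 100 ≤ L) (hl : 1 ≤ L * lam) (hl0 : 0 < lam)
    (hh : 0 ≤ h)
    (hs : L ^ 40 * h ≤ 1) (h1 : |p - lam| ≤ L ^ 4 * h) (h2 : |p - (lam + u)| ≤ L ^ 15 * h ^ 2)
    (h3 : |p - A| ≤ L ^ 34 * h ^ 3) (h4 : |u| ≤ 4 * L * h) :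
    0 < p ∧ |Real.log p - Real.log lam - ((A - lam) / lam - u ^ 2 / (2 * lam ^ 2))| ≤
      L ^ 37 * h ^ 3 := by
  have hL0 : 0 < L := by linarith
  have hlL : 1 / lam ≤ L := by rw [div_le_iff₀ hl0]; exact hl
  have hli : 0 ≤ 1 / lam := (div_pos one_pos hl0).le
  have key : ∀ {x y : ℝ}, |x| ≤ y → |x / lam| ≤ L * y := by
    intro x y hxy
    rw [div_eq_mul_one_div, abs_mul, abs_of_nonneg hli, mul_comm]
    exact mul_le_mul hlL hxy (abs_nonneg _) hL0.le
  set v := (p - lam) / lam with hv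
  have hv1 : |v| ≤ L ^ 5 * h := (key h1).trans (le_of_eq (by ring))
  have hv2 : |v - u / lam| ≤ L ^ 16 * h ^ 2 := by
    have : v - u / lam = (p - (lam + u)) / lam := by rw [hv]; ring
    rw [this]; exact (key h2).trans (le_of_eq (by ring))
  have hv3 : |v - (A - lam) / lam| ≤ L ^ 35 * h ^ 3 := by
    have : v - (A - lam) / lam = (p - A) / lam := by rw [hv]; ring
    rw [this]; exact (key h3).trans (le_of_eq (by ring))
  have hu : |u / lam| ≤ 4 * L ^ 2 * h := (key h4).trans (le_of_eq (by ring))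
  have hpow : ∀ k m : ℕ, k ≤ m → L ^ k ≤ L ^ m := fun k m hkm =>
    pow_le_pow_right₀ (by linarith) hkm
  have hLh : L ^ 5 * h ≤ 1 / 2 := by
    have e1 : L ^ 40 * h = L ^ 35 * (L ^ 5 * h) := by ring
    have e2 : (2 : ℝ) ≤ L ^ 35 := by
      have := hpow 1 35 (by norm_num); linarith
    have e3 : 0 ≤ L ^ 5 * h := mul_nonneg (by positivity) hh
    nlinarith
  have hvh : |v| ≤ 1 / 2 := hv1.trans hLh
  have hpv : p = lam * (1 + v) := by rw [hv]; field_simp; ring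
  have h1v : 0 < 1 + v := by linarith [(abs_le.mp hvh).1]
  refine ⟨hpv ▸ mul_pos hl0 h1v, ?_⟩
  have hlog : Real.log p - Real.log lam = Real.log (1 + v) := by
    rw [hpv, Real.log_mul hl0.ne' h1v.ne']; ring
  rw [hlog]
  have e := abs_log_one_add_le hvh
  have e1 : |v| ^ 3 ≤ L ^ 15 * h ^ 3 := by
    calc |v| ^ 3 ≤ (L ^ 5 * h) ^ 3 := pow_le_pow_left₀ (abs_nonneg _) hv1 3
      _ = _ := by ring
  have e2 : |v ^ 2 - (u / lam) ^ 2| ≤ L ^ 16 * h ^ 2 * (L ^ 5 * h + 4 * L ^ 2 * h) := by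
    rw [show v ^ 2 - (u / lam) ^ 2 = (v - u / lam) * (v + u / lam) by ring, abs_mul]
    exact mul_le_mul hv2 ((abs_add_le _ _).trans (add_le_add hv1 hu)) (abs_nonneg _)
      (mul_nonneg (by positivity) (by positivity))
  have e3 : Real.log (1 + v) - ((A - lam) / lam - u ^ 2 / (2 * lam ^ 2)) =
      (Real.log (1 + v) - v + v ^ 2 / 2) + (v - (A - lam) / lam) -
        (v ^ 2 - (u / lam) ^ 2) / 2 := by
    rw [div_pow]; field_simp; ring
  rw [e3]
  have e4 : |(v ^ 2 - (u / lam) ^ 2) / 2| ≤ L ^ 16 * h ^ 2 * (L ^ 5 * h + 4 * L ^ 2 * h) / 2 := by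
    rw [abs_div, abs_two]; linarith
  have h30 : 0 ≤ h ^ 3 := by positivity
  have f1 : |Real.log (1 + v) - v + v ^ 2 / 2 + (v - (A - lam) / lam) -
      (v ^ 2 - (u / lam) ^ 2) / 2| ≤
      2 * (L ^ 15 * h ^ 3) + L ^ 35 * h ^ 3 +
        L ^ 16 * h ^ 2 * (L ^ 5 * h + 4 * L ^ 2 * h) / 2 := by
    refine (abs_sub _ _).trans (add_le_add ((abs_add_le _ _).trans (add_le_add ?_ hv3)) e4)
    linarith
  refine f1.trans ?_
  have f2 : 2 * L ^ 15 + L ^ 35 + L ^ 16 * (L ^ 5 + 4 * L ^ 2) / 2 ≤ L ^ 37 := by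
    have g1 := hpow 15 35 (by norm_num)
    have g2 := hpow 21 35 (by norm_num)
    have g3 := hpow 18 35 (by norm_num)
    have g4 : L ^ 37 = L ^ 2 * L ^ 35 := by ring
    have g5 : (100 : ℝ) ≤ L ^ 2 := by nlinarith
    have g6 : 0 ≤ L ^ 35 := by positivity
    nlinarith
  calc _ = (2 * L ^ 15 + L ^ 35 + L ^ 16 * (L ^ 5 + 4 * L ^ 2) / 2) * h ^ 3 := by ring
    _ ≤ _ := mul_le_mul_of_nonneg_right f2 h30

lemma abs_quadTerm_le {n : ℕ} {L lam x y D : ℝ} (hL : 100 ≤ L) (hl : 1 ≤ L * lam) (hl0 : 0 < lam)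
    (hl1 : lam < 1) (hl' : 1 ≤ L * (1 - lam)) (hx : |x| ≤ D) (hy : |y| ≤ D) :
    |quadTerm n lam x y| ≤ 3 * L ^ 3 * D ^ 2 / n ^ 2 := by
  have hL0 : 0 < L := by linarith
  have hD : 0 ≤ D := (abs_nonneg _).trans hx
  have hlL : 1 / lam ≤ L := by rw [div_le_iff₀ hl0]; exact hl
  have hlL' : 1 / (1 - lam) ≤ L := by rw [div_le_iff₀ (by linarith)]; exact hl'
  have hli : 0 ≤ 1 / lam := (div_pos one_pos hl0).le
  have hli' : 0 ≤ 1 / (1 - lam) := (div_pos one_pos (by linarith)).le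
  rw [quadTerm, abs_div, abs_of_nonneg (by positivity : (0 : ℝ) ≤ (n : ℝ) ^ 2)]
  refine div_le_div_of_nonneg_right ?_ (by positivity)
  have e1 : (1 - 2 * lam) / (lam * (1 - lam)) * x * y / lam =
      (1 - 2 * lam) * ((1 / lam) * (1 / (1 - lam)) * (1 / lam)) * (x * y) := by
    have : (1 - lam) ≠ 0 := by linarith
    field_simp
  have e2 : (x + y) ^ 2 / (2 * lam ^ 2) = (1 / lam * (1 / lam)) * (x + y) ^ 2 / 2 := by
    field_simp
  have a1 : |1 - 2 * lam| ≤ 1 := abs_le.mpr ⟨by linarith, by linarith⟩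
  have a2 : 1 / lam * (1 / lam) ≤ L * L := mul_le_mul hlL hlL hli hL0.le
  have a3 : 1 / lam * (1 / (1 - lam)) * (1 / lam) ≤ L * L * L :=
    mul_le_mul (mul_le_mul hlL hlL' hli' hL0.le) hlL hli (by positivity)
  have a4 : |x * y| ≤ D * D := by rw [abs_mul]; exact mul_le_mul hx hy (abs_nonneg _) hD
  have a5 : (x + y) ^ 2 ≤ (2 * D) ^ 2 := by
    rw [← sq_abs]
    exact pow_le_pow_left₀ (abs_nonneg _) ((abs_add_le _ _).trans (by linarith)) 2
  have b1 : |(1 - 2 * lam) * ((1 / lam) * (1 / (1 - lam)) * (1 / lam)) * (x * y)| ≤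
      1 * (L * L * L) * (D * D) := by
    rw [abs_mul, abs_mul, abs_of_nonneg (mul_nonneg (mul_nonneg hli hli') hli)]
    exact mul_le_mul (mul_le_mul a1 a3 (mul_nonneg (mul_nonneg hli hli') hli) zero_le_one) a4
      (abs_nonneg _) (by positivity)
  have b2 : |(1 / lam * (1 / lam)) * (x + y) ^ 2 / 2| ≤ (L * L) * (2 * D) ^ 2 / 2 := by
    rw [abs_of_nonneg (by positivity)]
    exact div_le_div_of_nonneg_right (mul_le_mul a2 a5 (sq_nonneg _) (by positivity)) two_pos.le
  rw [e1, e2]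
  refine (abs_sub _ _).trans ((add_le_add b1 b2).trans ?_)
  have : 0 ≤ L ^ 2 * D ^ 2 := by positivity
  nlinarith

section clique
variable {n : ℕ} {G H : SimpleGraph (Fin n)} {L lam D : ℝ} {K J : Finset (Fin n)}
  {w k : Fin n}

lemma Partial.abs_log_prob_le (h : Partial K w J G) (hF : Fam L lam (cliquePairs K w J) G)
    (hB : Big n (4 * L)) (hL : 100 ≤ L) (hk : k ∈ K) (hkJ : k ∉ J)
    (hD : ∀ v, |(deg G v : ℝ) - lam * (n - 1)| ≤ D) :
    0 < prob (cliquePairs K w J) G w k ∧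
    |Real.log (prob (cliquePairs K w J) G w k) - Real.log lam -
      (regTerm n lam K.card J.card + linTerm n lam K.card J.card ((deg G k : ℝ) - lam * (n - 1))
        ((deg G w : ℝ) - lam * (n - 1)) (∑ j ∈ J, ((deg G j : ℝ) - lam * (n - 1)) +
          ∑ j ∈ K.erase k, ((deg G j : ℝ) - lam * (n - 1))))| ≤
      L ^ 37 / √n ^ 3 + 3 * L ^ 3 * D ^ 2 / n ^ 2 := by
  have hB1 : Big n L := hB.mono hL (by linarith)
  have hB2 : Big n (2 * L) := hB.mono (by linarith) (by linarith)
  obtain ⟨hs0, hns, hn0, hn1⟩ := hB1.basic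
  have hl0 := hF.lam_pos hL
  have hl1 := hF.lam_lt_one hL
  have hkw : w ≠ k := fun hh => h.notMem (hh ▸ hk)
  have hX : s(w, k) ∉ cliquePairs K w J := by
    rw [mem_cliquePairs]
    rintro (⟨-, h2, -⟩ | ⟨-, h2⟩ | ⟨h2, -⟩)
    · exact h.notMem h2
    · exact hkJ h2
    · exact hkw h2.symm
  have hfix : ∀ z ∈ freeNbrs (cliquePairs K w J) k, z ≠ w →
      fixedNbrs (cliquePairs K w J) z = ∅ := by
    intro z hz hzw
    refine h.fixedNbrs_of_notMem (fun hzK => ?_) hzw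
    simp only [freeNbrs, Finset.mem_filter, Finset.mem_univ, true_and, mem_cliquePairs] at hz
    exact hz.2 (Or.inl ⟨hz.1.symm, hk, hzK⟩)
  have c1 := hF.abs_prob_sub_lam_le hB1 hkw hX
  have c2 := hF.abs_prob_sub_le hB2 hL hkw hX
  have c3 := hF.abs_prob_sub_approxProb_le hB hL hkw hX hfix
  have c4 := hF.abs_dev_le hB1 k
  have c5 := hF.abs_dev_le hB1 w
  have c6 := h.approxProb_eq hk hkJ hn0.ne' hl0.ne' hF.deg_sum
  have c7 := abs_quadTerm_le (n := n) hL hF.lam_lo hl0 hl1 hF.lam_hi (hD k) (hD w)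
  simp only at c6
  have hs : L ^ 40 * (1 / √(n : ℝ)) ≤ 1 := by
    rw [mul_one_div, div_le_one hs0]
    exact hB1.pow_le_sqrt (by norm_num)
  obtain ⟨d1, d2⟩ := abs_log_sub_le (h := 1 / √(n : ℝ)) (p := prob (cliquePairs K w J) G w k)
    (A := approxProb (cliquePairs K w J) G lam w k)
    (u := dev (cliquePairs K w J) G lam k + dev (cliquePairs K w J) G lam w) hL hF.lam_lo hl0
    (div_nonneg zero_le_one hs0.le) hs (by rwa [mul_one_div])
    (by rw [div_pow, one_pow, mul_one_div]
        rwa [show lam + (dev (cliquePairs K w J) G lam k + dev (cliquePairs K w J) G lam w) =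
          lam + dev (cliquePairs K w J) G lam w + dev (cliquePairs K w J) G lam k by ring])
    (by rwa [div_pow, one_pow, mul_one_div])
    (by rw [mul_one_div]
        refine (abs_add_le _ _).trans ((add_le_add c4 c5).trans (le_of_eq (by ring))))
  refine ⟨d1, ?_⟩
  rw [c6, div_pow, one_pow, mul_one_div] at d2
  have := abs_add_le (Real.log (prob (cliquePairs K w J) G w k) - Real.log lam -
    (regTerm n lam K.card J.card + linTerm n lam K.card J.card ((deg G k : ℝ) - lam * (n - 1))
        ((deg G w : ℝ) - lam * (n - 1)) (∑ j ∈ J, ((deg G j : ℝ) - lam * (n - 1)) +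
          ∑ j ∈ K.erase k, ((deg G j : ℝ) - lam * (n - 1))) + quadTerm n lam
            ((deg G k : ℝ) - lam * (n - 1)) ((deg G w : ℝ) - lam * (n - 1))))
     (quadTerm n lam ((deg G k : ℝ) - lam * (n - 1)) ((deg G w : ℝ) - lam * (n - 1)))
  refine le_trans (le_of_eq ?_) (this.trans (add_le_add d2 c7))
  congr 1
  ring

end clique

/-! ### The number of graphs containing a given clique -/

/-- The degree sequence `d` has density `lam` and deviations at most `D`, all parameters being
controlled by `L`. -/
structure NearRegular {n : ℕ} (L lam D : ℝ) (d : Fin n → ℕ) : Prop where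
  big : Big n (4 * L)
  L_ge : 100 ≤ L
  lam_lo : 1 ≤ L * lam
  lam_hi : 1 ≤ L * (1 - lam)
  deg_near : ∀ v, |(d v : ℝ) - lam * ((n : ℝ) - 1)| ≤ L * √n
  dev_le : ∀ v, |(d v : ℝ) - lam * ((n : ℝ) - 1)| ≤ D
  deg_sum : ∑ v, (d v : ℝ) = lam * ((n : ℝ) * (n - 1))

section partialCliques
variable {n : ℕ} {d : Fin n → ℕ} {v : ℕ → Fin n} {q l r : ℕ} {L lam D : ℝ}
  {G H : SimpleGraph (Fin n)}

/-- The graphs with degree sequence `d` in which `v 0, …, v (q - 1)` are pairwise adjacent and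
`v q` is adjacent to `v 0, …, v (l - 1)`. -/
noncomputable def partialCliques (d : Fin n → ℕ) (v : ℕ → Fin n) (q l : ℕ) :
    Finset (SimpleGraph (Fin n)) :=
  (degFinset n d).filter fun G => (∀ i < q, ∀ j < q, i ≠ j → G.Adj (v i) (v j)) ∧
    ∀ i < l, G.Adj (v q) (v i)

lemma mem_partialCliques : G ∈ partialCliques d v q l ↔ (∀ j, deg G j = d j) ∧
    (∀ i < q, ∀ j < q, i ≠ j → G.Adj (v i) (v j)) ∧ ∀ i < l, G.Adj (v q) (v i) := by
  simp [partialCliques, degFinset]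

lemma partialCliques_zero_zero : partialCliques d v 0 0 = degFinset n d := by
  simp [partialCliques]

lemma partialCliques_succ_zero : partialCliques d v (q + 1) 0 = partialCliques d v q q := by
  ext G
  simp only [mem_partialCliques]
  constructor
  · rintro ⟨h1, h2, -⟩
    exact ⟨h1, fun i hi j hj => h2 i (by omega) j (by omega),
      fun i hi => h2 q (by omega) i (by omega) (by omega)⟩
  · rintro ⟨h1, h2, h3⟩
    refine ⟨h1, fun i hi j hj hij => ?_, fun i hi => absurd hi (by omega)⟩
    rcases Nat.lt_succ_iff_lt_or_eq.mp hi with hi' | rfl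
    · rcases Nat.lt_succ_iff_lt_or_eq.mp hj with hj' | rfl
      · exact h2 i hi' j hj' hij
      · exact (h3 i hi').symm
    · exact h3 j (by omega)

lemma partial_of_mem (hv : Set.InjOn v (Set.Iio r)) (hq : q < r) (hl : l ≤ q)
    (hG : G ∈ partialCliques d v q l) :
    Partial ((Finset.range q).image v) (v q) ((Finset.range l).image v) G := by
  rw [mem_partialCliques] at hG
  refine ⟨?_, Finset.image_subset_image (Finset.range_mono hl), ?_, ?_⟩
  · simp only [Finset.mem_image, Finset.mem_range, not_exists, not_and]
    intro i hi h
    have := hv (show i ∈ Set.Iio r from lt_trans hi hq) (show q ∈ Set.Iio r from hq) h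
    omega
  · simp only [Finset.mem_image, Finset.mem_range]
    rintro _ ⟨i, hi, rfl⟩ _ ⟨j, hj, rfl⟩ hij
    exact hG.2.1 i hi j hj fun h => hij (h ▸ rfl)
  · simp only [Finset.mem_image, Finset.mem_range]
    rintro _ ⟨i, hi, rfl⟩
    exact hG.2.2 i hi

lemma partialCliques_eq_cls (hv : Set.InjOn v (Set.Iio r)) (hq : q < r) (hl : l ≤ q)
    (hG : G ∈ partialCliques d v q l) :
    partialCliques d v q l =
      cls (cliquePairs ((Finset.range q).image v) (v q) ((Finset.range l).image v)) G := by
  have hP := partial_of_mem hv hq hl hG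
  ext H
  rw [mem_cls]
  constructor
  · intro hH
    have hP' := partial_of_mem hv hq hl hH
    rw [mem_partialCliques] at hG hH
    exact ⟨fun u => by rw [hG.1, hH.1],
      fun u z hz => by rw [hP.ind_eq_one hz, hP'.ind_eq_one hz]⟩
  · rintro ⟨h1, h2⟩
    rw [mem_partialCliques] at hG ⊢
    have key : ∀ u z, s(u, z) ∈ cliquePairs ((Finset.range q).image v) (v q)
        ((Finset.range l).image v) → H.Adj u z := by
      intro u z hz
      rw [← ind_eq_one_iff, h2 u z hz, hP.ind_eq_one hz]
    refine ⟨fun j => (h1 j).trans (hG.1 j), fun i hi j hj hij => key _ _ ?_,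
      fun i hi => key _ _ ?_⟩
    · rw [mem_cliquePairs]
      refine Or.inl ⟨fun hh => hij (hv (lt_trans hi hq) (lt_trans hj hq) hh), ?_, ?_⟩
      · exact Finset.mem_image_of_mem v (Finset.mem_range.mpr hi)
      · exact Finset.mem_image_of_mem v (Finset.mem_range.mpr hj)
    · rw [mem_cliquePairs]
      exact Or.inr (Or.inl ⟨rfl, Finset.mem_image_of_mem v (Finset.mem_range.mpr hi)⟩)

lemma card_partialCliques_succ (hv : Set.InjOn v (Set.Iio r)) (hq : q < r) (hl : l ≤ q)
    (hG : G ∈ partialCliques d v q l) :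
    ((partialCliques d v q (l + 1)).card : ℝ) = prob (cliquePairs ((Finset.range q).image v) (v q)
      ((Finset.range l).image v)) G (v q) (v l) * (partialCliques d v q l).card := by
  have h1 : partialCliques d v q (l + 1) =
      (partialCliques d v q l).filter fun H => H.Adj (v q) (v l) := by
    ext H
    simp only [mem_partialCliques, Finset.mem_filter, Nat.lt_succ_iff_lt_or_eq]
    constructor
    · rintro ⟨a, b, c⟩
      exact ⟨⟨a, b, fun i hi => c i (Or.inl hi)⟩, c l (Or.inr rfl)⟩
    · rintro ⟨⟨a, b, c⟩, e⟩
      refine ⟨a, b, ?_⟩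
      rintro i (hi | rfl)
      · exact c i hi
      · exact e
  have h2 : (0 : ℝ) < (partialCliques d v q l).card :=
    Nat.cast_pos.mpr (Finset.card_pos.mpr ⟨G, hG⟩)
  rw [prob, av, ← partialCliques_eq_cls hv hq hl hG, div_mul_cancel₀ _ h2.ne', h1,
    Finset.card_filter]
  push_cast
  rfl

/-- The main term of the logarithm of the probability that the pair `v q`, `v l` is adjacent. -/
noncomputable def logTerm (n : ℕ) (lam : ℝ) (x : ℕ → ℝ) (q l : ℕ) : ℝ :=
  Real.log lam + (regTerm n lam q l + linTerm n lam q l (x l) (x q)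
    (∑ i ∈ Finset.range l, x i + (∑ i ∈ Finset.range q, x i - x l)))

lemma NearRegular.card_partialCliques_succ (h : NearRegular L lam D d)
    (hv : Set.InjOn v (Set.Iio r)) (hr : (r : ℝ) ≤ L * √n) (hq : q < r) (hl : l < q)
    (hne : (partialCliques d v q l).Nonempty) :
    (partialCliques d v q (l + 1)).Nonempty ∧
    |Real.log (partialCliques d v q (l + 1)).card - Real.log (partialCliques d v q l).card -
      logTerm n lam (fun i => (d (v i) : ℝ) - lam * (n - 1)) q l| ≤
      L ^ 37 / √n ^ 3 + 3 * L ^ 3 * D ^ 2 / n ^ 2 := by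
  obtain ⟨G, hG⟩ := hne
  have hP := partial_of_mem hv hq hl.le hG
  have hdeg : ∀ u, deg G u = d u := (mem_partialCliques.mp hG).1
  have hcard : ∀ m, m ≤ r → ((Finset.range m).image v).card = m := by
    intro m hm
    rw [Finset.card_image_of_injOn, Finset.card_range]
    intro i hi j hj
    exact hv (lt_of_lt_of_le (Finset.mem_range.mp hi) hm)
      (lt_of_lt_of_le (Finset.mem_range.mp hj) hm)
  have hsum : ∀ m, m ≤ r → ∀ f : Fin n → ℝ, ∑ u ∈ (Finset.range m).image v, f u =
      ∑ i ∈ Finset.range m, f (v i) := by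
    intro m hm f
    rw [Finset.sum_image]
    intro i hi j hj
    exact hv (lt_of_lt_of_le (Finset.mem_range.mp hi) hm)
      (lt_of_lt_of_le (Finset.mem_range.mp hj) hm)
  have hF := hP.fam (L := L) h.lam_lo h.lam_hi (fun u => by rw [hdeg]; exact h.deg_near u)
    (by simp only [hdeg]; exact h.deg_sum) (by
      rw [hcard q hq.le]
      refine le_trans ?_ hr
      exact_mod_cast hq)
  have hk : v l ∈ (Finset.range q).image v :=
    Finset.mem_image_of_mem v (Finset.mem_range.mpr hl)
  have hkJ : v l ∉ (Finset.range l).image v := by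
    simp only [Finset.mem_image, Finset.mem_range, not_exists, not_and]
    intro i hi hh
    have := hv (show i ∈ Set.Iio r from by simp; omega) (show l ∈ Set.Iio r from by simp; omega) hh
    omega
  obtain ⟨h1, h2⟩ := hP.abs_log_prob_le hF h.big h.L_ge hk hkJ (D := D)
    (fun u => by rw [hdeg]; exact h.dev_le u)
  have h0 : (0 : ℝ) < (partialCliques d v q l).card :=
    Nat.cast_pos.mpr (Finset.card_pos.mpr ⟨G, hG⟩)
  have h3 := Stmt19.card_partialCliques_succ hv hq hl.le hG
  have h4 : (0 : ℝ) < (partialCliques d v q (l + 1)).card := by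
    rw [h3]; exact mul_pos h1 h0
  refine ⟨Finset.card_pos.mp (Nat.cast_pos.mp h4), ?_⟩
  rw [h3, Real.log_mul h1.ne' h0.ne']
  refine le_trans (le_of_eq ?_) h2
  simp only [hdeg]
  rw [Finset.sum_erase_eq_sub hk, hsum q hq.le, hsum l (by omega), hcard q hq.le,
    hcard l (by omega), logTerm]
  congr 1
  ring

lemma NearRegular.card_partialCliques_row (h : NearRegular L lam D d)
    (hv : Set.InjOn v (Set.Iio r)) (hr : (r : ℝ) ≤ L * √n) (hq : q < r)
    (hne : (partialCliques d v q 0).Nonempty) (hl : l ≤ q) :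
    (partialCliques d v q l).Nonempty ∧
    |Real.log (partialCliques d v q l).card - Real.log (partialCliques d v q 0).card -
      ∑ i ∈ Finset.range l, logTerm n lam (fun i => (d (v i) : ℝ) - lam * (n - 1)) q i| ≤
      l * (L ^ 37 / √n ^ 3 + 3 * L ^ 3 * D ^ 2 / n ^ 2) := by
  induction l with
  | zero => exact ⟨hne, by simp⟩
  | succ l ih =>
    obtain ⟨h1, h2⟩ := ih (by omega)
    obtain ⟨h3, h4⟩ := h.card_partialCliques_succ hv hr hq (by omega : l < q) h1
    refine ⟨h3, ?_⟩
    rw [Finset.sum_range_succ]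
    have := abs_add_le _ _ |>.trans (add_le_add h2 h4)
    refine le_trans (le_of_eq ?_) (this.trans (le_of_eq ?_))
    · congr 1; ring
    · push_cast; ring

lemma NearRegular.card_partialCliques (h : NearRegular L lam D d)
    (hv : Set.InjOn v (Set.Iio r)) (hr : (r : ℝ) ≤ L * √n) (hq : q ≤ r)
    (hne : (degFinset n d).Nonempty) :
    (partialCliques d v q 0).Nonempty ∧
    |Real.log (partialCliques d v q 0).card - Real.log (degFinset n d).card -
      ∑ j ∈ Finset.range q, ∑ i ∈ Finset.range j,
        logTerm n lam (fun i => (d (v i) : ℝ) - lam * (n - 1)) j i| ≤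
      q * (r * (L ^ 37 / √n ^ 3 + 3 * L ^ 3 * D ^ 2 / n ^ 2)) := by
  induction q with
  | zero => rw [partialCliques_zero_zero]; exact ⟨hne, by simp⟩
  | succ q ih =>
    obtain ⟨h1, h2⟩ := ih (by omega)
    obtain ⟨h3, h4⟩ := h.card_partialCliques_row hv hr (by omega : q < r) h1 le_rfl
    rw [partialCliques_succ_zero]
    refine ⟨h3, ?_⟩
    have hL := h.L_ge
    have h5 : (q : ℝ) * (L ^ 37 / √n ^ 3 + 3 * L ^ 3 * D ^ 2 / n ^ 2) ≤
        r * (L ^ 37 / √n ^ 3 + 3 * L ^ 3 * D ^ 2 / n ^ 2) :=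
      mul_le_mul_of_nonneg_right (Nat.cast_le.mpr (by omega)) (by positivity)
    rw [Finset.sum_range_succ]
    have := abs_add_le _ _ |>.trans (add_le_add h2 (h4.trans h5))
    refine le_trans (le_of_eq ?_) (this.trans (le_of_eq ?_))
    · congr 1; ring
    · push_cast; ring

end partialCliques

/-! ### Averaging over the orderings of a clique -/

lemma abs_sub_average_le {r : ℕ} (hr : 0 < r) {A e : ℝ} {f : ℕ → ℝ}
    (h : ∀ s ∈ Finset.range r, |A - f s| ≤ e) :
    |A - (∑ s ∈ Finset.range r, f s) / r| ≤ e := by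
  have hr' : (0 : ℝ) < r := Nat.cast_pos.mpr hr
  have e1 : A - (∑ s ∈ Finset.range r, f s) / r = (∑ s ∈ Finset.range r, (A - f s)) / r := by
    rw [Finset.sum_sub_distrib, Finset.sum_const, Finset.card_range, nsmul_eq_mul]
    field_simp
  rw [e1, abs_div, abs_of_pos hr', div_le_iff₀ hr']
  refine (Finset.abs_sum_le_sum_abs _ _).trans ((Finset.sum_le_sum h).trans (le_of_eq ?_))
  rw [Finset.sum_const, Finset.card_range, nsmul_eq_mul, mul_comm]

lemma image_add_mod {r : ℕ} (i : ℕ) :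
    (Finset.range r).image (fun s => (i + s) % r) = Finset.range r := by
  rcases Nat.eq_zero_or_pos r with rfl | hr
  · simp
  apply Finset.eq_of_subset_of_card_le
  · intro z
    simp only [Finset.mem_image, Finset.mem_range]
    rintro ⟨s, -, rfl⟩
    exact Nat.mod_lt _ hr
  · rw [Finset.card_image_of_injOn]
    intro s hs t ht hst
    have h1 : s % r = t % r := Nat.ModEq.add_left_cancel' i hst
    rwa [Nat.mod_eq_of_lt (Finset.mem_range.mp hs), Nat.mod_eq_of_lt (Finset.mem_range.mp ht)]
      at h1

lemma injOn_add_mod {r : ℕ} (i : ℕ) : Set.InjOn (fun s => (i + s) % r) (Set.Iio r) := by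
  intro s hs t ht hst
  have h1 : s % r = t % r := Nat.ModEq.add_left_cancel' i hst
  rwa [Nat.mod_eq_of_lt hs, Nat.mod_eq_of_lt ht] at h1

lemma sum_add_mod {r : ℕ} (i : ℕ) (x : ℕ → ℝ) :
    ∑ s ∈ Finset.range r, x ((i + s) % r) = ∑ s ∈ Finset.range r, x s := by
  conv_rhs => rw [← image_add_mod i]
  rw [Finset.sum_image]
  intro s hs t ht hst
  exact injOn_add_mod i (Finset.mem_range.mp hs) (Finset.mem_range.mp ht) hst

lemma sum_linTerm (n : ℕ) (lam q l : ℝ) {ι : Type*} (s : Finset ι) (x y z : ι → ℝ) :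
    ∑ i ∈ s, linTerm n lam q l (x i) (y i) (z i) =
      linTerm n lam q l (∑ i ∈ s, x i) (∑ i ∈ s, y i) (∑ i ∈ s, z i) := by
  induction s using Finset.induction_on with
  | empty => simp [linTerm]
  | insert a s ha ih =>
    rw [Finset.sum_insert ha, Finset.sum_insert ha, Finset.sum_insert ha, Finset.sum_insert ha, ih]
    unfold linTerm
    ring

lemma linTerm_mul (n : ℕ) (lam q l c x y z : ℝ) :
    linTerm n lam q l (c * x) (c * y) (c * z) = c * linTerm n lam q l x y z := by
  unfold linTerm
  ring

/-- The average of `logTerm` over cyclic shifts. -/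
lemma sum_logTerm_shift (n : ℕ) (lam : ℝ) (x : ℕ → ℝ) (q l r : ℕ) :
    ∑ s ∈ Finset.range r, logTerm n lam (fun i => x ((i + s) % r)) q l =
      r * (Real.log lam + regTerm n lam q l) + (∑ i ∈ Finset.range r, x i) *
        linTerm n lam q l 1 1 (l + (q - 1)) := by
  have h2 : ∀ m, ∑ s ∈ Finset.range r, ∑ i ∈ Finset.range m, x ((i + s) % r) =
      m * ∑ i ∈ Finset.range r, x i := by
    intro m
    rw [Finset.sum_comm]
    simp only [sum_add_mod]
    rw [Finset.sum_const, Finset.card_range, nsmul_eq_mul]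
  unfold logTerm
  rw [Finset.sum_add_distrib, Finset.sum_add_distrib, sum_linTerm, Finset.sum_add_distrib,
    Finset.sum_sub_distrib, h2, h2, sum_add_mod, sum_add_mod, Finset.sum_const, Finset.sum_const,
    Finset.card_range, nsmul_eq_mul, nsmul_eq_mul, ← linTerm_mul]
  rw [mul_add, mul_one, add_assoc]
  congr 3
  ring

/-- The graphs with degree sequence `d` in which `S` is a clique. -/
noncomputable def cliquesOn {n : ℕ} (d : Fin n → ℕ) (S : Finset (Fin n)) :
    Finset (SimpleGraph (Fin n)) :=
  (degFinset n d).filter fun G => ∀ j ∈ S, ∀ k ∈ S, j ≠ k → G.Adj j k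

section
variable {n : ℕ} {d : Fin n → ℕ} {v : ℕ → Fin n} {r : ℕ} {L lam D : ℝ} {S : Finset (Fin n)}

lemma cliquesOn_eq (hv : Set.InjOn v (Set.Iio r)) (hS : (Finset.range r).image v = S) :
    cliquesOn d S = partialCliques d v r 0 := by
  subst hS
  ext G
  simp only [cliquesOn, partialCliques, Finset.mem_filter, Finset.mem_image, Finset.mem_range]
  constructor
  · rintro ⟨h1, h2⟩
    exact ⟨h1, fun i hi j hj hij => h2 _ ⟨i, hi, rfl⟩ _ ⟨j, hj, rfl⟩
      fun hh => hij (hv hi hj hh), fun i hi => absurd hi (by omega)⟩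
  · rintro ⟨h1, h2, -⟩
    refine ⟨h1, ?_⟩
    rintro _ ⟨i, hi, rfl⟩ _ ⟨j, hj, rfl⟩ hij
    exact h2 i hi j hj fun hh => hij (hh ▸ rfl)

lemma exists_enumeration (hr : 0 < r) (hS : S.card = r) :
    ∃ v : ℕ → Fin n, Set.InjOn v (Set.Iio r) ∧ (Finset.range r).image v = S := by
  obtain ⟨u, hu⟩ := Finset.card_pos.mp (hS ▸ hr)
  refine ⟨fun i => if h : i < r then (S.equivFinOfCardEq hS).symm ⟨i, h⟩ else u, ?_, ?_⟩
  · intro i hi j hj hij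
    simp only [Set.mem_Iio] at hi hj
    simp only [hi, hj, dif_pos] at hij
    simpa using hij
  · ext z
    simp only [Finset.mem_image, Finset.mem_range]
    constructor
    · rintro ⟨i, hi, rfl⟩
      simp [hi]
    · intro hz
      refine ⟨S.equivFinOfCardEq hS ⟨z, hz⟩, Fin.is_lt _, ?_⟩
      simp

/-- The logarithm of the number of graphs in which a given set is a clique. -/
lemma NearRegular.abs_log_cliquesOn_le (h : NearRegular L lam D d) (hr0 : 0 < r)
    (hr : (r : ℝ) ≤ L * √n) (hS : S.card = r) (hne : (degFinset n d).Nonempty) :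
    (cliquesOn d S).Nonempty ∧
    |Real.log (cliquesOn d S).card - Real.log (degFinset n d).card -
      (∑ j ∈ Finset.range r, ∑ i ∈ Finset.range j, (Real.log lam + regTerm n lam j i) +
      (∑ u ∈ S, ((d u : ℝ) - lam * (n - 1))) *
        ((∑ j ∈ Finset.range r, ∑ i ∈ Finset.range j, linTerm n lam j i 1 1 (i + (j - 1))) / r))| ≤
      r * (r * (L ^ 37 / √n ^ 3 + 3 * L ^ 3 * D ^ 2 / n ^ 2)) := by
  obtain ⟨v, hv, hvS⟩ := exists_enumeration hr0 hS
  have hr' : (r : ℝ) ≠ 0 := Nat.cast_ne_zero.mpr hr0.ne'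
  have hshift : ∀ s, Set.InjOn (fun i => v ((i + s) % r)) (Set.Iio r) ∧
      (Finset.range r).image (fun i => v ((i + s) % r)) = S := by
    intro s
    constructor
    · intro i hi j hj hij
      have := hv (Set.mem_Iio.mpr (Nat.mod_lt _ hr0)) (Set.mem_Iio.mpr (Nat.mod_lt _ hr0)) hij
      rw [add_comm i, add_comm j] at this
      exact injOn_add_mod s hi hj this
    · rw [← hvS]
      conv_rhs => rw [← image_add_mod s, Finset.image_image]
      simp only [Function.comp_def, add_comm s]
  have hmain : ∀ s ∈ Finset.range r,
      |Real.log (cliquesOn d S).card - Real.log (degFinset n d).card -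
        ∑ j ∈ Finset.range r, ∑ i ∈ Finset.range j,
        logTerm n lam (fun i => (d (v ((i + s) % r)) : ℝ) - lam * (n - 1)) j i| ≤
      r * (r * (L ^ 37 / √n ^ 3 + 3 * L ^ 3 * D ^ 2 / n ^ 2)) := by
    intro s _
    rw [cliquesOn_eq (hshift s).1 (hshift s).2]
    exact (h.card_partialCliques (hshift s).1 hr le_rfl hne).2
  refine ⟨?_, ?_⟩
  · rw [cliquesOn_eq hv hvS]
    exact (h.card_partialCliques hv hr le_rfl hne).1
  refine le_trans (le_of_eq ?_) (abs_sub_average_le hr0 hmain)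
  congr 2
  have hsum : ∑ u ∈ S, ((d u : ℝ) - lam * (n - 1)) =
      ∑ i ∈ Finset.range r, ((d (v i) : ℝ) - lam * (n - 1)) := by
    rw [← hvS, Finset.sum_image]
    intro i hi j hj
    exact hv (Finset.mem_range.mp hi) (Finset.mem_range.mp hj)
  rw [Finset.sum_comm, hsum]
  have h3 : ∀ j ∈ Finset.range r, ∑ s ∈ Finset.range r, ∑ i ∈ Finset.range j,
        logTerm n lam (fun i => (d (v ((i + s) % r)) : ℝ) - lam * (n - 1)) j i =
      ∑ i ∈ Finset.range j, (r * (Real.log lam + regTerm n lam j i) +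
        (∑ i ∈ Finset.range r, ((d (v i) : ℝ) - lam * (n - 1))) *
          linTerm n lam j i 1 1 (i + (j - 1))) := by
    intro j _
    rw [Finset.sum_comm]
    refine Finset.sum_congr rfl fun i _ => ?_
    exact sum_logTerm_shift n lam (fun i => (d (v i) : ℝ) - lam * (n - 1)) j i r
  rw [Finset.sum_congr rfl h3]
  simp only [Finset.sum_add_distrib, ← Finset.mul_sum]
  field_simp

end

/-! ### Sums of the deterministic terms -/

lemma sum_quadratic (A B C : ℝ) (m : ℕ) :
    ∑ i ∈ Finset.range m, (A + B * i + C * (i : ℝ) ^ 2) =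
      A * m + B * (m * (m - 1) / 2) + C * (m * (m - 1) * (2 * m - 1) / 6) := by
  induction m with
  | zero => simp
  | succ m ih => rw [Finset.sum_range_succ, ih]; push_cast; ring

lemma regTerm_eq {n : ℕ} {lam : ℝ} (hn : (n : ℝ) ≠ 0) (hl : lam ≠ 0) (hl1 : 1 - lam ≠ 0)
    (q l : ℝ) :
    regTerm n lam q l = -((1 - lam) / (lam * n)) * (q - 1 + l) + (1 - lam) / (lam ^ 2 * n ^ 2) *
      (-((q - 1) ^ 2 + l ^ 2) / 2 + lam * (-2 * (q - 1) * l -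
        (q * (q - 1) + l ^ 2 + q * l - (q - 1) - l) + (q - 1 + l) ^ 2 / 2)) := by
  unfold regTerm
  field_simp
  ring

lemma sum_regTerm {n : ℕ} {lam : ℝ} (hn : (n : ℝ) ≠ 0) (hl : lam ≠ 0) (hl1 : 1 - lam ≠ 0)
    (r : ℕ) :
    ∑ j ∈ Finset.range r, ∑ i ∈ Finset.range j, regTerm n lam j i =
      -((1 - lam) * (r : ℝ) ^ 2 * ((r : ℝ) - 3) / (2 * lam * n)) -
        (1 - lam) * (2 + 5 * lam) * (r : ℝ) ^ 4 / (12 * lam ^ 2 * (n : ℝ) ^ 2) +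
      (-((1 - lam) / (lam * n)) * r + (1 - lam) / (lam ^ 2 * n ^ 2) *
        ((3 / 4 * r ^ 3 - 13 / 12 * r ^ 2 + r / 2) +
          lam * (23 / 12 * r ^ 3 - 17 / 6 * r ^ 2 + 4 / 3 * r))) := by
  have inner : ∀ j : ℕ, ∑ i ∈ Finset.range j, regTerm n lam j i =
      -((1 - lam) / (lam * n)) * (j * (j - 1) * 3 / 2) + (1 - lam) / (lam ^ 2 * n ^ 2) *
        (-(j * (j - 1) ^ 2) / 2 - j * (j - 1) * (2 * j - 1) / 12 +
          lam * (-(j * (j - 1) ^ 2) / 2 - 2 * (j - 1) * (j * (j - 1) / 2) -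
            j * (j - 1) * (2 * j - 1) / 12)) := by
    intro j
    set α := (1 - lam) / (lam * n)
    set β := (1 - lam) / (lam ^ 2 * n ^ 2)
    have e : ∀ i : ℕ, regTerm n lam j i =
        (-α * (j - 1) + β * (-(j - 1) ^ 2 / 2 + lam * (-(j * (j - 1)) + (j - 1) +
          (j - 1) ^ 2 / 2))) +
        (-α + β * lam * (-2 * (j - 1) - j + 1 + (j - 1))) * i +
        (β * (-1 / 2 + lam * (-1 + 1 / 2))) * (i : ℝ) ^ 2 := by
      intro i
      rw [regTerm_eq hn hl hl1]
      ring
    simp only [e]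
    rw [sum_quadratic]
    ring
  simp only [inner]
  have outer : ∀ m : ℕ, ∑ j ∈ Finset.range m,
      (-((1 - lam) / (lam * n)) * ((j : ℝ) * (j - 1) * 3 / 2) + (1 - lam) / (lam ^ 2 * n ^ 2) *
        (-((j : ℝ) * (j - 1) ^ 2) / 2 - j * (j - 1) * (2 * j - 1) / 12 +
          lam * (-((j : ℝ) * (j - 1) ^ 2) / 2 - 2 * (j - 1) * (j * (j - 1) / 2) -
            j * (j - 1) * (2 * j - 1) / 12))) =
      -((1 - lam) / (lam * n)) * ((m : ℝ) * (m - 1) * (m - 2) / 2) +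
        (1 - lam) / (lam ^ 2 * n ^ 2) *
        ((m / 2 - 13 / 12 * m ^ 2 + 3 / 4 * m ^ 3 - m ^ 4 / 6) +
          lam * (4 / 3 * m - 17 / 6 * m ^ 2 + 23 / 12 * m ^ 3 - 5 / 12 * m ^ 4)) := by
    intro m
    induction m with
    | zero => simp
    | succ m ih => rw [Finset.sum_range_succ, ih]; push_cast; ring
  rw [outer]
  field_simp
  ring

section
variable {n : ℕ} {L lam : ℝ} {r : ℕ}

lemma abs_sum_regTerm_sub_le (hL : 100 ≤ L) (hl : 1 ≤ L * lam) (hl0 : 0 < lam) (hl1 : lam < 1)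
    (hn : 0 < (n : ℝ)) (hr : 1 ≤ r) :
    |∑ j ∈ Finset.range r, ∑ i ∈ Finset.range j, regTerm n lam j i -
      (-((1 - lam) * (r : ℝ) ^ 2 * ((r : ℝ) - 3) / (2 * lam * n)) -
        (1 - lam) * (2 + 5 * lam) * (r : ℝ) ^ 4 / (12 * lam ^ 2 * (n : ℝ) ^ 2))| ≤
      L * r / n + 9 * L ^ 2 * r ^ 3 / n ^ 2 := by
  rw [sum_regTerm hn.ne' hl0.ne' (by linarith), add_sub_cancel_left]
  have hL0 : 0 < L := by linarith
  have hr1 : (1 : ℝ) ≤ r := by exact_mod_cast hr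
  have hlL : 1 / lam ≤ L := by rw [div_le_iff₀ hl0]; exact hl
  have hli : 0 ≤ 1 / lam := (div_pos one_pos hl0).le
  have hc0 : 0 ≤ 1 - lam := by linarith
  have a1 : |-((1 - lam) / (lam * n)) * r| ≤ L * r / n := by
    rw [show -((1 - lam) / (lam * n)) * r = -((1 - lam) * (1 / lam) * r / n) by field_simp,
      abs_neg, abs_of_nonneg (by positivity)]
    refine div_le_div_of_nonneg_right (mul_le_mul_of_nonneg_right ?_ (by linarith)) hn.le
    nlinarith
  have a2 : |(3 / 4 * (r : ℝ) ^ 3 - 13 / 12 * r ^ 2 + r / 2) +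
      lam * (23 / 12 * r ^ 3 - 17 / 6 * r ^ 2 + 4 / 3 * r)| ≤ 9 * (r : ℝ) ^ 3 := by
    have h2 : (r : ℝ) ^ 2 ≤ r ^ 3 := pow_le_pow_right₀ hr1 (by norm_num)
    have h3 : (r : ℝ) ≤ r ^ 3 := le_self_pow₀ hr1 (by norm_num)
    have h4 : 0 ≤ (r : ℝ) ^ 2 := sq_nonneg _
    have b1 : |3 / 4 * (r : ℝ) ^ 3 - 13 / 12 * r ^ 2 + r / 2| ≤ 5 / 2 * (r : ℝ) ^ 3 := by
      rw [abs_le]; constructor <;> linarith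
    have b2 : |23 / 12 * (r : ℝ) ^ 3 - 17 / 6 * r ^ 2 + 4 / 3 * r| ≤ 13 / 2 * (r : ℝ) ^ 3 := by
      rw [abs_le]; constructor <;> linarith
    have b3 : |lam * (23 / 12 * (r : ℝ) ^ 3 - 17 / 6 * r ^ 2 + 4 / 3 * r)| ≤ 13 / 2 * (r : ℝ) ^ 3 := by
      rw [abs_mul, abs_of_pos hl0]
      exact (mul_le_of_le_one_left (abs_nonneg _) hl1.le).trans b2
    exact (abs_add_le _ _).trans (by linarith)
  refine (abs_add_le _ _).trans (add_le_add a1 ?_)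
  rw [abs_mul]
  have a3 : |(1 - lam) / (lam ^ 2 * n ^ 2)| ≤ L ^ 2 / n ^ 2 := by
    rw [show (1 - lam) / (lam ^ 2 * n ^ 2) = (1 - lam) * (1 / lam) ^ 2 / n ^ 2 by field_simp,
      abs_of_nonneg (by positivity)]
    refine div_le_div_of_nonneg_right ?_ (by positivity)
    have := pow_le_pow_left₀ hli hlL 2
    have h5 : 0 ≤ (1 / lam) ^ 2 := by positivity
    nlinarith
  calc _ ≤ L ^ 2 / n ^ 2 * (9 * r ^ 3) :=
        mul_le_mul a3 a2 (abs_nonneg _) (by positivity)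
    _ = _ := by ring

lemma abs_linTerm_sub_le (hL : 100 ≤ L) (hl : 1 ≤ L * lam) (hl0 : 0 < lam) (hl1 : lam < 1)
    (hn : 0 < (n : ℝ)) {i j : ℕ} (hi : i < j) (hj : j < r) :
    |linTerm n lam j i 1 1 (i + (j - 1)) - 2 / (lam * n)| ≤ 10 * L ^ 2 * r / n ^ 2 := by
  have hL0 : 0 < L := by linarith
  have hi0 : (0 : ℝ) ≤ i := Nat.cast_nonneg i
  have hi1 : (i : ℝ) + 1 ≤ j := by exact_mod_cast hi
  have hj1 : (j : ℝ) + 1 ≤ r := by exact_mod_cast hj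
  have hlL : 1 / lam ≤ L := by rw [div_le_iff₀ hl0]; exact hl
  have hli : 0 ≤ 1 / lam := (div_pos one_pos hl0).le
  have hc : 1 - lam ≠ 0 := by linarith
  have e : linTerm n lam j i 1 1 (i + (j - 1)) - 2 / (lam * n) =
      ((2 * j + 2 * i - 1) * (1 / lam) + (i + j - 1) * (1 / lam) ^ 2) / n ^ 2 := by
    unfold linTerm
    field_simp
    ring
  have hsq := pow_le_pow_left₀ hli hlL 2
  have hLL : L ≤ L ^ 2 := by nlinarith
  rw [e, abs_of_nonneg (div_nonneg (add_nonneg (mul_nonneg (by linarith) hli)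
    (mul_nonneg (by linarith) (sq_nonneg _))) (by positivity))]
  refine div_le_div_of_nonneg_right ?_ (by positivity)
  have h1 : (2 * (j : ℝ) + 2 * i - 1) * (1 / lam) ≤ (4 * (r : ℝ)) * L ^ 2 :=
    mul_le_mul (by linarith) (hlL.trans hLL) hli (by linarith)
  have h2 : ((i : ℝ) + j - 1) * (1 / lam) ^ 2 ≤ (2 * (r : ℝ)) * L ^ 2 :=
    mul_le_mul (by linarith) hsq (sq_nonneg _) (by linarith)
  have h3 : 0 ≤ (r : ℝ) * L ^ 2 := by positivity
  nlinarith

lemma abs_sum_linTerm_sub_le (hL : 100 ≤ L) (hl : 1 ≤ L * lam) (hl0 : 0 < lam) (hl1 : lam < 1)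
    (hn : 0 < (n : ℝ)) (hr : 1 ≤ r) :
    |(∑ j ∈ Finset.range r, ∑ i ∈ Finset.range j, linTerm n lam j i 1 1 (i + (j - 1))) / r -
      ((r : ℝ) - 1) / (lam * n)| ≤ 10 * L ^ 2 * r ^ 2 / n ^ 2 := by
  have hr1 : (1 : ℝ) ≤ r := by exact_mod_cast hr
  have hr0 : (0 : ℝ) < r := by linarith
  have e : (∑ j ∈ Finset.range r, ∑ i ∈ Finset.range j, linTerm n lam j i 1 1 (i + (j - 1))) / r -
      ((r : ℝ) - 1) / (lam * n) = (∑ j ∈ Finset.range r, ∑ i ∈ Finset.range j,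
        (linTerm n lam j i 1 1 (i + (j - 1)) - 2 / (lam * n))) / r := by
    have : ∑ j ∈ Finset.range r, ∑ _i ∈ Finset.range j, 2 / (lam * n) =
        r * (r - 1) / (lam * n) := by
      have h1 : ∀ j : ℕ, ∑ _i ∈ Finset.range j, 2 / (lam * n) =
          0 + (2 / (lam * n)) * j + 0 * (j : ℝ) ^ 2 := by
        intro j
        rw [Finset.sum_const, Finset.card_range, nsmul_eq_mul]; ring
      simp only [h1]
      rw [sum_quadratic]
      ring
    simp only [Finset.sum_sub_distrib, this]
    field_simp
  rw [e, abs_div, abs_of_pos hr0, div_le_iff₀ hr0]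
  calc _ ≤ ∑ j ∈ Finset.range r, |∑ i ∈ Finset.range j,
        (linTerm n lam j i 1 1 (i + (j - 1)) - 2 / (lam * n))| := Finset.abs_sum_le_sum_abs _ _
    _ ≤ ∑ _j ∈ Finset.range r, r * (10 * L ^ 2 * r / n ^ 2) := by
        refine Finset.sum_le_sum fun j hj => ?_
        have hj' := Finset.mem_range.mp hj
        refine (Finset.abs_sum_le_sum_abs _ _).trans ((Finset.sum_le_sum fun i hi =>
          abs_linTerm_sub_le hL hl hl0 hl1 hn (Finset.mem_range.mp hi) hj').trans ?_)
        rw [Finset.sum_const, Finset.card_range, nsmul_eq_mul]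
        exact mul_le_mul_of_nonneg_right (Nat.cast_le.mpr hj'.le) (by positivity)
    _ = _ := by rw [Finset.sum_const, Finset.card_range, nsmul_eq_mul]; ring

end

/-! ### The exponential moments of the sum over a random subset -/

lemma sum_powersetCard_succ {α : Type*} [Fintype α] [DecidableEq α] (m : ℕ) (g : Finset α → ℝ) :
    ((m : ℝ) + 1) * ∑ S ∈ Finset.powersetCard (m + 1) (Finset.univ : Finset α), g S =
      ∑ S ∈ Finset.powersetCard m (Finset.univ : Finset α), ∑ v ∈ Sᶜ, g (insert v S) := by
  have h1 : ((m : ℝ) + 1) * ∑ S ∈ Finset.powersetCard (m + 1) (Finset.univ : Finset α), g S =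
      ∑ S ∈ Finset.powersetCard (m + 1) (Finset.univ : Finset α), ∑ _v ∈ S, g S := by
    rw [Finset.mul_sum]
    refine Finset.sum_congr rfl fun S hS => ?_
    rw [Finset.sum_const, (Finset.mem_powersetCard.mp hS).2, nsmul_eq_mul]
    push_cast
    ring
  rw [h1, Finset.sum_sigma', Finset.sum_sigma']
  refine Finset.sum_bij' (fun p _ => ⟨p.1.erase p.2, p.2⟩) (fun p _ => ⟨insert p.2 p.1, p.2⟩)
    ?_ ?_ ?_ ?_ ?_
  · rintro ⟨S, v⟩ h
    simp only [Finset.mem_sigma, Finset.mem_powersetCard, Finset.subset_univ, true_and,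
      Finset.mem_compl] at h ⊢
    exact ⟨by rw [Finset.card_erase_of_mem h.2, h.1]; rfl, Finset.notMem_erase v S⟩
  · rintro ⟨S, v⟩ h
    simp only [Finset.mem_sigma, Finset.mem_powersetCard, Finset.subset_univ, true_and,
      Finset.mem_compl] at h ⊢
    exact ⟨by rw [Finset.card_insert_of_notMem h.2, h.1], Finset.mem_insert_self v S⟩
  · rintro ⟨S, v⟩ h
    simp only [Finset.mem_sigma] at h
    simp [Finset.insert_erase h.2]
  · rintro ⟨S, v⟩ h
    simp only [Finset.mem_sigma, Finset.mem_compl] at h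
    simp [Finset.erase_insert h.2]
  · rintro ⟨S, v⟩ h
    simp only [Finset.mem_sigma] at h
    simp [Finset.insert_erase h.2]

lemma abs_exp_sub_le {y : ℝ} (hy : |y| ≤ 1) : |Real.exp y - 1 - y - y ^ 2 / 2| ≤ |y| ^ 3 := by
  have h := Real.exp_bound hy (n := 3) (by norm_num)
  simp only [Finset.sum_range_succ, Finset.sum_range_zero, Nat.factorial] at h
  norm_num at h
  have e : Real.exp y - 1 - y - y ^ 2 / 2 = Real.exp y - (1 + y + y ^ 2 / 2) := by ring
  rw [e]
  refine h.trans ?_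
  have : 0 ≤ |y| ^ 3 := by positivity
  linarith

/-- The logarithm of `1 + u + w + θ` for small `u`, `w` and very small `θ`. -/
lemma log_add_bounds {f u w θ x p : ℝ} (hf : f = 1 - u + w + θ) (hx0 : 0 ≤ x) (hx : x ≤ 1 / 20)
    (hp0 : 0 ≤ p) (hp : p ≤ 1) (hu : |u| ≤ 2 * x * p) (hw : |w| ≤ x ^ 2)
    (hθ : |θ| ≤ 3 * (x ^ 3 + x ^ 2 * p)) :
    Real.exp (-u + w - 40 * (x ^ 3 + x ^ 2 * p)) ≤ f ∧
      f ≤ Real.exp (-u + w + 40 * (x ^ 3 + x ^ 2 * p)) := by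
  have hE : 0 ≤ x ^ 3 + x ^ 2 * p := by positivity
  have hx2 : x ^ 2 ≤ 1 / 400 := by nlinarith
  have hx2' : 0 ≤ x ^ 2 := sq_nonneg x
  have hEx : x ^ 3 + x ^ 2 * p ≤ 1 / 300 := by
    have : x ^ 3 ≤ 1 / 400 * (1 / 20) := by
      calc x ^ 3 = x ^ 2 * x := by ring
        _ ≤ _ := mul_le_mul hx2 hx hx0 (by norm_num)
    have : x ^ 2 * p ≤ 1 / 400 * 1 := mul_le_mul hx2 hp hp0 (by norm_num)
    linarith
  have hxp : x * p ≤ 1 / 20 := by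
    calc x * p ≤ 1 / 20 * 1 := mul_le_mul hx hp hp0 (by norm_num)
      _ = _ := by ring
  set s := -u + w with hs
  have hs1 : |s| ≤ 2 * x * p + x ^ 2 := by
    rw [hs]; refine (abs_add_le _ _).trans ?_; rw [abs_neg]; linarith
  have hs2 : |s| ≤ 1 / 5 := by linarith
  have hs3 : s ^ 2 ≤ 8 * (x ^ 3 + x ^ 2 * p) := by
    have h1 : s ^ 2 ≤ (2 * x * p + x ^ 2) ^ 2 := by
      rw [← sq_abs]; exact pow_le_pow_left₀ (abs_nonneg _) hs1 2
    have h2 : x ^ 2 * p ^ 2 ≤ x ^ 2 * p := mul_le_mul_of_nonneg_left (by nlinarith) hx2'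
    have h3 : x ^ 4 ≤ x ^ 3 := by
      calc x ^ 4 = x ^ 3 * x := by ring
        _ ≤ x ^ 3 * 1 := mul_le_mul_of_nonneg_left (by linarith) (by positivity)
        _ = _ := by ring
    have h4 : x ^ 3 * p ≤ x ^ 3 * 1 := mul_le_mul_of_nonneg_left hp (by positivity)
    nlinarith
  have hfs : f = 1 + s + θ := by rw [hf, hs]; ring
  have hθ' := abs_le.mp hθ
  have hs' := abs_le.mp hs2
  set E := x ^ 3 + x ^ 2 * p with hEdef
  constructor
  · have h1 := Real.abs_exp_sub_one_sub_id_le (x := s - 40 * E)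
      (abs_le.mpr ⟨by linarith, by linarith⟩)
    have h2 := (abs_le.mp h1).2
    have h3 : (s - 40 * E) ^ 2 ≤ s ^ 2 + 26 * E := by nlinarith
    linarith
  · have h2 := Real.add_one_le_exp (s + 40 * E)
    linarith

section
variable {α : Type*} [Fintype α] [DecidableEq α] {δ : α → ℝ} {D R t x p : ℝ} {m r : ℕ}
  {S : Finset α}

/-- The average of `exp (t * δ v)` over the complement of a small set. -/
lemma average_compl_bounds (hD : ∀ v, |δ v| ≤ D) (hsum : ∑ v, δ v = 0)
    (hR : ∑ v, δ v ^ 2 = Fintype.card α * R) (hS : S.card = m) (hm : m < r)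
    (hp : 2 * (r : ℝ) = p * Fintype.card α) (hp1 : p ≤ 1)
    (hx : x ≤ 1 / 20) (ht : |t| * D ≤ x) (hD0 : 0 ≤ D) :
    Real.exp (-(t * (∑ v ∈ S, δ v) / (Fintype.card α - m)) + t ^ 2 * R / 2 -
        40 * (x ^ 3 + x ^ 2 * p)) * (Fintype.card α - m) ≤ ∑ v ∈ Sᶜ, Real.exp (t * δ v) ∧
      ∑ v ∈ Sᶜ, Real.exp (t * δ v) ≤
      Real.exp (-(t * (∑ v ∈ S, δ v) / (Fintype.card α - m)) + t ^ 2 * R / 2 +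
        40 * (x ^ 3 + x ^ 2 * p)) * (Fintype.card α - m) := by
  set N : ℝ := ((Fintype.card α : ℕ) : ℝ) with hN
  have hm' : (m : ℝ) + 1 ≤ r := by exact_mod_cast hm
  have hm0 : (0 : ℝ) ≤ m := Nat.cast_nonneg m
  have hN0 : 0 ≤ N := Nat.cast_nonneg _
  have hNpos : 0 < N := by
    rcases hN0.eq_or_lt with h | h
    · rw [← h] at hp; linarith
    · exact h
  have hp0 : 0 ≤ p := by
    by_contra hneg
    have : p * N < 0 := mul_neg_of_neg_of_pos (by linarith) hNpos
    linarith
  have hrN : 2 * (r : ℝ) ≤ N := by rw [hp]; nlinarith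
  have hNm : 0 < N - m := by linarith
  have hNm2 : N / 2 ≤ N - m := by linarith
  have hmp : m ≤ p * (N - m) := by nlinarith
  have hx0 : 0 ≤ x := le_trans (mul_nonneg (abs_nonneg t) hD0) ht
  have hy : ∀ v, |t * δ v| ≤ x := fun v => by
    rw [abs_mul]; exact (mul_le_mul_of_nonneg_left (hD v) (abs_nonneg t)).trans ht
  have hsq : ∀ v, (t * δ v) ^ 2 ≤ x ^ 2 := fun v => by
    rw [← sq_abs]; exact pow_le_pow_left₀ (abs_nonneg _) (hy v) 2
  have hcard : ((Sᶜ : Finset α).card : ℝ) = N - m := by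
    rw [Finset.card_compl, hS, Nat.cast_sub (hS ▸ Finset.card_le_univ S)]
  have hc1 : ∑ v ∈ Sᶜ, δ v = -∑ v ∈ S, δ v := by
    have := Finset.sum_add_sum_compl S δ
    linarith
  have hc2 : ∑ v ∈ Sᶜ, δ v ^ 2 = N * R - ∑ v ∈ S, δ v ^ 2 := by
    have := Finset.sum_add_sum_compl S fun v => δ v ^ 2
    linarith
  have hR0 : 0 ≤ t ^ 2 * R := by
    have : 0 ≤ N * R := by rw [← hR]; exact Finset.sum_nonneg fun v _ => sq_nonneg _
    exact mul_nonneg (sq_nonneg t) (nonneg_of_mul_nonneg_right this hNpos)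
  have hRx : t ^ 2 * R ≤ x ^ 2 := by
    have : t ^ 2 * (N * R) ≤ N * x ^ 2 := by
      rw [← hR, Finset.mul_sum, hN]
      calc ∑ v, t ^ 2 * δ v ^ 2 ≤ ∑ _v : α, x ^ 2 :=
            Finset.sum_le_sum fun v _ => by rw [← mul_pow]; exact hsq v
        _ = _ := by rw [Finset.sum_const, nsmul_eq_mul]; rfl
    have e : t ^ 2 * (N * R) = N * (t ^ 2 * R) := by ring
    rw [e] at this
    exact le_of_mul_le_mul_left this hNpos
  have hu : |t * (∑ v ∈ S, δ v) / (N - m)| ≤ 2 * x * p := by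
    rw [abs_div, abs_of_pos hNm, div_le_iff₀ hNm, Finset.mul_sum]
    calc |∑ v ∈ S, t * δ v| ≤ ∑ v ∈ S, |t * δ v| := Finset.abs_sum_le_sum_abs _ _
      _ ≤ ∑ _v ∈ S, x := Finset.sum_le_sum fun v _ => hy v
      _ = m * x := by rw [Finset.sum_const, hS, nsmul_eq_mul]
      _ ≤ p * (N - m) * x := mul_le_mul_of_nonneg_right hmp hx0
      _ ≤ 2 * (p * (N - m) * x) := by
        have : 0 ≤ p * (N - m) * x := mul_nonneg (mul_nonneg hp0 hNm.le) hx0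
        linarith
      _ = _ := by ring
  have hQ0 : 0 ≤ ∑ v ∈ S, (t * δ v) ^ 2 := Finset.sum_nonneg fun v _ => sq_nonneg _
  have hQ : ∑ v ∈ S, (t * δ v) ^ 2 ≤ m * x ^ 2 := by
    calc _ ≤ ∑ _v ∈ S, x ^ 2 := Finset.sum_le_sum fun v _ => hsq v
      _ = _ := by rw [Finset.sum_const, hS, nsmul_eq_mul]
  have hrem : |∑ v ∈ Sᶜ, (Real.exp (t * δ v) - 1 - t * δ v - (t * δ v) ^ 2 / 2)| ≤
      (N - m) * x ^ 3 := by
    refine (Finset.abs_sum_le_sum_abs _ _).trans ?_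
    calc _ ≤ ∑ _v ∈ Sᶜ, x ^ 3 := Finset.sum_le_sum fun v _ =>
          (abs_exp_sub_le ((hy v).trans (by linarith))).trans
            (pow_le_pow_left₀ (abs_nonneg _) (hy v) 3)
      _ = _ := by rw [Finset.sum_const, nsmul_eq_mul, hcard]
  have hexp : ∑ v ∈ Sᶜ, (Real.exp (t * δ v) - 1 - t * δ v - (t * δ v) ^ 2 / 2) =
      ∑ v ∈ Sᶜ, Real.exp (t * δ v) - (N - m) + t * (∑ v ∈ S, δ v) -
        (N * (t ^ 2 * R) - ∑ v ∈ S, (t * δ v) ^ 2) / 2 := by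
    have e1 : ∑ v ∈ Sᶜ, (t * δ v) ^ 2 = N * (t ^ 2 * R) - ∑ v ∈ S, (t * δ v) ^ 2 := by
      simp only [mul_pow, ← Finset.mul_sum, hc2]; ring
    rw [Finset.sum_sub_distrib, Finset.sum_sub_distrib, Finset.sum_sub_distrib, ← Finset.sum_div,
      e1, ← Finset.mul_sum, hc1, Finset.sum_const, nsmul_eq_mul, hcard]
    ring
  set F := ∑ v ∈ Sᶜ, Real.exp (t * δ v) with hF
  set Y := ∑ v ∈ S, δ v with hY
  set Q := ∑ v ∈ S, (t * δ v) ^ 2 with hQdef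
  rw [hexp] at hrem
  have hθ : |F / (N - m) - 1 + t * Y / (N - m) - t ^ 2 * R / 2| ≤ 3 * (x ^ 3 + x ^ 2 * p) := by
    have e1 : F / (N - m) - 1 + t * Y / (N - m) - t ^ 2 * R / 2 =
        ((F - (N - m) + t * Y - (N * (t ^ 2 * R) - Q) / 2) + (m * (t ^ 2 * R) - Q) / 2) /
          (N - m) := by
      field_simp; ring
    rw [e1, abs_div, abs_of_pos hNm, div_le_iff₀ hNm]
    have e2 : |(m * (t ^ 2 * R) - Q) / 2| ≤ m * x ^ 2 := by
      have : m * (t ^ 2 * R) ≤ m * x ^ 2 := mul_le_mul_of_nonneg_left hRx hm0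
      have : 0 ≤ m * (t ^ 2 * R) := mul_nonneg hm0 hR0
      rw [abs_le]; constructor <;> linarith
    have e3 : m * x ^ 2 ≤ p * (N - m) * x ^ 2 := mul_le_mul_of_nonneg_right hmp (sq_nonneg x)
    have e4 : 0 ≤ (N - m) * x ^ 3 := mul_nonneg hNm.le (pow_nonneg hx0 3)
    have e5 : 0 ≤ p * (N - m) * x ^ 2 := mul_nonneg (mul_nonneg hp0 hNm.le) (sq_nonneg x)
    refine (abs_add_le _ _).trans ((add_le_add hrem e2).trans ?_)
    linarith
  obtain ⟨g1, g2⟩ := log_add_bounds (f := F / (N - m)) (u := t * Y / (N - m)) (w := t ^ 2 * R / 2)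
    (θ := F / (N - m) - 1 + t * Y / (N - m) - t ^ 2 * R / 2) (by ring) hx0 hx hp0 hp1 hu
    (by rw [abs_of_nonneg (by linarith)]; linarith) hθ
  rw [le_div_iff₀ hNm] at g1
  rw [div_le_iff₀ hNm] at g2
  exact ⟨g1, g2⟩

/-- The exponential moment of the sum over a random subset of size `m`. -/
lemma sum_exp_bounds (hD : ∀ v, |δ v| ≤ D) (hsum : ∑ v, δ v = 0)
    (hR : ∑ v, δ v ^ 2 = Fintype.card α * R) (hp : 2 * (r : ℝ) = p * Fintype.card α)
    (hp1 : p ≤ 1) (hp0 : 0 ≤ p) (hx : x ≤ 1 / 20) (hD0 : 0 ≤ D) (hRD : R ≤ D ^ 2) (hR0 : 0 ≤ R)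
    (hm : m ≤ r) (ht : |t| * D ≤ x) :
    (Fintype.card α).choose m *
        Real.exp (m * (t ^ 2 * R / 2) - m * (42 * (x ^ 3 + x ^ 2 * p))) ≤
      ∑ S ∈ Finset.powersetCard m (Finset.univ : Finset α), Real.exp (t * ∑ v ∈ S, δ v) ∧
    ∑ S ∈ Finset.powersetCard m (Finset.univ : Finset α), Real.exp (t * ∑ v ∈ S, δ v) ≤
      (Fintype.card α).choose m *
        Real.exp (m * (t ^ 2 * R / 2) + m * (42 * (x ^ 3 + x ^ 2 * p))) := by
  induction m generalizing t with
  | zero => simp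
  | succ m ih =>
    set N : ℝ := ((Fintype.card α : ℕ) : ℝ) with hN
    have hx0 : 0 ≤ x := le_trans (mul_nonneg (abs_nonneg t) hD0) ht
    set E := x ^ 3 + x ^ 2 * p with hE
    have hE1 : x ^ 2 * p ≤ E := by
      have : 0 ≤ x ^ 3 := pow_nonneg hx0 3
      linarith
    have hm' : (m : ℝ) + 1 ≤ r := by exact_mod_cast hm
    have hm0 : (0 : ℝ) ≤ m := Nat.cast_nonneg m
    have hN0 : 0 ≤ N := Nat.cast_nonneg _
    have hrN : 2 * (r : ℝ) ≤ N := by rw [hp]; nlinarith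
    have hNm : 1 ≤ N - m := by linarith
    have hNm0 : 0 < N - m := by linarith
    have hmp : m ≤ p * (N - m) := by nlinarith
    have hi0 : 0 ≤ 1 / (N - m) := (div_pos one_pos hNm0).le
    have hi1 : 1 / (N - m) ≤ 1 := by rw [div_le_one hNm0]; exact hNm
    have hmi : m * (1 / (N - m)) ≤ p := by rw [mul_one_div, div_le_iff₀ hNm0]; exact hmp
    set t' := t * (1 - 1 / (N - m)) with ht'def
    have ht' : |t'| * D ≤ x := by
      refine le_trans (mul_le_mul_of_nonneg_right ?_ hD0) ht
      rw [ht'def, abs_mul, abs_of_nonneg (by linarith : 0 ≤ 1 - 1 / (N - m))]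
      exact mul_le_of_le_one_right (abs_nonneg t) (by linarith)
    obtain ⟨ih1, ih2⟩ := ih (by omega) ht'
    have htR : t ^ 2 * R ≤ x ^ 2 := by
      calc t ^ 2 * R ≤ t ^ 2 * D ^ 2 := mul_le_mul_of_nonneg_left hRD (sq_nonneg t)
        _ = (|t| * D) ^ 2 := by rw [mul_pow, sq_abs]
        _ ≤ x ^ 2 := pow_le_pow_left₀ (mul_nonneg (abs_nonneg t) hD0) ht 2
    have htR0 : 0 ≤ t ^ 2 * R := mul_nonneg (sq_nonneg t) hR0
    have hmt : m * (t' ^ 2 * R / 2) ≤ m * (t ^ 2 * R / 2) ∧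
        m * (t ^ 2 * R / 2) - 2 * E ≤ m * (t' ^ 2 * R / 2) := by
      have e1 : m * (t' ^ 2 * R / 2) = m * (t ^ 2 * R / 2) -
          (m * (1 / (N - m))) * (t ^ 2 * R) * (2 - 1 / (N - m)) / 2 := by
        rw [ht'def]; ring
      have e2 : 0 ≤ (m * (1 / (N - m))) * (t ^ 2 * R) := mul_nonneg (mul_nonneg hm0 hi0) htR0
      have e3 : (m * (1 / (N - m))) * (t ^ 2 * R) ≤ p * x ^ 2 := mul_le_mul hmi htR htR0 hp0
      rw [e1]
      constructor
      · have := mul_nonneg e2 (by linarith : 0 ≤ 2 - 1 / (N - m))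
        linarith
      · have := mul_le_mul_of_nonneg_left (by linarith : 2 - 1 / (N - m) ≤ 2) e2
        have hpx : p * x ^ 2 = x ^ 2 * p := mul_comm _ _
        have hE0 : 0 ≤ E := le_trans (mul_nonneg (sq_nonneg x) hp0) hE1
        linarith
    have hchoose : ((m : ℝ) + 1) * (Fintype.card α).choose (m + 1) =
        (N - m) * (Fintype.card α).choose m := by
      have h1 := Nat.choose_succ_right_eq (Fintype.card α) m
      have h2 : m ≤ Fintype.card α := by
        have : (m : ℝ) ≤ Fintype.card α := by linarith
        exact_mod_cast this
      have h3 : (((Fintype.card α).choose (m + 1) * (m + 1) : ℕ) : ℝ) =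
          ((Fintype.card α).choose m * (Fintype.card α - m) : ℕ) := by rw [h1]
      push_cast [h2] at h3
      linarith
    have hm1 : (0 : ℝ) < (m : ℝ) + 1 := by linarith
    have hrec := sum_powersetCard_succ m fun S : Finset α => Real.exp (t * ∑ v ∈ S, δ v)
    have hrec' : ((m : ℝ) + 1) * ∑ S ∈ Finset.powersetCard (m + 1) (Finset.univ : Finset α),
        Real.exp (t * ∑ v ∈ S, δ v) = ∑ S ∈ Finset.powersetCard m (Finset.univ : Finset α),
          Real.exp (t * ∑ v ∈ S, δ v) * ∑ v ∈ Sᶜ, Real.exp (t * δ v) := by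
      rw [hrec]
      refine Finset.sum_congr rfl fun S _ => ?_
      rw [Finset.mul_sum]
      refine Finset.sum_congr rfl fun v hv => ?_
      rw [Finset.sum_insert (Finset.mem_compl.mp hv), ← Real.exp_add]
      congr 1; ring
    have hfac : ∀ (c : ℝ) (S : Finset α), Real.exp (t * ∑ v ∈ S, δ v) *
        (Real.exp (-(t * (∑ v ∈ S, δ v) / (N - m)) + t ^ 2 * R / 2 + c) * (N - m)) =
        (N - m) * Real.exp (t ^ 2 * R / 2 + c) * Real.exp (t' * ∑ v ∈ S, δ v) := by
      intro c S
      rw [mul_assoc (N - m), ← Real.exp_add, ← mul_assoc, ← Real.exp_add, mul_comm]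
      congr 2
      rw [ht'def]; ring
    have hfin : ∀ c c' : ℝ, (N - m) * Real.exp (t ^ 2 * R / 2 + c) *
        ((Fintype.card α).choose m * Real.exp (m * (t' ^ 2 * R / 2) + c')) =
        ((m : ℝ) + 1) * ((Fintype.card α).choose (m + 1) *
          Real.exp (t ^ 2 * R / 2 + c + (m * (t' ^ 2 * R / 2) + c'))) := by
      intro c c'
      rw [← mul_assoc ((m : ℝ) + 1), hchoose, Real.exp_add _ (m * (t' ^ 2 * R / 2) + c')]
      ring
    constructor
    · refine le_of_mul_le_mul_left ?_ hm1
      rw [hrec']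
      have step : (N - m) * Real.exp (t ^ 2 * R / 2 + -(40 * E)) *
          ∑ S ∈ Finset.powersetCard m (Finset.univ : Finset α), Real.exp (t' * ∑ v ∈ S, δ v) ≤
          ∑ S ∈ Finset.powersetCard m (Finset.univ : Finset α),
            Real.exp (t * ∑ v ∈ S, δ v) * ∑ v ∈ Sᶜ, Real.exp (t * δ v) := by
        rw [Finset.mul_sum]
        refine Finset.sum_le_sum fun S hS => ?_
        rw [← hfac]
        refine mul_le_mul_of_nonneg_left ?_ (Real.exp_pos _).le
        have := (average_compl_bounds hD hsum hR (Finset.mem_powersetCard.mp hS).2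
          (by omega) hp hp1 hx ht hD0).1
        rwa [sub_eq_add_neg] at this
      refine le_trans ?_ step
      rw [sub_eq_add_neg] at ih1
      refine le_trans ?_ (mul_le_mul_of_nonneg_left ih1
        (mul_nonneg hNm0.le (Real.exp_pos _).le))
      rw [hfin]
      refine mul_le_mul_of_nonneg_left (mul_le_mul_of_nonneg_left (Real.exp_le_exp.mpr ?_)
        (Nat.cast_nonneg _)) hm1.le
      push_cast
      linarith [hmt.2]
    · refine le_of_mul_le_mul_left ?_ hm1
      rw [hrec']
      have step : ∑ S ∈ Finset.powersetCard m (Finset.univ : Finset α),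
            Real.exp (t * ∑ v ∈ S, δ v) * ∑ v ∈ Sᶜ, Real.exp (t * δ v) ≤
          (N - m) * Real.exp (t ^ 2 * R / 2 + 40 * E) *
          ∑ S ∈ Finset.powersetCard m (Finset.univ : Finset α), Real.exp (t' * ∑ v ∈ S, δ v) := by
        rw [Finset.mul_sum]
        refine Finset.sum_le_sum fun S hS => ?_
        rw [← hfac]
        refine mul_le_mul_of_nonneg_left ?_ (Real.exp_pos _).le
        exact (average_compl_bounds hD hsum hR (Finset.mem_powersetCard.mp hS).2
          (by omega) hp hp1 hx ht hD0).2
      refine step.trans ((mul_le_mul_of_nonneg_left ih2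
        (mul_nonneg hNm0.le (Real.exp_pos _).le)).trans ?_)
      rw [hfin]
      refine mul_le_mul_of_nonneg_left (mul_le_mul_of_nonneg_left (Real.exp_le_exp.mpr ?_)
        (Nat.cast_nonneg _)) hm1.le
      push_cast
      have hE0 : 0 ≤ E := le_trans (mul_nonneg (sq_nonneg x) hp0) hE1
      linarith [hmt.1]

end

/-! ### The expected number of cliques with an explicit error -/

section
variable {n : ℕ} {d : Fin n → ℕ} {r : ℕ} {L lam D : ℝ}

lemma expCliques_eq_sum (n : ℕ) (d : Fin n → ℕ) (r : ℕ) :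
    expCliques n d r = ∑ S ∈ Finset.powersetCard r (Finset.univ : Finset (Fin n)),
      ((cliquesOn d S).card : ℝ) / (degFinset n d).card := by
  rw [expCliques, ← Finset.sum_div]
  congr 1
  have h1 : ∀ G : SimpleGraph (Fin n), (cliqueCount r G : ℝ) =
      ∑ S ∈ Finset.powersetCard r (Finset.univ : Finset (Fin n)),
        if ∀ j ∈ S, ∀ k ∈ S, j ≠ k → G.Adj j k then (1 : ℝ) else 0 := by
    intro G
    rw [cliqueCount, ← Finset.sum_filter, Finset.sum_const, nsmul_eq_mul, mul_one]
    congr 2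
    ext S
    simp [Finset.mem_powersetCard]
  simp only [h1]
  rw [Finset.sum_comm]
  refine Finset.sum_congr rfl fun S _ => ?_
  rw [cliquesOn, Finset.card_filter]
  push_cast
  rfl

/-- If each summand is `exp (M + t * Y S)` up to a factor close to one, and the exponential moment
is known, then so is the sum. -/
lemma exists_exp_of_sum {ι : Type*} {s : Finset ι} {P Y : ι → ℝ} {M t e e' c w : ℝ} (hc : 0 < c)
    (hP0 : ∀ i ∈ s, 0 < P i) (hP : ∀ i ∈ s, |Real.log (P i) - (M + Y i * t)| ≤ e)
    (h1 : c * Real.exp (w - e') ≤ ∑ i ∈ s, Real.exp (t * Y i))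
    (h2 : ∑ i ∈ s, Real.exp (t * Y i) ≤ c * Real.exp (w + e')) :
    ∃ E, |E| ≤ e + e' ∧ ∑ i ∈ s, P i = c * Real.exp (M + w + E) := by
  have l1 : c * Real.exp (M + w - (e + e')) ≤ ∑ i ∈ s, P i := by
    calc c * Real.exp (M + w - (e + e')) = Real.exp (M - e) * (c * Real.exp (w - e')) := by
          rw [mul_left_comm, ← Real.exp_add]; congr 2; ring
      _ ≤ Real.exp (M - e) * ∑ i ∈ s, Real.exp (t * Y i) :=
          mul_le_mul_of_nonneg_left h1 (Real.exp_pos _).le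
      _ = ∑ i ∈ s, Real.exp (M + Y i * t - e) := by
          rw [Finset.mul_sum]
          refine Finset.sum_congr rfl fun i _ => ?_
          rw [← Real.exp_add]; congr 1; ring
      _ ≤ ∑ i ∈ s, P i := Finset.sum_le_sum fun i hi => by
          rw [← Real.le_log_iff_exp_le (hP0 i hi)]
          linarith [(abs_le.mp (hP i hi)).1]
  have l2 : ∑ i ∈ s, P i ≤ c * Real.exp (M + w + (e + e')) := by
    calc ∑ i ∈ s, P i ≤ ∑ i ∈ s, Real.exp (M + Y i * t + e) := Finset.sum_le_sum fun i hi => by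
          rw [← Real.log_le_iff_le_exp (hP0 i hi)]
          linarith [(abs_le.mp (hP i hi)).2]
      _ = Real.exp (M + e) * ∑ i ∈ s, Real.exp (t * Y i) := by
          rw [Finset.mul_sum]
          refine Finset.sum_congr rfl fun i _ => ?_
          rw [← Real.exp_add]; congr 1; ring
      _ ≤ Real.exp (M + e) * (c * Real.exp (w + e')) :=
          mul_le_mul_of_nonneg_left h2 (Real.exp_pos _).le
      _ = c * Real.exp (M + w + (e + e')) := by
          rw [mul_left_comm, ← Real.exp_add]; congr 2; ring
  have hpos : 0 < ∑ i ∈ s, P i := lt_of_lt_of_le (mul_pos hc (Real.exp_pos _)) l1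
  refine ⟨Real.log ((∑ i ∈ s, P i) / c) - (M + w), ?_, ?_⟩
  · have hq : 0 < (∑ i ∈ s, P i) / c := div_pos hpos hc
    have m1 : M + w - (e + e') ≤ Real.log ((∑ i ∈ s, P i) / c) := by
      rw [Real.le_log_iff_exp_le hq, le_div_iff₀ hc, mul_comm]; exact l1
    have m2 : Real.log ((∑ i ∈ s, P i) / c) ≤ M + w + (e + e') := by
      rw [Real.log_le_iff_le_exp hq, div_le_iff₀ hc, mul_comm]; exact l2
    rw [abs_le]; constructor <;> linarith
  · rw [add_sub_cancel, Real.exp_log (div_pos hpos hc)]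
    field_simp

lemma abs_variance_sub_le {t R N : ℝ} {r : ℝ} (hL : 100 ≤ L) (hl : 1 ≤ L * lam)
    (hl0 : 0 < lam) (hl1 : lam < 1) (hN : 0 < N) (hr : 1 ≤ r) (hrN : 10 * L ^ 2 * r ≤ N)
    (ht : |t - (r - 1) / (lam * N)| ≤ 10 * L ^ 2 * r ^ 2 / N ^ 2)
    (hR0 : 0 ≤ R) (hRD : R ≤ D ^ 2) :
    |t| ≤ 2 * r / (lam * N) ∧
    |r * (t ^ 2 * R / 2) - R * r ^ 3 / (2 * lam ^ 2 * N ^ 2)| ≤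
      2 * L ^ 2 * (r ^ 2 * D ^ 2 / N ^ 2) + 20 * L ^ 3 * (r ^ 4 * D ^ 2 / N ^ 3) := by
  have hL0 : 0 < L := by linarith
  have hr0 : 0 < r := by linarith
  have hlL : 1 / lam ≤ L := by rw [div_le_iff₀ hl0]; exact hl
  have hl1' : 1 ≤ 1 / lam := by rw [le_div_iff₀ hl0]; linarith
  set i := 1 / lam with hi
  set g := 1 / N with hg
  have hg0 : 0 < g := div_pos one_pos hN
  have hgN : 10 * L ^ 2 * r * g ≤ 1 := by
    rw [hg, mul_one_div, div_le_one hN]; exact hrN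
  have e1 : (r - 1) / (lam * N) = (r - 1) * i * g := by rw [hi, hg]; field_simp
  have e2 : 10 * L ^ 2 * r ^ 2 / N ^ 2 = 10 * L ^ 2 * r * g * (r * g) := by rw [hg]; field_simp
  have e3 : 2 * r / (lam * N) = 2 * (r * i * g) := by rw [hi, hg]; field_simp
  have e4 : R * r ^ 3 / (2 * lam ^ 2 * N ^ 2) = r * ((r * i * g) ^ 2 * R / 2) := by
    rw [hi, hg]; field_simp
  have e5 : r ^ 2 * D ^ 2 / N ^ 2 = r ^ 2 * D ^ 2 * g ^ 2 := by rw [hg]; field_simp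
  have e6 : r ^ 4 * D ^ 2 / N ^ 3 = r ^ 4 * D ^ 2 * g ^ 3 := by rw [hg]; field_simp
  rw [e1, e2] at ht
  rw [e3, e4, e5, e6]
  have hrg : 0 < r * g := mul_pos hr0 hg0
  have hig : 0 < i * g := mul_pos (by linarith) hg0
  have b1 : 10 * L ^ 2 * r * g * (r * g) ≤ r * g := mul_le_of_le_one_left hrg.le hgN
  have b2 : r * g ≤ r * i * g := by
    have := mul_le_mul_of_nonneg_right hl1' hrg.le
    linarith
  have b3 : i * g ≤ L * g := mul_le_mul_of_nonneg_right hlL hg0.le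
  have ht' := abs_le.mp ht
  have hb4 : (r - 1) * i * g = r * i * g - i * g := by ring
  have hri : i * g ≤ r * i * g := by
    have := mul_le_mul_of_nonneg_right hr hig.le
    linarith
  have ht2 : |t| ≤ 2 * (r * i * g) := by
    rw [abs_le]; constructor <;> linarith
  refine ⟨ht2, ?_⟩
  have d1 : |t - r * i * g| ≤ L * g + 10 * L ^ 2 * r * g * (r * g) := by
    rw [abs_le]; constructor <;> linarith
  have d2 : |t + r * i * g| ≤ 4 * L * r * g := by
    have : r * i * g ≤ L * r * g := by
      have := mul_le_mul_of_nonneg_right hlL hrg.le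
      linarith
    have h3 := abs_add_le t (r * i * g)
    have h4 : |r * i * g| = r * i * g := abs_of_pos (by linarith)
    rw [h4] at h3
    have : 0 < r * i * g := by linarith
    linarith
  rw [show r * (t ^ 2 * R / 2) - r * ((r * i * g) ^ 2 * R / 2) =
    r * R / 2 * ((t - r * i * g) * (t + r * i * g)) by ring, abs_mul, abs_mul,
    abs_of_nonneg (by positivity : 0 ≤ r * R / 2)]
  calc _ ≤ r * D ^ 2 / 2 * ((L * g + 10 * L ^ 2 * r * g * (r * g)) * (4 * L * r * g)) := by
        refine mul_le_mul ?_ (mul_le_mul d1 d2 (abs_nonneg _) (by positivity)) (by positivity)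
          (by positivity)
        exact div_le_div_of_nonneg_right (mul_le_mul_of_nonneg_left hRD hr0.le) two_pos.le
    _ = _ := by ring

set_option maxHeartbeats 1000000 in
/-- Collecting the error terms. -/
lemma error_sum_le {s r Z : ℝ} (hL : 100 ≤ L) (hs : 0 < s) (hr : 0 ≤ r) (hrs : r ≤ L * s)
    (hD : 0 ≤ D) (hsL : L ^ 50 ≤ s) (hZ : r ^ 4 * D ^ 3 / (s ^ 2) ^ 3 ≤ Z) :
    r * (r * (L ^ 37 / s ^ 3 + 3 * L ^ 3 * D ^ 2 / (s ^ 2) ^ 2)) +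
      (336 * Z + 336 * L ^ 2 * (r ^ 4 * D ^ 2 / (s ^ 2) ^ 3)) +
      (L * r / s ^ 2 + 9 * L ^ 2 * r ^ 3 / (s ^ 2) ^ 2) +
      (2 * L ^ 2 * (r ^ 2 * D ^ 2 / (s ^ 2) ^ 2) + 20 * L ^ 3 * (r ^ 4 * D ^ 2 / (s ^ 2) ^ 3)) ≤
    L ^ 41 / s + 337 * Z + L ^ 4 * (r ^ 2 * D ^ 2 / (s ^ 2) ^ 2) := by
  have hL0 : 0 < L := by linarith
  have hpow : ∀ k m : ℕ, k ≤ m → L ^ k ≤ L ^ m := fun k m hkm =>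
    pow_le_pow_right₀ (by linarith) hkm
  set h := 1 / s with hh
  have hh0 : 0 < h := div_pos one_pos hs
  have hrh : r * h ≤ L := by rw [hh, mul_one_div, div_le_iff₀ hs]; exact hrs
  have hrh0 : 0 ≤ r * h := mul_nonneg hr hh0.le
  have hLh : L ^ 50 * h ≤ 1 := by rw [hh, mul_one_div, div_le_one hs]; exact hsL
  have e1 : L ^ 37 / s ^ 3 = L ^ 37 * h ^ 3 := by rw [hh]; field_simp
  have e2 : 3 * L ^ 3 * D ^ 2 / (s ^ 2) ^ 2 = 3 * L ^ 3 * D ^ 2 * h ^ 4 := by rw [hh]; field_simp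
  have e3 : r ^ 4 * D ^ 2 / (s ^ 2) ^ 3 = (r * h) ^ 4 * D ^ 2 * h ^ 2 := by rw [hh]; field_simp
  have e4 : L * r / s ^ 2 = L * (r * h) * h := by rw [hh]; field_simp
  have e5 : 9 * L ^ 2 * r ^ 3 / (s ^ 2) ^ 2 = 9 * L ^ 2 * (r * h) ^ 3 * h := by
    rw [hh]; field_simp
  have e6 : r ^ 2 * D ^ 2 / (s ^ 2) ^ 2 = (r * h) ^ 2 * D ^ 2 * h ^ 2 := by rw [hh]; field_simp
  have e7 : L ^ 41 / s = L ^ 41 * h := by rw [hh]; field_simp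
  have e8 : r ^ 4 * D ^ 3 / (s ^ 2) ^ 3 = (r * h) ^ 4 * D ^ 3 * h ^ 2 := by rw [hh]; field_simp
  rw [e8] at hZ
  rw [e1, e2, e3, e4, e5, e6, e7]
  set y := r * h with hy
  have p1 : y ^ 2 ≤ L ^ 2 := pow_le_pow_left₀ hrh0 hrh 2
  have p2 : y ^ 3 ≤ L ^ 3 := pow_le_pow_left₀ hrh0 hrh 3
  have p3 : y ^ 4 ≤ L ^ 4 := pow_le_pow_left₀ hrh0 hrh 4
  have f1 : r * (r * (L ^ 37 * h ^ 3 + 3 * L ^ 3 * D ^ 2 * h ^ 4)) =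
      L ^ 37 * y ^ 2 * h + 3 * L ^ 3 * (y ^ 2 * D ^ 2 * h ^ 2) := by rw [hy]; ring
  rw [f1]
  have q1 : L ^ 37 * y ^ 2 * h ≤ L ^ 39 * h := by
    calc L ^ 37 * y ^ 2 * h ≤ L ^ 37 * L ^ 2 * h :=
          mul_le_mul_of_nonneg_right (mul_le_mul_of_nonneg_left p1 (by positivity)) hh0.le
      _ = _ := by ring
  have q2 : L * y * h ≤ L ^ 39 * h := by
    refine mul_le_mul_of_nonneg_right ?_ hh0.le
    calc L * y ≤ L * L := mul_le_mul_of_nonneg_left hrh hL0.le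
      _ = L ^ 2 := by ring
      _ ≤ _ := hpow 2 39 (by norm_num)
  have q3 : 9 * L ^ 2 * y ^ 3 * h ≤ 9 * L ^ 39 * h := by
    refine mul_le_mul_of_nonneg_right ?_ hh0.le
    calc 9 * L ^ 2 * y ^ 3 ≤ 9 * L ^ 2 * L ^ 3 := mul_le_mul_of_nonneg_left p2 (by positivity)
      _ = 9 * L ^ 5 := by ring
      _ ≤ _ := by have := hpow 5 39 (by norm_num); linarith
  have q4 : (336 * L ^ 2 + 20 * L ^ 3) * (y ^ 4 * D ^ 2 * h ^ 2) ≤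
      y ^ 4 * D ^ 3 * h ^ 2 + L ^ 39 * h := by
    have g2 : 0 ≤ L ^ 39 * h := by positivity
    have g3 : 0 ≤ y ^ 4 * D ^ 3 * h ^ 2 := by positivity
    have g1 : 336 * L ^ 2 + 20 * L ^ 3 ≤ L ^ 4 := by
      have : L ^ 4 = L ^ 2 * L ^ 2 := by ring
      have h3 : L ^ 3 = L * L ^ 2 := by ring
      have h2 : 0 ≤ L ^ 2 := sq_nonneg L
      nlinarith
    have g4 : 0 ≤ y ^ 4 * D ^ 2 * h ^ 2 := by positivity
    refine (mul_le_mul_of_nonneg_right g1 g4).trans ?_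
    rcases le_total (L ^ 4) D with hc | hc
    · have := mul_le_mul_of_nonneg_right hc g4
      have e : D * (y ^ 4 * D ^ 2 * h ^ 2) = y ^ 4 * D ^ 3 * h ^ 2 := by ring
      linarith
    · have h1 : D ^ 2 ≤ (L ^ 4) ^ 2 := pow_le_pow_left₀ hD hc 2
      have h2 : y ^ 4 * D ^ 2 ≤ L ^ 4 * (L ^ 4) ^ 2 :=
        mul_le_mul p3 h1 (sq_nonneg D) (by positivity)
      have h3 : h ≤ 1 := by
        have : 1 ≤ L ^ 50 := one_le_pow₀ (by linarith)
        have := mul_le_mul_of_nonneg_right this hh0.le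
        linarith
      have h4 : h ^ 2 ≤ h := by nlinarith
      calc L ^ 4 * (y ^ 4 * D ^ 2 * h ^ 2) = L ^ 4 * ((y ^ 4 * D ^ 2) * h ^ 2) := by ring
        _ ≤ L ^ 4 * ((L ^ 4 * (L ^ 4) ^ 2) * h) :=
            mul_le_mul_of_nonneg_left (mul_le_mul h2 h4 (sq_nonneg h) (by positivity))
              (by positivity)
        _ = L ^ 16 * h := by ring
        _ ≤ L ^ 39 * h := mul_le_mul_of_nonneg_right (hpow 16 39 (by norm_num)) hh0.le
        _ ≤ _ := by linarith
  have q5 : (3 * L ^ 3 + 2 * L ^ 2) * (y ^ 2 * D ^ 2 * h ^ 2) ≤ L ^ 4 * (y ^ 2 * D ^ 2 * h ^ 2) := by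
    refine mul_le_mul_of_nonneg_right ?_ (by positivity)
    have h4 : L ^ 4 = L * L ^ 3 := by ring
    have h2 := hpow 2 3 (by norm_num)
    have h3 : 0 ≤ L ^ 3 := by positivity
    nlinarith
  have q6 : 12 * L ^ 39 * h ≤ L ^ 41 * h := by
    refine mul_le_mul_of_nonneg_right ?_ hh0.le
    have h4 : L ^ 41 = L ^ 2 * L ^ 39 := by ring
    have h2 : 12 ≤ L ^ 2 := by
      have := pow_le_pow_left₀ (by norm_num) hL 2
      linarith only [this]
    rw [h4]
    exact mul_le_mul_of_nonneg_right h2 (pow_nonneg hL0.le 39)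
  linarith only [q1, q2, q3, q4, q5, q6, hZ]

set_option maxHeartbeats 1000000 in
/-- The expected number of cliques with an explicit error term. -/
theorem NearRegular.exists_expCliques_eq (h : NearRegular L lam D d) (hr1 : 1 ≤ r)
    (hr : (r : ℝ) ≤ L * √n) (hne : (degFinset n d).Nonempty)
    (hlam : dbar n d = lam * ((n : ℝ) - 1)) (hx : 2 * (r : ℝ) / (lam * n) * D ≤ 1 / 20) :
    ∃ E : ℝ, |E| ≤ L ^ 41 / √n + 337 * (D ^ 3 * (r : ℝ) ^ 4 / (lam ^ 3 * (n : ℝ) ^ 3)) +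
        L ^ 4 * ((r : ℝ) ^ 2 * D ^ 2 / (n : ℝ) ^ 2) ∧
      expCliques n d r = (Nat.choose n r : ℝ) * lam ^ (Nat.choose r 2) *
        Real.exp (-((1 - lam) * (r : ℝ) ^ 2 * ((r : ℝ) - 3) / (2 * lam * n))
          + Rpar n d * (r : ℝ) ^ 3 / (2 * lam ^ 2 * (n : ℝ) ^ 2)
          - (1 - lam) * (2 + 5 * lam) * (r : ℝ) ^ 4 / (12 * lam ^ 2 * (n : ℝ) ^ 2) + E) := by
  have hL := h.L_ge
  have hL0 : 0 < L := by linarith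
  have hB : Big n L := h.big.mono hL (by linarith)
  obtain ⟨hs0, hns, hn0, hn1⟩ := hB.basic
  have hl0 : 0 < lam := by
    by_contra hneg
    have := h.lam_lo
    nlinarith
  have hl1 : lam < 1 := by
    by_contra hneg
    have := h.lam_hi
    nlinarith
  have hr1' : (1 : ℝ) ≤ r := by exact_mod_cast hr1
  have hr0 : (0 : ℝ) < r := by linarith
  have hLs : L ^ 50 ≤ √(n : ℝ) := hB.pow_le_sqrt le_rfl
  have hrn : 10 * L ^ 2 * r ≤ n := by
    have h1 : 10 * L ^ 3 ≤ L ^ 50 := by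
      have h2 : L ^ 4 ≤ L ^ 50 := pow_le_pow_right₀ (by linarith) (by norm_num)
      have h3 : L ^ 4 = L * L ^ 3 := by ring
      have h4 : 0 ≤ L ^ 3 := pow_nonneg hL0.le 3
      nlinarith
    calc 10 * L ^ 2 * r ≤ 10 * L ^ 2 * (L * √n) :=
          mul_le_mul_of_nonneg_left hr (mul_nonneg (by norm_num) (sq_nonneg L))
      _ = 10 * L ^ 3 * √n := by ring
      _ ≤ √n * √n := mul_le_mul_of_nonneg_right (h1.trans hLs) hs0.le
      _ = n := by rw [← sq]; exact hns.symm
  have hrn2 : 2 * (r : ℝ) ≤ n := by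
    have : 2 * (r : ℝ) ≤ 10 * L ^ 2 * r := by
      refine mul_le_mul_of_nonneg_right ?_ hr0.le
      nlinarith
    linarith
  have hD0 : 0 ≤ D := by
    have hn : 0 < n := Nat.cast_pos.mp hn0
    exact (abs_nonneg _).trans (h.dev_le ⟨0, hn⟩)
  set δ : Fin n → ℝ := fun u => (d u : ℝ) - lam * ((n : ℝ) - 1) with hδ
  have hδD : ∀ v, |δ v| ≤ D := h.dev_le
  have hδ0 : ∑ v, δ v = 0 := by
    simp only [hδ, Finset.sum_sub_distrib, h.deg_sum, Finset.sum_const, Finset.card_univ,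
      Fintype.card_fin, nsmul_eq_mul]
    ring
  have hRsum : ∑ v, δ v ^ 2 = n * Rpar n d := by
    rw [Rpar, hlam, mul_div_cancel₀ _ hn0.ne']
  have hR0 : 0 ≤ Rpar n d := by
    rw [Rpar]; exact div_nonneg (Finset.sum_nonneg fun v _ => sq_nonneg _) hn0.le
  have hRD : Rpar n d ≤ D ^ 2 := by
    have h1 : ∑ v, δ v ^ 2 ≤ n * D ^ 2 := by
      calc ∑ v, δ v ^ 2 ≤ ∑ _v : Fin n, D ^ 2 := Finset.sum_le_sum fun v _ => by
            rw [← sq_abs]; exact pow_le_pow_left₀ (abs_nonneg _) (hδD v) 2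
        _ = _ := by simp
    rw [hRsum] at h1
    exact le_of_mul_le_mul_left h1 hn0
  set t := (∑ j ∈ Finset.range r, ∑ i ∈ Finset.range j, linTerm n lam j i 1 1 (i + (j - 1))) / r
    with ht
  have ht1 := abs_sum_linTerm_sub_le hL h.lam_lo hl0 hl1 hn0 hr1
  rw [← ht] at ht1
  obtain ⟨htabs, hvar⟩ := abs_variance_sub_le hL h.lam_lo hl0 hl1 hn0 hr1' hrn ht1 hR0 hRD
  set x := 2 * (r : ℝ) / (lam * n) * D with hxdef
  have htx : |t| * D ≤ x := mul_le_mul_of_nonneg_right htabs hD0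
  have hp0 : 0 ≤ 2 * (r : ℝ) / n := div_nonneg (by linarith) hn0.le
  obtain ⟨s1, s2⟩ := sum_exp_bounds (δ := δ) (R := Rpar n d) (t := t) (x := x)
    (p := 2 * (r : ℝ) / n) (m := r) (r := r) hδD hδ0 (by rw [Fintype.card_fin]; exact hRsum)
    (by rw [Fintype.card_fin, div_mul_cancel₀ _ hn0.ne'])
    ((div_le_one hn0).mpr hrn2) hp0 hx hD0 hRD hR0 le_rfl htx
  rw [Fintype.card_fin] at s1 s2
  have hc : 0 < (n.choose r : ℝ) := by
    have h1 : (r : ℝ) ≤ n := by linarith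
    exact_mod_cast Nat.choose_pos (Nat.cast_le.mp h1)
  have hdpos : (0 : ℝ) < (degFinset n d).card := Nat.cast_pos.mpr (Finset.card_pos.mpr hne)
  have hcl : ∀ S ∈ Finset.powersetCard r (Finset.univ : Finset (Fin n)), _ := fun S hS =>
    h.abs_log_cliquesOn_le hr1 hr (Finset.mem_powersetCard.mp hS).2 hne
  have hcpos : ∀ S ∈ Finset.powersetCard r (Finset.univ : Finset (Fin n)),
      (0 : ℝ) < (cliquesOn d S).card := fun S hS =>
    Nat.cast_pos.mpr (Finset.card_pos.mpr (hcl S hS).1)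
  obtain ⟨E, hE, hsum⟩ := exists_exp_of_sum (P := fun S => ((cliquesOn d S).card : ℝ) /
    (degFinset n d).card) (Y := fun S => ∑ v ∈ S, δ v) (t := t)
    (M := ∑ j ∈ Finset.range r, ∑ i ∈ Finset.range j, (Real.log lam + regTerm n lam j i)) hc
    (fun S hS => div_pos (hcpos S hS) hdpos)
    (fun S hS => by
      rw [Real.log_div (hcpos S hS).ne' hdpos.ne']
      exact (hcl S hS).2) s1 s2
  have hreg := abs_sum_regTerm_sub_le hL h.lam_lo hl0 hl1 hn0 hr1
  set A := -((1 - lam) * (r : ℝ) ^ 2 * ((r : ℝ) - 3) / (2 * lam * n)) with hA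
  set B := (1 - lam) * (2 + 5 * lam) * (r : ℝ) ^ 4 / (12 * lam ^ 2 * (n : ℝ) ^ 2) with hBdef
  set V := Rpar n d * (r : ℝ) ^ 3 / (2 * lam ^ 2 * (n : ℝ) ^ 2) with hV
  set Q := ∑ j ∈ Finset.range r, ∑ i ∈ Finset.range j, regTerm n lam j i with hQ
  have hM : ∑ j ∈ Finset.range r, ∑ i ∈ Finset.range j, (Real.log lam + regTerm n lam j i) =
      (r.choose 2 : ℕ) * Real.log lam + Q := by
    have h1 : ∀ m : ℕ, ∑ j ∈ Finset.range m, ∑ _i ∈ Finset.range j, Real.log lam =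
        (m.choose 2 : ℕ) * Real.log lam := by
      intro m
      simp only [Finset.sum_const, Finset.card_range, nsmul_eq_mul]
      rw [← Finset.sum_mul, ← Nat.cast_sum, Finset.sum_range_id, Nat.choose_two_right]
    simp only [Finset.sum_add_distrib, h1, hQ]
  have hpow : lam ^ (r.choose 2) = Real.exp ((r.choose 2 : ℕ) * Real.log lam) := by
    rw [Real.exp_nat_mul, Real.exp_log hl0]
  refine ⟨E + (Q - (A - B)) + (r * (t ^ 2 * Rpar n d / 2) - V), ?_, ?_⟩
  · have hE2 : |E + (Q - (A - B)) + (r * (t ^ 2 * Rpar n d / 2) - V)| ≤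
        (r * (r * (L ^ 37 / √n ^ 3 + 3 * L ^ 3 * D ^ 2 / n ^ 2)) +
          r * (42 * (x ^ 3 + x ^ 2 * (2 * (r : ℝ) / n)))) +
        (L * r / n + 9 * L ^ 2 * r ^ 3 / n ^ 2) +
        (2 * L ^ 2 * (r ^ 2 * D ^ 2 / n ^ 2) + 20 * L ^ 3 * (r ^ 4 * D ^ 2 / n ^ 3)) :=
      (abs_add_le _ _).trans (add_le_add ((abs_add_le _ _).trans (add_le_add hE hreg)) hvar)
    have hlL : 1 / lam ≤ L := by rw [div_le_iff₀ hl0]; exact h.lam_lo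
    have hli : 0 ≤ 1 / lam := (div_pos one_pos hl0).le
    have hZ0 : (r : ℝ) ^ 4 * D ^ 3 / (n : ℝ) ^ 3 ≤
        D ^ 3 * (r : ℝ) ^ 4 / (lam ^ 3 * (n : ℝ) ^ 3) := by
      rw [mul_comm]
      refine div_le_div_of_nonneg_left (mul_nonneg (pow_nonneg hD0 3) (pow_nonneg hr0.le 4))
        (mul_pos (pow_pos hl0 3) (pow_pos hn0 3)) ?_
      exact mul_le_of_le_one_left (pow_nonneg hn0.le 3) (pow_le_one₀ hl0.le hl1.le)
    have hxx : (r : ℝ) * (42 * (x ^ 3 + x ^ 2 * (2 * (r : ℝ) / n))) ≤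
        336 * (D ^ 3 * (r : ℝ) ^ 4 / (lam ^ 3 * (n : ℝ) ^ 3)) +
          336 * L ^ 2 * ((r : ℝ) ^ 4 * D ^ 2 / n ^ 3) := by
      have e1 : (r : ℝ) * (42 * (x ^ 3 + x ^ 2 * (2 * (r : ℝ) / n))) =
          336 * (D ^ 3 * (r : ℝ) ^ 4 / (lam ^ 3 * (n : ℝ) ^ 3)) +
          336 * (1 / lam) ^ 2 * ((r : ℝ) ^ 4 * D ^ 2 / n ^ 3) := by
        rw [hxdef]; field_simp; ring
      rw [e1]
      have e2 := pow_le_pow_left₀ hli hlL 2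
      have e3 : 0 ≤ (r : ℝ) ^ 4 * D ^ 2 / (n : ℝ) ^ 3 :=
        div_nonneg (mul_nonneg (pow_nonneg hr0.le 4) (sq_nonneg D)) (pow_nonneg hn0.le 3)
      have e4 := mul_le_mul_of_nonneg_right e2 e3
      linarith
    have hfin := error_sum_le (s := √(n : ℝ)) (r := r) (D := D)
      (Z := D ^ 3 * (r : ℝ) ^ 4 / (lam ^ 3 * (n : ℝ) ^ 3)) hL hs0 hr0.le hr hD0 hLs
      (by rw [← hns]; exact hZ0)
    rw [← hns] at hfin
    linarith
  · rw [expCliques_eq_sum, hsum, hpow, mul_assoc, ← Real.exp_add, hM]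
    congr 2
    ring

end

/-! ### Asymptotics -/

/-- For large `n`, the power `n ^ (2 ε)` dominates the constants and logarithms involved. -/
lemma eventually_rpow_bounds {a b C₀ ε : ℝ} (hb : 0 < b) (hε : 0 < ε)
    (hε' : 400 * ε = 1 / 2 - b) :
    ∀ᶠ x : ℝ in Filter.atTop, 3 ≤ x ∧ 100 ≤ x ^ (2 * ε) ∧ (4 * x ^ (2 * ε)) ^ 100 ≤ x ∧
      C₀ ≤ x ^ ε ∧ 3 * a * Real.log x ≤ x ^ (2 * ε) ∧ 8 * (C₀ * x ^ (-b)) ≤ (1 / 20) ^ 3 := by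
  have h2 : 0 < 2 * ε := by linarith
  have t1 := tendsto_rpow_atTop hε
  have t2 := tendsto_rpow_atTop h2
  have t3 : Filter.Tendsto (fun x : ℝ => x ^ (1 - 200 * ε)) Filter.atTop Filter.atTop :=
    tendsto_rpow_atTop (by linarith)
  have t4 : Filter.Tendsto (fun x : ℝ => 8 * (C₀ * x ^ (-b))) Filter.atTop (nhds 0) := by
    have := ((tendsto_rpow_neg_atTop hb).const_mul C₀).const_mul 8
    simpa using this
  have t5 := ((isLittleO_log_rpow_atTop h2).const_mul_left (3 * a)).bound one_pos
  filter_upwards [Filter.eventually_ge_atTop 3, t2.eventually_ge_atTop 100,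
    t3.eventually_ge_atTop (4 ^ 100), t1.eventually_ge_atTop C₀, t5,
    t4.eventually_le_const (show (0 : ℝ) < (1 / 20) ^ 3 by norm_num)] with x h3 k2 k3 k1 k5 k4
  have hx : 0 < x := by linarith
  refine ⟨h3, k2, ?_, k1, ?_, k4⟩
  · rw [mul_pow, ← Real.rpow_natCast (x ^ (2 * ε)), ← Real.rpow_mul hx.le]
    calc (4 : ℝ) ^ 100 * x ^ (2 * ε * (100 : ℕ)) ≤
          x ^ (1 - 200 * ε) * x ^ (2 * ε * (100 : ℕ)) :=
          mul_le_mul_of_nonneg_right k3 (Real.rpow_nonneg hx.le _)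
      _ = x ^ (1 : ℝ) := by
          rw [← Real.rpow_add hx]
          congr 1
          push_cast
          ring
      _ = x := Real.rpow_one x
  · rw [one_mul, Real.norm_eq_abs, Real.norm_eq_abs, abs_of_pos (Real.rpow_pos_of_pos hx _)] at k5
    exact (le_abs_self _).trans k5

lemma pow_div_sqrt_le {x b ε : ℝ} (hx : 1 ≤ x) (hε : 0 < ε) (hε' : 400 * ε = 1 / 2 - b) :
    (x ^ (2 * ε)) ^ 41 / √x ≤ x ^ (-b) := by
  have hx0 : 0 < x := by linarith
  rw [Real.sqrt_eq_rpow, ← Real.rpow_natCast (x ^ (2 * ε)), ← Real.rpow_mul hx0.le,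
    ← Real.rpow_sub hx0]
  refine Real.rpow_le_rpow_of_exponent_le hx ?_
  push_cast
  linarith

/-- The error term controlled through the third moment condition. -/
lemma sq_error_le {L D r lam x w C₀ : ℝ} (hL : 100 ≤ L) (hx : 0 < x) (hw : 0 < w)
    (hC : 0 < C₀) (hl0 : 0 < lam) (hl1 : lam ≤ 1) (hD0 : 0 ≤ D) (hD : D ≤ L * √x)
    (hr : 0 ≤ r) (hLw : L ^ 41 / √x ≤ w)
    (hZ : D ^ 3 * r ^ 4 / (lam ^ 3 * x ^ 3) ≤ C₀ * w) :
    L ^ 4 * (r ^ 2 * D ^ 2 / x ^ 2) ≤ (1 + C₀) * w := by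
  have hL0 : 0 < L := by linarith
  have hs : 0 < √x := Real.sqrt_pos.mpr hx
  have hsx : x = √x ^ 2 := (Real.sq_sqrt hx.le).symm
  have h1 : D ^ 3 * r ^ 4 / x ^ 3 ≤ C₀ * w := by
    refine le_trans ?_ hZ
    refine div_le_div_of_nonneg_left (mul_nonneg (pow_nonneg hD0 3) (pow_nonneg hr 4))
      (mul_pos (pow_pos hl0 3) (pow_pos hx 3)) ?_
    exact mul_le_of_le_one_left (pow_nonneg hx.le 3) (pow_le_one₀ hl0.le hl1)
  have h2 : D / x ≤ L / √x := by
    rw [div_le_div_iff₀ hx hs]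
    calc D * √x ≤ L * √x * √x := mul_le_mul_of_nonneg_right hD hs.le
      _ = L * √x ^ 2 := by ring
      _ = L * x := by rw [← hsx]
  have h3 : L ^ 9 / √x ≤ w := by
    refine le_trans ?_ hLw
    exact div_le_div_of_nonneg_right (pow_le_pow_right₀ (by linarith) (by norm_num)) hs.le
  have h4 : (L ^ 4 * (r ^ 2 * D ^ 2 / x ^ 2)) ^ 2 ≤ ((1 + C₀) * w) ^ 2 := by
    calc (L ^ 4 * (r ^ 2 * D ^ 2 / x ^ 2)) ^ 2 =
          L ^ 8 * ((D ^ 3 * r ^ 4 / x ^ 3) * (D / x)) := by field_simp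
      _ ≤ L ^ 8 * ((C₀ * w) * (L / √x)) :=
          mul_le_mul_of_nonneg_left (mul_le_mul h1 h2 (div_nonneg hD0 hx.le)
            (mul_pos hC hw).le) (pow_nonneg hL0.le 8)
      _ = C₀ * w * (L ^ 9 / √x) := by ring
      _ ≤ C₀ * w * w := mul_le_mul_of_nonneg_left h3 (mul_pos hC hw).le
      _ = C₀ * w ^ 2 := by ring
      _ ≤ (1 + C₀) ^ 2 * w ^ 2 :=
          mul_le_mul_of_nonneg_right (by nlinarith) (sq_nonneg w)
      _ = _ := by ring
  exact (abs_le_of_sq_le_sq' h4 (mul_pos (by linarith) hw).le).2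

/-- The size of the linear tilt is small under the third moment condition. -/
lemma tilt_le {D r lam x w : ℝ} (hx : 0 < x) (hl0 : 0 < lam) (hD0 : 0 ≤ D) (hr : 1 ≤ r)
    (hZ : D ^ 3 * r ^ 4 / (lam ^ 3 * x ^ 3) ≤ w) (hw : 8 * w ≤ (1 / 20) ^ 3) :
    2 * r / (lam * x) * D ≤ 1 / 20 := by
  have h0 : 0 ≤ D ^ 3 * r ^ 3 / (lam ^ 3 * x ^ 3) := by positivity
  have h1 : (2 * r / (lam * x) * D) ^ 3 = 8 * (D ^ 3 * r ^ 3 / (lam ^ 3 * x ^ 3)) := by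
    field_simp
    ring
  have h2 : D ^ 3 * r ^ 4 / (lam ^ 3 * x ^ 3) = D ^ 3 * r ^ 3 / (lam ^ 3 * x ^ 3) * r := by ring
  have h3 := mul_le_mul_of_nonneg_left hr h0
  refine le_of_pow_le_pow_left₀ (n := 3) (by norm_num) (by norm_num) ?_
  rw [h1]
  linarith

lemma abs_sub_dbar_le_deltaPar {n : ℕ} (d : Fin n → ℕ) (j : Fin n) :
    |(d j : ℝ) - dbar n d| ≤ deltaPar n d :=
  le_ciSup (f := fun j => |(d j : ℝ) - dbar n d|) (Set.finite_range _).bddAbove j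

/-- The density is bounded away from `0` and `1`. -/
lemma one_le_mul_div_of_log {x m c L : ℝ} (hx : 3 ≤ x) (hc : 0 < c)
    (hL : c * Real.log x ≤ L) (hm : x / (c * Real.log x) ≤ m) :
    1 ≤ L * (m / (x - 1)) := by
  have hlog : 0 < Real.log x := Real.log_pos (by linarith)
  have hcl : 0 < c * Real.log x := mul_pos hc hlog
  rw [div_le_iff₀ hcl] at hm
  have hm0 : 0 < m := by
    by_contra h
    have := mul_nonneg (neg_nonneg.mpr (not_lt.mp h)) hcl.le
    linarith
  rw [← mul_div_assoc, le_div_iff₀ (by linarith), one_mul]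
  have := mul_le_mul_of_nonneg_left hL hm0.le
  linarith

/-- The hypotheses of the theorem make `d` near-regular. -/
lemma NearRegular.of_bounds {n : ℕ} {L a : ℝ} {d : Fin n → ℕ} (hn : 3 ≤ (n : ℝ)) (ha : 0 < a)
    (hL : 100 ≤ L) (hLn : (4 * L) ^ 100 ≤ n) (hlog : 3 * a * Real.log n ≤ L)
    (hδ : deltaPar n d ≤ L * √n)
    (hmin : min (dbar n d) ((n : ℝ) - dbar n d - 1) ≥ (n : ℝ) / (3 * a * Real.log n)) :
    dbar n d = lam n d * ((n : ℝ) - 1) ∧ NearRegular L (lam n d) (deltaPar n d) d := by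
  have hlam : dbar n d = lam n d * ((n : ℝ) - 1) := by
    rw [lam, div_mul_cancel₀ _ (by linarith : ((n : ℝ) - 1) ≠ 0)]
  have h1 : 1 - lam n d = ((n : ℝ) - dbar n d - 1) / ((n : ℝ) - 1) := by
    rw [lam, eq_div_iff (by linarith : ((n : ℝ) - 1) ≠ 0), sub_mul,
      div_mul_cancel₀ _ (by linarith : ((n : ℝ) - 1) ≠ 0)]
    ring
  refine ⟨hlam, ⟨⟨by linarith, hLn⟩, hL, ?_, ?_, fun v => ?_, fun v => ?_, ?_⟩⟩
  · exact one_le_mul_div_of_log hn (by linarith) hlog (hmin.trans (min_le_left _ _))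
  · rw [h1]
    exact one_le_mul_div_of_log hn (by linarith) hlog (hmin.trans (min_le_right _ _))
  · rw [← hlam]; exact (abs_sub_dbar_le_deltaPar d v).trans hδ
  · rw [← hlam]; exact abs_sub_dbar_le_deltaPar d v
  · have : ∑ v, (d v : ℝ) = dbar n d * n := by
      rw [dbar, div_mul_cancel₀ _ (by linarith : (n : ℝ) ≠ 0)]
    rw [this, hlam]
    ring

theorem statement19 (a b C₀ : ℝ) (ha : 0 < a) (hb : 0 < b) (hab : a + b < 1 / 2)
    (hC₀ : 0 < C₀) :
    ∃ ε : ℝ, 0 < ε ∧ ∃ C : ℝ, 0 < C ∧ ∃ N : ℕ, ∀ n : ℕ, N ≤ n →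
      ∀ d : Fin n → ℕ, (degFinset n d).Nonempty →
        deltaPar n d ≤ C₀ * (n : ℝ) ^ ((1 : ℝ) / 2 + ε) →
        min (dbar n d) ((n : ℝ) - dbar n d - 1) ≥ (n : ℝ) / (3 * a * Real.log n) →
        ∀ r : ℕ, 0 < r → (r : ℝ) ≤ C₀ * (n : ℝ) ^ ((1 : ℝ) / 2 + ε) →
          (deltaPar n d) ^ 3 * (r : ℝ) ^ 4 / ((lam n d) ^ 3 * (n : ℝ) ^ 3) ≤
            C₀ * (n : ℝ) ^ (-b) →
          ∃ E : ℝ, |E| ≤ C * (n : ℝ) ^ (-b) ∧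
            expCliques n d r =
              (Nat.choose n r : ℝ) * (lam n d) ^ (Nat.choose r 2) *
                Real.exp (
                  -((1 - lam n d) * (r : ℝ) ^ 2 * ((r : ℝ) - 3) /
                      (2 * lam n d * n))
                  + Rpar n d * (r : ℝ) ^ 3 / (2 * (lam n d) ^ 2 * (n : ℝ) ^ 2)
                  - (1 - lam n d) * (2 + 5 * lam n d) * (r : ℝ) ^ 4 /
                      (12 * (lam n d) ^ 2 * (n : ℝ) ^ 2)
                  + E) := by
  set ε := (1 / 2 - b) / 400 with hεdef
  have hε' : 400 * ε = 1 / 2 - b := by rw [hεdef]; ring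
  have hε : 0 < ε := by linarith
  refine ⟨ε, hε, 2 + 338 * C₀, by linarith, ?_⟩
  obtain ⟨N, hN⟩ := Filter.eventually_atTop.mp (tendsto_natCast_atTop_atTop.eventually
    (eventually_rpow_bounds (a := a) (C₀ := C₀) hb hε hε'))
  refine ⟨N, fun n hn d hne hδ hmin r hr0 hr hZ => ?_⟩
  obtain ⟨hn3, hL, hLn, hC, hlog, hw⟩ := hN n hn
  have hx : (0 : ℝ) < n := by linarith
  set L := (n : ℝ) ^ (2 * ε) with hLdef
  set w := (n : ℝ) ^ (-b) with hwdef
  have hw0 : 0 < w := Real.rpow_pos_of_pos hx _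
  have hCL : C₀ * (n : ℝ) ^ ((1 : ℝ) / 2 + ε) ≤ L * √n := by
    calc C₀ * (n : ℝ) ^ ((1 : ℝ) / 2 + ε) ≤ (n : ℝ) ^ ε * (n : ℝ) ^ ((1 : ℝ) / 2 + ε) :=
          mul_le_mul_of_nonneg_right hC (Real.rpow_nonneg hx.le _)
      _ = L * √n := by
          rw [Real.sqrt_eq_rpow, hLdef, ← Real.rpow_add hx, ← Real.rpow_add hx]
          congr 1
          ring
  have hr1 : (1 : ℝ) ≤ r := by exact_mod_cast hr0
  obtain ⟨hlam, hreg⟩ := NearRegular.of_bounds hn3 ha hL hLn hlog (hδ.trans hCL) hmin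
  have hl0 : 0 < lam n d := by
    by_contra hneg
    have := hreg.lam_lo
    nlinarith
  have hl1 : lam n d ≤ 1 := by
    by_contra hneg
    have := hreg.lam_hi
    nlinarith
  have hD0 : 0 ≤ deltaPar n d := Real.iSup_nonneg fun _ => abs_nonneg _
  obtain ⟨E, hE, heq⟩ := hreg.exists_expCliques_eq hr0 (hr.trans hCL) hne hlam
    (tilt_le hx hl0 hD0 hr1 hZ hw)
  refine ⟨E, hE.trans ?_, heq⟩
  have hLw : L ^ 41 / √(n : ℝ) ≤ w := pow_div_sqrt_le (by linarith) hε hε'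
  have h3 := sq_error_le hL hx hw0 hC₀ hl0 hl1 hD0 (hδ.trans hCL) (by linarith) hLw hZ
  linarith

end Stmt19
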